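/- The natural ring homomorphism from ℂ[h_{i,s} : 1 ≤ i ≤ M+N−1, s ∈ ℤ∖{0}][K_i^{±1} : 1 ≤ i ≤ M+N−1] (polynomial algebra in the h_{i,s} tensored with the Laurent polynomial algebra in the K_i) to U⁰, sending each generator to the element of the same name, is an isomorphism; in particular U⁰ is a commutative algebra of Laurent polynomials. -/

import Mathlib

noncomputable section

namespace QAS

open Polynomial
open scoped TensorProduct

/-! ### Basic combinatorial data -/

/-- `l_i = 1` for `i ≤ M`, `-1` otherwise. -/
def lof (M : ℕ) (i : ℕ) : ℤ := if i ≤ M then 1 else -1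

/-- the bilinear form `(ε_i, ε_j) = l_i δ_{ij}`. -/
def innerE (M : ℕ) (i j : ℕ) : ℤ := if i = j then lof M i else 0

/-- `(ε_a − ε_b, ε_c − ε_d)`. -/
def form4 (M : ℕ) (a b c d : ℕ) : ℤ :=
  innerE M a c - innerE M a d - innerE M b c + innerE M b d

/-- the Cartan pairing `c_{ij} = (ε_i − ε_{i+1}, ε_j − ε_{j+1})`. -/
def cc (M : ℕ) (i j : ℕ) : ℤ := form4 M i (i + 1) j (j + 1)

/-- `q_i = q^{l_i}`. -/
def qpar (q : ℂ) (M : ℕ) (i : ℕ) : ℂ := q ^ lof M i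

/-- the quantum integer `[m]_v`. -/
def qint (v : ℂ) (m : ℤ) : ℂ := (v ^ m - v ^ (-m)) / (v - v⁻¹)

/-- the sign `(−1)^{|X_i||X_j|}` for the generators `X_i`, `X_j`. -/
def sgn (M : ℕ) (i j : ℕ) : ℂ := if i = M ∧ j = M then -1 else 1

/-- index set `1 ≤ i ≤ M+N−1`. -/
abbrev Idx (M N : ℕ) := {i : ℕ // 1 ≤ i ∧ i ≤ M + N - 1}

/-! ### Generators and the free superalgebra -/

/-- Drinfel'd generators; when `ext = true` we also have `K₀^{±1}`. -/
inductive Gen (M N : ℕ) (ext : Bool) : Type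
  | Xp : Idx M N → ℤ → Gen M N ext
  | Xm : Idx M N → ℤ → Gen M N ext
  | K : Idx M N → Gen M N ext
  | Ki : Idx M N → Gen M N ext
  | H : Idx M N → {s : ℤ // s ≠ 0} → Gen M N ext
  | K0 : ext = true → Gen M N ext
  | K0i : ext = true → Gen M N ext

abbrev FA (M N : ℕ) (ext : Bool) := FreeAlgebra ℂ (Gen M N ext)

def gi {M N : ℕ} {ext : Bool} (g : Gen M N ext) : FA M N ext := FreeAlgebra.ι ℂ g

def XpF (M N : ℕ) (ext : Bool) (i : ℕ) (n : ℤ) : FA M N ext :=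
  if h : 1 ≤ i ∧ i ≤ M + N - 1 then gi (Gen.Xp ⟨i, h⟩ n) else 0

def XmF (M N : ℕ) (ext : Bool) (i : ℕ) (n : ℤ) : FA M N ext :=
  if h : 1 ≤ i ∧ i ≤ M + N - 1 then gi (Gen.Xm ⟨i, h⟩ n) else 0

def KF (M N : ℕ) (ext : Bool) (i : ℕ) : FA M N ext :=
  if h : 1 ≤ i ∧ i ≤ M + N - 1 then gi (Gen.K ⟨i, h⟩) else 0

def KiF (M N : ℕ) (ext : Bool) (i : ℕ) : FA M N ext :=
  if h : 1 ≤ i ∧ i ≤ M + N - 1 then gi (Gen.Ki ⟨i, h⟩) else 0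

def HF (M N : ℕ) (ext : Bool) (i : ℕ) (s : ℤ) : FA M N ext :=
  if h : (1 ≤ i ∧ i ≤ M + N - 1) ∧ s ≠ 0 then gi (Gen.H ⟨i, h.1⟩ ⟨s, h.2⟩) else 0

def K0F (M N : ℕ) (ext : Bool) : FA M N ext :=
  if h : ext = true then gi (Gen.K0 h) else 0

def K0iF (M N : ℕ) (ext : Bool) : FA M N ext :=
  if h : ext = true then gi (Gen.K0i h) else 0

/-- coefficients of `exp (t · Σ_{s ≥ 1} a_s z^s)`. -/
def expC {A : Type} [Ring A] [Algebra ℂ A] (t : ℂ) (a : ℕ → A) : ℕ → A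
  | 0 => 1
  | n + 1 =>
      ((n : ℂ) + 1)⁻¹ •
        (t • ∑ s ∈ Finset.range (n + 1), ((s : ℂ) + 1) • (a (s + 1) * expC t a (n - s)))
termination_by n => n
decreasing_by omega

/-- `φ⁺_{i,n}`, the coefficient of `z^n` in
`K_i exp((q_i − q_i⁻¹) Σ_{s>0} h_{i,s} z^s)`. -/
def phiPF (q : ℂ) (M N : ℕ) (ext : Bool) (i : ℕ) (n : ℤ) : FA M N ext :=
  if 0 ≤ n then
    KF M N ext i *
      expC (qpar q M i - (qpar q M i)⁻¹) (fun s => HF M N ext i (s : ℤ)) n.toNat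
  else 0

/-- `φ⁻_{i,n}`, the coefficient of `z^n` (`n ≤ 0`) in
`K_i⁻¹ exp(−(q_i − q_i⁻¹) Σ_{s>0} h_{i,−s} z^{−s})`. -/
def phiMF (q : ℂ) (M N : ℕ) (ext : Bool) (i : ℕ) (n : ℤ) : FA M N ext :=
  if n ≤ 0 then
    KiF M N ext i *
      expC (-(qpar q M i - (qpar q M i)⁻¹)) (fun s => HF M N ext i (-(s : ℤ))) (-n).toNat
  else 0

/-- the `u`-bracket `[x,y]_u = xy − u·yx` (for `x` or `y` of even parity). -/
def brF {A : Type} [Ring A] [Module ℂ A] (u : ℂ) (x y : A) : A := x * y - u • (y * x)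

/-- the quartic oscillation expression
`[[[X_{M−1,m}, X_{M,n}]_{q⁻¹}, X_{M+1,k}]_q, X_{M,u}]` (a graded anticommutator in the
outermost bracket, both entries being odd). -/
def oscOf {A : Type} [Ring A] [Module ℂ A] (q : ℂ) (M : ℕ) (X : ℕ → ℤ → A) (m n k u : ℤ) : A :=
  brF q (brF q⁻¹ (X (M - 1) m) (X M n)) (X (M + 1) k) * X M u +
    X M u * brF q (brF q⁻¹ (X (M - 1) m) (X M n)) (X (M + 1) k)

/-! ### The defining relations.
`lvl = 1`: only (R1)–(R3);  `lvl = 2`: (R1)–(R5);  `lvl = 3`: all of (R1)–(R7).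
`ext = true` adds `K₀^{±1}` together with its relations. -/

inductive rel (q : ℂ) (M N : ℕ) (ext : Bool) (lvl : ℕ) : FA M N ext → FA M N ext → Prop
  | KKi (i : Idx M N) : rel q M N ext lvl (gi (Gen.K i) * gi (Gen.Ki i)) 1
  | KiK (i : Idx M N) : rel q M N ext lvl (gi (Gen.Ki i) * gi (Gen.K i)) 1
  | KK (i j : Idx M N) :
      rel q M N ext lvl (gi (Gen.K i) * gi (Gen.K j)) (gi (Gen.K j) * gi (Gen.K i))
  | KKi2 (i j : Idx M N) :
      rel q M N ext lvl (gi (Gen.K i) * gi (Gen.Ki j)) (gi (Gen.Ki j) * gi (Gen.K i))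
  | KiKi (i j : Idx M N) :
      rel q M N ext lvl (gi (Gen.Ki i) * gi (Gen.Ki j)) (gi (Gen.Ki j) * gi (Gen.Ki i))
  | KH (i j : Idx M N) (s : {s : ℤ // s ≠ 0}) :
      rel q M N ext lvl (gi (Gen.K i) * gi (Gen.H j s)) (gi (Gen.H j s) * gi (Gen.K i))
  | KiH (i j : Idx M N) (s : {s : ℤ // s ≠ 0}) :
      rel q M N ext lvl (gi (Gen.Ki i) * gi (Gen.H j s)) (gi (Gen.H j s) * gi (Gen.Ki i))
  | HH (i j : Idx M N) (s t : {s : ℤ // s ≠ 0}) :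
      rel q M N ext lvl (gi (Gen.H i s) * gi (Gen.H j t)) (gi (Gen.H j t) * gi (Gen.H i s))
  | KXp (i j : Idx M N) (n : ℤ) :
      rel q M N ext lvl (gi (Gen.K i) * gi (Gen.Xp j n))
        ((q ^ cc M i.1 j.1) • (gi (Gen.Xp j n) * gi (Gen.K i)))
  | KXm (i j : Idx M N) (n : ℤ) :
      rel q M N ext lvl (gi (Gen.K i) * gi (Gen.Xm j n))
        ((q ^ (-cc M i.1 j.1)) • (gi (Gen.Xm j n) * gi (Gen.K i)))
  | HXp (i j : Idx M N) (s : {s : ℤ // s ≠ 0}) (n : ℤ) :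
      rel q M N ext lvl
        (gi (Gen.H i s) * gi (Gen.Xp j n) - gi (Gen.Xp j n) * gi (Gen.H i s))
        ((qint (qpar q M i.1) (s.1 * lof M i.1 * cc M i.1 j.1) / (s.1 : ℂ)) •
          gi (Gen.Xp j (n + s.1)))
  | HXm (i j : Idx M N) (s : {s : ℤ // s ≠ 0}) (n : ℤ) :
      rel q M N ext lvl
        (gi (Gen.H i s) * gi (Gen.Xm j n) - gi (Gen.Xm j n) * gi (Gen.H i s))
        (-((qint (qpar q M i.1) (s.1 * lof M i.1 * cc M i.1 j.1) / (s.1 : ℂ)) •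
          gi (Gen.Xm j (n + s.1))))
  | XpXm (i j : Idx M N) (m n : ℤ) :
      rel q M N ext lvl
        (gi (Gen.Xp i m) * gi (Gen.Xm j n) -
          sgn M i.1 j.1 • (gi (Gen.Xm j n) * gi (Gen.Xp i m)))
        (if i = j then
            (qpar q M i.1 - (qpar q M i.1)⁻¹)⁻¹ •
              (phiPF q M N ext i.1 (m + n) - phiMF q M N ext i.1 (m + n))
          else 0)
  | XX0p (i j : Idx M N) (m n : ℤ) (h2 : 2 ≤ lvl) (h : cc M i.1 j.1 = 0) :
      rel q M N ext lvl
        (gi (Gen.Xp i m) * gi (Gen.Xp j n) -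
          sgn M i.1 j.1 • (gi (Gen.Xp j n) * gi (Gen.Xp i m))) 0
  | XX0m (i j : Idx M N) (m n : ℤ) (h2 : 2 ≤ lvl) (h : cc M i.1 j.1 = 0) :
      rel q M N ext lvl
        (gi (Gen.Xm i m) * gi (Gen.Xm j n) -
          sgn M i.1 j.1 • (gi (Gen.Xm j n) * gi (Gen.Xm i m))) 0
  | XXp (i j : Idx M N) (m n : ℤ) (h2 : 2 ≤ lvl) (h : cc M i.1 j.1 ≠ 0) :
      rel q M N ext lvl
        (gi (Gen.Xp i (m + 1)) * gi (Gen.Xp j n) -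
          (q ^ cc M i.1 j.1) • (gi (Gen.Xp j n) * gi (Gen.Xp i (m + 1))))
        ((q ^ cc M i.1 j.1) • (gi (Gen.Xp i m) * gi (Gen.Xp j (n + 1))) -
          gi (Gen.Xp j (n + 1)) * gi (Gen.Xp i m))
  | XXm (i j : Idx M N) (m n : ℤ) (h2 : 2 ≤ lvl) (h : cc M i.1 j.1 ≠ 0) :
      rel q M N ext lvl
        (gi (Gen.Xm i (m + 1)) * gi (Gen.Xm j n) -
          (q ^ (-cc M i.1 j.1)) • (gi (Gen.Xm j n) * gi (Gen.Xm i (m + 1))))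
        ((q ^ (-cc M i.1 j.1)) • (gi (Gen.Xm i m) * gi (Gen.Xm j (n + 1))) -
          gi (Gen.Xm j (n + 1)) * gi (Gen.Xm i m))
  | serreP (i j : Idx M N) (m n k : ℤ) (h3 : 3 ≤ lvl)
      (h : cc M i.1 j.1 = 1 ∨ cc M i.1 j.1 = -1) (hi : i.1 ≠ M) :
      rel q M N ext lvl
        (brF q (gi (Gen.Xp i m)) (brF q⁻¹ (gi (Gen.Xp i n)) (gi (Gen.Xp j k))) +
          brF q (gi (Gen.Xp i n)) (brF q⁻¹ (gi (Gen.Xp i m)) (gi (Gen.Xp j k)))) 0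
  | serreM (i j : Idx M N) (m n k : ℤ) (h3 : 3 ≤ lvl)
      (h : cc M i.1 j.1 = 1 ∨ cc M i.1 j.1 = -1) (hi : i.1 ≠ M) :
      rel q M N ext lvl
        (brF q (gi (Gen.Xm i m)) (brF q⁻¹ (gi (Gen.Xm i n)) (gi (Gen.Xm j k))) +
          brF q (gi (Gen.Xm i n)) (brF q⁻¹ (gi (Gen.Xm i m)) (gi (Gen.Xm j k)))) 0
  | oscP (m n k u : ℤ) (h3 : 3 ≤ lvl) (hM : 1 < M) (hN : 1 < N) :
      rel q M N ext lvl
        (oscOf q M (XpF M N ext) m n k u + oscOf q M (XpF M N ext) m u k n) 0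
  | oscM (m n k u : ℤ) (h3 : 3 ≤ lvl) (hM : 1 < M) (hN : 1 < N) :
      rel q M N ext lvl
        (oscOf q M (XmF M N ext) m n k u + oscOf q M (XmF M N ext) m u k n) 0
  | K0K0i (he : ext = true) : rel q M N ext lvl (gi (Gen.K0 he) * gi (Gen.K0i he)) 1
  | K0iK0 (he : ext = true) : rel q M N ext lvl (gi (Gen.K0i he) * gi (Gen.K0 he)) 1
  | K0K (he : ext = true) (i : Idx M N) :
      rel q M N ext lvl (gi (Gen.K0 he) * gi (Gen.K i)) (gi (Gen.K i) * gi (Gen.K0 he))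
  | K0Ki (he : ext = true) (i : Idx M N) :
      rel q M N ext lvl (gi (Gen.K0 he) * gi (Gen.Ki i)) (gi (Gen.Ki i) * gi (Gen.K0 he))
  | K0H (he : ext = true) (i : Idx M N) (s : {s : ℤ // s ≠ 0}) :
      rel q M N ext lvl (gi (Gen.K0 he) * gi (Gen.H i s)) (gi (Gen.H i s) * gi (Gen.K0 he))
  | K0Xp (he : ext = true) (i : Idx M N) (n : ℤ) :
      rel q M N ext lvl (gi (Gen.K0 he) * gi (Gen.Xp i n))
        ((q ^ (if i.1 = 1 then (1 : ℤ) else 0)) • (gi (Gen.Xp i n) * gi (Gen.K0 he)))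
  | K0Xm (he : ext = true) (i : Idx M N) (n : ℤ) :
      rel q M N ext lvl (gi (Gen.K0 he) * gi (Gen.Xm i n))
        ((q ^ (if i.1 = 1 then (-1 : ℤ) else 0)) • (gi (Gen.Xm i n) * gi (Gen.K0 he)))

/-! ### The quantum affine superalgebras -/

abbrev ALG (q : ℂ) (M N : ℕ) (ext : Bool) (lvl : ℕ) := RingQuot (rel q M N ext lvl)

def mkA (q : ℂ) (M N : ℕ) (ext : Bool) (lvl : ℕ) : FA M N ext →ₐ[ℂ] ALG q M N ext lvl :=
  RingQuot.mkAlgHom ℂ (rel q M N ext lvl)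

def XpA (q : ℂ) (M N : ℕ) (ext : Bool) (lvl : ℕ) (i : ℕ) (n : ℤ) : ALG q M N ext lvl :=
  mkA q M N ext lvl (XpF M N ext i n)

def XmA (q : ℂ) (M N : ℕ) (ext : Bool) (lvl : ℕ) (i : ℕ) (n : ℤ) : ALG q M N ext lvl :=
  mkA q M N ext lvl (XmF M N ext i n)

def KA (q : ℂ) (M N : ℕ) (ext : Bool) (lvl : ℕ) (i : ℕ) : ALG q M N ext lvl :=
  mkA q M N ext lvl (KF M N ext i)

def KiA (q : ℂ) (M N : ℕ) (ext : Bool) (lvl : ℕ) (i : ℕ) : ALG q M N ext lvl :=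
  mkA q M N ext lvl (KiF M N ext i)

def HA (q : ℂ) (M N : ℕ) (ext : Bool) (lvl : ℕ) (i : ℕ) (s : ℤ) : ALG q M N ext lvl :=
  mkA q M N ext lvl (HF M N ext i s)

def K0A (q : ℂ) (M N : ℕ) (ext : Bool) (lvl : ℕ) : ALG q M N ext lvl :=
  mkA q M N ext lvl (K0F M N ext)

def K0iA (q : ℂ) (M N : ℕ) (ext : Bool) (lvl : ℕ) : ALG q M N ext lvl :=
  mkA q M N ext lvl (K0iF M N ext)

def phiPA (q : ℂ) (M N : ℕ) (ext : Bool) (lvl : ℕ) (i : ℕ) (n : ℤ) : ALG q M N ext lvl :=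
  mkA q M N ext lvl (phiPF q M N ext i n)

def phiMA (q : ℂ) (M N : ℕ) (ext : Bool) (lvl : ℕ) (i : ℕ) (n : ℤ) : ALG q M N ext lvl :=
  mkA q M N ext lvl (phiMF q M N ext i n)

/-- `U⁺`: the subalgebra generated by the `X⁺_{i,n}`. -/
def Aplus (q : ℂ) (M N : ℕ) (ext : Bool) (lvl : ℕ) : Subalgebra ℂ (ALG q M N ext lvl) :=
  Algebra.adjoin ℂ {x | ∃ i : ℕ, ∃ n : ℤ, x = XpA q M N ext lvl i n}

/-- `U⁻`: the subalgebra generated by the `X⁻_{i,n}`. -/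
def Aminus (q : ℂ) (M N : ℕ) (ext : Bool) (lvl : ℕ) : Subalgebra ℂ (ALG q M N ext lvl) :=
  Algebra.adjoin ℂ {x | ∃ i : ℕ, ∃ n : ℤ, x = XmA q M N ext lvl i n}

/-- `U⁰`: the subalgebra generated by the `K_i^{±1}` and `h_{i,s}`. -/
def Azero (q : ℂ) (M N : ℕ) (ext : Bool) (lvl : ℕ) : Subalgebra ℂ (ALG q M N ext lvl) :=
  Algebra.adjoin ℂ {x | (∃ i : ℕ, x = KA q M N ext lvl i) ∨ (∃ i : ℕ, x = KiA q M N ext lvl i) ∨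
    ∃ i : ℕ, ∃ s : ℤ, x = HA q M N ext lvl i s}

/-- `U'⁰`: the subalgebra generated by `U⁰` and `K₀^{±1}`. -/
def AzeroE (q : ℂ) (M N : ℕ) (ext : Bool) (lvl : ℕ) : Subalgebra ℂ (ALG q M N ext lvl) :=
  Algebra.adjoin ℂ {x | (∃ i : ℕ, x = KA q M N ext lvl i) ∨ (∃ i : ℕ, x = KiA q M N ext lvl i) ∨
    (∃ i : ℕ, ∃ s : ℤ, x = HA q M N ext lvl i s) ∨ x = K0A q M N ext lvl ∨
      x = K0iA q M N ext lvl}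

/-! ### The multiplication map on the triple tensor product -/

def triMul (q : ℂ) (M N : ℕ) (ext : Bool) (lvl : ℕ)
    (S T R : Subalgebra ℂ (ALG q M N ext lvl)) :
    (↥S ⊗[ℂ] (↥T ⊗[ℂ] ↥R)) →ₗ[ℂ] ALG q M N ext lvl :=
  TensorProduct.lift
    (((LinearMap.mul ℂ (ALG q M N ext lvl)).comp S.val.toLinearMap).compl₂
      (TensorProduct.lift
        (((LinearMap.mul ℂ (ALG q M N ext lvl)).comp T.val.toLinearMap).compl₂
          R.val.toLinearMap)))

/-! ### Root vectors and PBW monomials -/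

def Xroot (q : ℂ) (M N : ℕ) (ext : Bool) (lvl : ℕ) (i : ℕ) : ℕ → ℤ → ALG q M N ext lvl
  | 0, n => XpA q M N ext lvl i n
  | k + 1, n =>
      brF (qpar q M (i + k + 1)) (Xroot q M N ext lvl i k n) (XpA q M N ext lvl (i + k + 1) 0)

/-- the root vector `X_{α_i + ⋯ + α_j}(n)`. -/
def XrootIJ (q : ℂ) (M N : ℕ) (ext : Bool) (lvl : ℕ) (i j : ℕ) (n : ℤ) : ALG q M N ext lvl :=
  Xroot q M N ext lvl i (j - i) n

def rootLE (a b : ℕ × ℕ) : Prop := a.1 < b.1 ∨ (a.1 = b.1 ∧ a.2 ≤ b.2)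

/-- the set of PBW ordered monomials in the root vectors. -/
def pbwSet (q : ℂ) (M N : ℕ) (ext : Bool) (lvl : ℕ) : Set (ALG q M N ext lvl) :=
  {x | ∃ L : List ((ℕ × ℕ) × ℤ),
      (∀ p ∈ L, 1 ≤ p.1.1 ∧ p.1.1 ≤ p.1.2 ∧ p.1.2 ≤ M + N - 1) ∧
      L.Chain' (fun a b => rootLE a.1 b.1) ∧
      x = (L.map fun p => XrootIJ q M N ext lvl p.1.1 p.1.2 p.2).prod}

/-- PBW ordered monomials of total degree `d` (`d i` counts the multiplicity of `α_i`). -/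
def pbwDegSet (q : ℂ) (M N : ℕ) (ext : Bool) (lvl : ℕ) (d : ℕ → ℕ) : Set (ALG q M N ext lvl) :=
  {x | ∃ L : List ((ℕ × ℕ) × ℤ),
      (∀ p ∈ L, 1 ≤ p.1.1 ∧ p.1.1 ≤ p.1.2 ∧ p.1.2 ≤ M + N - 1) ∧
      L.Chain' (fun a b => rootLE a.1 b.1) ∧
      (∀ i : ℕ, ((L.map fun p => if p.1.1 ≤ i ∧ i ≤ p.1.2 then 1 else 0).sum) = d i) ∧
      x = (L.map fun p => XrootIJ q M N ext lvl p.1.1 p.1.2 p.2).prod}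

/-- words in the generators `X⁺_{i,n}` of degree `d`. -/
def wordDegSet (q : ℂ) (M N : ℕ) (ext : Bool) (lvl : ℕ) (d : ℕ → ℕ) :
    Set (ALG q M N ext lvl) :=
  {x | ∃ w : List (ℕ × ℤ), (∀ p ∈ w, 1 ≤ p.1 ∧ p.1 ≤ M + N - 1) ∧
      (∀ i : ℕ, (w.map Prod.fst).count i = d i) ∧
      x = (w.map fun p => XpA q M N ext lvl p.1 p.2).prod}

/-! ### The subspaces `I^±_{i,j}` and `O^±` -/

def IElt (q : ℂ) (M N : ℕ) (ext : Bool) (lvl : ℕ) (pl : Bool) (i j : ℕ) (m n : ℤ) :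
    ALG q M N ext lvl :=
  let X : ℕ → ℤ → ALG q M N ext lvl := if pl then XpA q M N ext lvl else XmA q M N ext lvl
  let e : ℤ := if pl then cc M i j else -cc M i j
  if cc M i j = 0 then X i m * X j n - sgn M i j • (X j n * X i m)
  else
    X i (m + 1) * X j n - (q ^ e) • (X j n * X i (m + 1)) -
      (q ^ e) • (X i m * X j (n + 1)) + X j (n + 1) * X i m

def Isub (q : ℂ) (M N : ℕ) (ext : Bool) (lvl : ℕ) (pl : Bool) (i j : ℕ) :
    Submodule ℂ (ALG q M N ext lvl) :=
  Submodule.span ℂ (Set.range fun p : ℤ × ℤ => IElt q M N ext lvl pl i j p.1 p.2)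

def IsubAll (q : ℂ) (M N : ℕ) (ext : Bool) (lvl : ℕ) (pl : Bool) :
    Submodule ℂ (ALG q M N ext lvl) :=
  ⨆ p : ℕ × ℕ, ⨆ _ : 1 ≤ p.1 ∧ p.1 ≤ p.2 ∧ p.2 ≤ M + N - 1,
    Isub q M N ext lvl pl p.1 p.2

def OscElt (q : ℂ) (M N : ℕ) (ext : Bool) (lvl : ℕ) (pl : Bool) (m n k u : ℤ) :
    ALG q M N ext lvl :=
  let X : ℕ → ℤ → ALG q M N ext lvl := if pl then XpA q M N ext lvl else XmA q M N ext lvl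
  oscOf q M X m n k u + oscOf q M X m u k n

def Osub (q : ℂ) (M N : ℕ) (ext : Bool) (lvl : ℕ) (pl : Bool) :
    Submodule ℂ (ALG q M N ext lvl) :=
  Submodule.span ℂ
    (Set.range fun p : ℤ × ℤ × ℤ × ℤ => OscElt q M N ext lvl pl p.1 p.2.1 p.2.2.1 p.2.2.2)

/-- the sign `(−1)^{(p(α_k)+p(α_u))·p(α_i)}`. -/
def gsgn (M : ℕ) (k u i : ℕ) : ℂ :=
  if ((k = M ∧ ¬u = M) ∨ (¬k = M ∧ u = M)) ∧ i = M then -1 else 1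

/-! ### Highest weights and the associated eigenvalue sequences -/

/-- `Q·f = 0` for a bilateral formal series `f`. -/
def annih (Q : Polynomial ℂ) (f : ℤ → ℂ) : Prop :=
  ∀ n : ℤ, ∑ s ∈ Finset.range (Q.natDegree + 1), Q.coeff s * f (n - s) = 0

/-- an element of `R_{M,N}`: a highest weight `(P̲, f, c)`. -/
structure HW (q : ℂ) (M N : ℕ) : Type where
  P : ℕ → Polynomial ℂ
  f : ℤ → ℂ
  c : ℂ
  P_const : ∀ i, (P i).coeff 0 = 1
  c_ne : c ≠ 0
  torsion : ∃ Q : Polynomial ℂ, Q ≠ 0 ∧ annih Q f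
  f_zero : f 0 = (c - c⁻¹) / (q - q⁻¹)

def toPS (p : Polynomial ℂ) : PowerSeries ℂ := PowerSeries.mk fun n => p.coeff n

/-- `P(z·u)`. -/
def pscale (u : ℂ) (P : Polynomial ℂ) : Polynomial ℂ := P.comp (Polynomial.C u * Polynomial.X)

/-- the coefficient of `z^n` (`n ≥ 0`) in `q_i^{deg P} P(z q_i⁻¹)/P(z q_i)`,
expanded at `z = 0`. -/
def gammaP (q : ℂ) (M : ℕ) (i : ℕ) (P : Polynomial ℂ) (n : ℤ) : ℂ :=
  if 0 ≤ n then
    qpar q M i ^ P.natDegree *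
      PowerSeries.coeff n.toNat
        (toPS (pscale (qpar q M i)⁻¹ P) * (toPS (pscale (qpar q M i) P))⁻¹)
  else 0

/-- the coefficient of `z^n` (`n ≤ 0`) in `q_i^{deg P} P(z q_i⁻¹)/P(z q_i)`,
expanded at `z = ∞`. -/
def gammaM (q : ℂ) (M : ℕ) (i : ℕ) (P : Polynomial ℂ) (n : ℤ) : ℂ :=
  if n ≤ 0 then
    qpar q M i ^ P.natDegree *
      PowerSeries.coeff (-n).toNat
        (toPS ((pscale (qpar q M i)⁻¹ P).reflect P.natDegree) *
          (toPS ((pscale (qpar q M i) P).reflect P.natDegree))⁻¹)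
  else 0

/-! ### Verma, Weyl and simple modules -/

def vermaRels (q : ℂ) (M N : ℕ) (ext : Bool) (Λ : HW q M N) : Set (ALG q M N ext 3) :=
  {x | ∃ i : ℕ, ∃ n : ℤ, x = XpA q M N ext 3 i n} ∪
  {x | ∃ i : ℕ, ∃ n : ℤ, 1 ≤ i ∧ i ≤ M + N - 1 ∧ i ≠ M ∧
      (x = phiPA q M N ext 3 i n - algebraMap ℂ _ (gammaP q M i (Λ.P i) n) ∨
       x = phiMA q M N ext 3 i n - algebraMap ℂ _ (gammaM q M i (Λ.P i) n))} ∪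
  {x | x = KA q M N ext 3 M - algebraMap ℂ _ Λ.c} ∪
  {x | ∃ n : ℤ, x = phiPA q M N ext 3 M n - phiMA q M N ext 3 M n -
      algebraMap ℂ _ ((q - q⁻¹) * Λ.f n)} ∪
  {x | ext = true ∧ x = K0A q M N ext 3 - 1}

def evenRels (q : ℂ) (M N : ℕ) (ext : Bool) (Λ : HW q M N) : Set (ALG q M N ext 3) :=
  {x | ∃ i : ℕ, 1 ≤ i ∧ i ≤ M + N - 1 ∧ i ≠ M ∧
      x = XmA q M N ext 3 i 0 ^ (1 + (Λ.P i).natDegree)}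

def oddElt (q : ℂ) (M N : ℕ) (ext : Bool) (Q : Polynomial ℂ) (n : ℤ) : ALG q M N ext 3 :=
  ∑ s ∈ Finset.range (Q.natDegree + 1),
    Q.coeff (Q.natDegree - s) • XmA q M N ext 3 M ((s : ℤ) + n)

def oddRels (q : ℂ) (M N : ℕ) (ext : Bool) (Q : Polynomial ℂ) : Set (ALG q M N ext 3) :=
  if M = 1 ∧ N = 1 then {x | ∃ n : ℤ, x = oddElt q M N ext Q n}
  else {oddElt q M N ext Q 0}

def vermaIdeal (q : ℂ) (M N : ℕ) (ext : Bool) (Λ : HW q M N) : Ideal (ALG q M N ext 3) :=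
  Ideal.span (vermaRels q M N ext Λ)

def weylIdeal (q : ℂ) (M N : ℕ) (ext : Bool) (Λ : HW q M N) (Q : Polynomial ℂ) :
    Ideal (ALG q M N ext 3) :=
  Ideal.span (vermaRels q M N ext Λ ∪ evenRels q M N ext Λ ∪ oddRels q M N ext Q)

def uweylIdeal (q : ℂ) (M N : ℕ) (ext : Bool) (Λ : HW q M N) : Ideal (ALG q M N ext 3) :=
  Ideal.span (vermaRels q M N ext Λ ∪ evenRels q M N ext Λ)

/-- the Verma module `M(Λ)`. -/
def VermaMod (q : ℂ) (M N : ℕ) (ext : Bool) (Λ : HW q M N) : Type :=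
  ALG q M N ext 3 ⧸ vermaIdeal q M N ext Λ

/-- the Weyl module `W(Λ; Q)`. -/
def WeylMod (q : ℂ) (M N : ℕ) (ext : Bool) (Λ : HW q M N) (Q : Polynomial ℂ) : Type :=
  ALG q M N ext 3 ⧸ weylIdeal q M N ext Λ Q

/-- the universal Weyl module `W(Λ)`. -/
def UWeylMod (q : ℂ) (M N : ℕ) (ext : Bool) (Λ : HW q M N) : Type :=
  ALG q M N ext 3 ⧸ uweylIdeal q M N ext Λ

instance (q : ℂ) (M N : ℕ) (ext : Bool) (Λ : HW q M N) : AddCommGroup (VermaMod q M N ext Λ) :=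
  inferInstanceAs (AddCommGroup (ALG q M N ext 3 ⧸ vermaIdeal q M N ext Λ))
instance (q : ℂ) (M N : ℕ) (ext : Bool) (Λ : HW q M N) :
    Module (ALG q M N ext 3) (VermaMod q M N ext Λ) :=
  inferInstanceAs (Module (ALG q M N ext 3) (ALG q M N ext 3 ⧸ vermaIdeal q M N ext Λ))
instance (q : ℂ) (M N : ℕ) (ext : Bool) (Λ : HW q M N) : Module ℂ (VermaMod q M N ext Λ) :=
  inferInstanceAs (Module ℂ (ALG q M N ext 3 ⧸ vermaIdeal q M N ext Λ))
instance (q : ℂ) (M N : ℕ) (ext : Bool) (Λ : HW q M N) :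
    IsScalarTower ℂ (ALG q M N ext 3) (VermaMod q M N ext Λ) :=
  inferInstanceAs (IsScalarTower ℂ (ALG q M N ext 3) (ALG q M N ext 3 ⧸ vermaIdeal q M N ext Λ))

instance (q : ℂ) (M N : ℕ) (ext : Bool) (Λ : HW q M N) (Q : Polynomial ℂ) :
    AddCommGroup (WeylMod q M N ext Λ Q) :=
  inferInstanceAs (AddCommGroup (ALG q M N ext 3 ⧸ weylIdeal q M N ext Λ Q))
instance (q : ℂ) (M N : ℕ) (ext : Bool) (Λ : HW q M N) (Q : Polynomial ℂ) :
    Module (ALG q M N ext 3) (WeylMod q M N ext Λ Q) :=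
  inferInstanceAs (Module (ALG q M N ext 3) (ALG q M N ext 3 ⧸ weylIdeal q M N ext Λ Q))
instance (q : ℂ) (M N : ℕ) (ext : Bool) (Λ : HW q M N) (Q : Polynomial ℂ) :
    Module ℂ (WeylMod q M N ext Λ Q) :=
  inferInstanceAs (Module ℂ (ALG q M N ext 3 ⧸ weylIdeal q M N ext Λ Q))
instance (q : ℂ) (M N : ℕ) (ext : Bool) (Λ : HW q M N) (Q : Polynomial ℂ) :
    IsScalarTower ℂ (ALG q M N ext 3) (WeylMod q M N ext Λ Q) :=
  inferInstanceAs
    (IsScalarTower ℂ (ALG q M N ext 3) (ALG q M N ext 3 ⧸ weylIdeal q M N ext Λ Q))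

instance (q : ℂ) (M N : ℕ) (ext : Bool) (Λ : HW q M N) : AddCommGroup (UWeylMod q M N ext Λ) :=
  inferInstanceAs (AddCommGroup (ALG q M N ext 3 ⧸ uweylIdeal q M N ext Λ))
instance (q : ℂ) (M N : ℕ) (ext : Bool) (Λ : HW q M N) :
    Module (ALG q M N ext 3) (UWeylMod q M N ext Λ) :=
  inferInstanceAs (Module (ALG q M N ext 3) (ALG q M N ext 3 ⧸ uweylIdeal q M N ext Λ))
instance (q : ℂ) (M N : ℕ) (ext : Bool) (Λ : HW q M N) : Module ℂ (UWeylMod q M N ext Λ) :=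
  inferInstanceAs (Module ℂ (ALG q M N ext 3 ⧸ uweylIdeal q M N ext Λ))
instance (q : ℂ) (M N : ℕ) (ext : Bool) (Λ : HW q M N) :
    IsScalarTower ℂ (ALG q M N ext 3) (UWeylMod q M N ext Λ) :=
  inferInstanceAs (IsScalarTower ℂ (ALG q M N ext 3) (ALG q M N ext 3 ⧸ uweylIdeal q M N ext Λ))

/-- the highest weight vector (image of `1`). -/
def vgen (q : ℂ) (M N : ℕ) (Λ : HW q M N) : VermaMod q M N true Λ :=
  Submodule.Quotient.mk 1

/-- the sum of all submodules not containing the highest weight vector (the unique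
maximal submodule of the Verma module). -/
def radV (q : ℂ) (M N : ℕ) (Λ : HW q M N) :
    Submodule (ALG q M N true 3) (VermaMod q M N true Λ) :=
  sSup {p | vgen q M N Λ ∉ p}

/-- the simple quotient `S'(Λ)`. -/
def SimpMod (q : ℂ) (M N : ℕ) (Λ : HW q M N) : Type :=
  VermaMod q M N true Λ ⧸ radV q M N Λ

instance (q : ℂ) (M N : ℕ) (Λ : HW q M N) : AddCommGroup (SimpMod q M N Λ) :=
  inferInstanceAs (AddCommGroup (VermaMod q M N true Λ ⧸ radV q M N Λ))
instance (q : ℂ) (M N : ℕ) (Λ : HW q M N) :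
    Module (ALG q M N true 3) (SimpMod q M N Λ) :=
  inferInstanceAs (Module (ALG q M N true 3) (VermaMod q M N true Λ ⧸ radV q M N Λ))
instance (q : ℂ) (M N : ℕ) (Λ : HW q M N) : Module ℂ (SimpMod q M N Λ) :=
  inferInstanceAs (Module ℂ (VermaMod q M N true Λ ⧸ radV q M N Λ))
instance (q : ℂ) (M N : ℕ) (Λ : HW q M N) :
    IsScalarTower ℂ (ALG q M N true 3) (SimpMod q M N Λ) :=
  inferInstanceAs (IsScalarTower ℂ (ALG q M N true 3) (VermaMod q M N true Λ ⧸ radV q M N Λ))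

/-! ### Weight spaces -/

/-- `K_i` for `0 ≤ i`, with `K₀` at `i = 0`. -/
def Kgen (q : ℂ) (M N : ℕ) (ext : Bool) (lvl : ℕ) (i : ℕ) : ALG q M N ext lvl :=
  if i = 0 then K0A q M N ext lvl else KA q M N ext lvl i

/-- the `μ`-weight space of a module. -/
def wtSp (q : ℂ) (M N : ℕ) (ext : Bool) {W : Type} [AddCommGroup W] [Module ℂ W]
    [Module (ALG q M N ext 3) W] [IsScalarTower ℂ (ALG q M N ext 3) W] (μ : ℕ → ℂ) :
    Submodule ℂ W where
  carrier := {w | ∀ i < M + N, Kgen q M N ext 3 i • w = μ i • w}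
  add_mem' := by
    intro a b ha hb i hi
    rw [smul_add, ha i hi, hb i hi, smul_add]
  zero_mem' := by
    intro i hi
    rw [smul_zero, smul_zero]
  smul_mem' := by
    intro c w hw i hi
    have h1 : Kgen q M N ext 3 i • (c • w) = c • (Kgen q M N ext 3 i • w) := by
      rw [← algebraMap_smul (ALG q M N ext 3) c w, ← mul_smul, ← Algebra.commutes, mul_smul,
        algebraMap_smul]
    rw [h1, hw i hi, smul_comm]

/-- the character `λ_Λ`. -/
def lamF (q : ℂ) (M N : ℕ) (Λ : HW q M N) : ℕ → ℂ :=
  fun i => if i = 0 then 1 else if i = M then Λ.c else qpar q M i ^ (Λ.P i).natDegree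

/-- the character `α_j`. -/
def alF (q : ℂ) (M : ℕ) (j : ℕ) : ℕ → ℂ :=
  fun i => if i = 0 then (if j = 1 then q else 1) else q ^ cc M j i

/-! ### The generators of `U` inside `U'` -/

def UGenSet (q : ℂ) (M N : ℕ) : Set (ALG q M N true 3) :=
  {x | (∃ i : ℕ, ∃ n : ℤ, x = XpA q M N true 3 i n) ∨
    (∃ i : ℕ, ∃ n : ℤ, x = XmA q M N true 3 i n) ∨
    (∃ i : ℕ, x = KA q M N true 3 i) ∨ (∃ i : ℕ, x = KiA q M N true 3 i) ∨
    ∃ i : ℕ, ∃ s : ℤ, x = HA q M N true 3 i s}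

/-! ### One-sided presentations (for `U^±`) -/

def XgF (M N : ℕ) (i : ℕ) (n : ℤ) : FreeAlgebra ℂ (Idx M N × ℤ) :=
  if h : 1 ≤ i ∧ i ≤ M + N - 1 then FreeAlgebra.ι ℂ ((⟨i, h⟩, n) : Idx M N × ℤ) else 0

inductive rel1 (q : ℂ) (M N : ℕ) (pl : Bool) :
    FreeAlgebra ℂ (Idx M N × ℤ) → FreeAlgebra ℂ (Idx M N × ℤ) → Prop
  | comm0 (i j : Idx M N) (m n : ℤ) (h : cc M i.1 j.1 = 0) :
      rel1 q M N pl
        (FreeAlgebra.ι ℂ ((i, m) : Idx M N × ℤ) * FreeAlgebra.ι ℂ ((j, n) : Idx M N × ℤ) -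
          sgn M i.1 j.1 •
            (FreeAlgebra.ι ℂ ((j, n) : Idx M N × ℤ) * FreeAlgebra.ι ℂ ((i, m) : Idx M N × ℤ))) 0
  | deg2 (i j : Idx M N) (m n : ℤ) (h : cc M i.1 j.1 ≠ 0) :
      rel1 q M N pl
        (FreeAlgebra.ι ℂ ((i, m + 1) : Idx M N × ℤ) * FreeAlgebra.ι ℂ ((j, n) : Idx M N × ℤ) -
          (q ^ (if pl then cc M i.1 j.1 else -cc M i.1 j.1)) •
            (FreeAlgebra.ι ℂ ((j, n) : Idx M N × ℤ) *
              FreeAlgebra.ι ℂ ((i, m + 1) : Idx M N × ℤ)))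
        ((q ^ (if pl then cc M i.1 j.1 else -cc M i.1 j.1)) •
            (FreeAlgebra.ι ℂ ((i, m) : Idx M N × ℤ) *
              FreeAlgebra.ι ℂ ((j, n + 1) : Idx M N × ℤ)) -
          FreeAlgebra.ι ℂ ((j, n + 1) : Idx M N × ℤ) * FreeAlgebra.ι ℂ ((i, m) : Idx M N × ℤ))
  | serre (i j : Idx M N) (m n k : ℤ) (h : cc M i.1 j.1 = 1 ∨ cc M i.1 j.1 = -1)
      (hi : i.1 ≠ M) :
      rel1 q M N pl
        (brF q (FreeAlgebra.ι ℂ ((i, m) : Idx M N × ℤ))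
            (brF q⁻¹ (FreeAlgebra.ι ℂ ((i, n) : Idx M N × ℤ))
              (FreeAlgebra.ι ℂ ((j, k) : Idx M N × ℤ))) +
          brF q (FreeAlgebra.ι ℂ ((i, n) : Idx M N × ℤ))
            (brF q⁻¹ (FreeAlgebra.ι ℂ ((i, m) : Idx M N × ℤ))
              (FreeAlgebra.ι ℂ ((j, k) : Idx M N × ℤ)))) 0
  | osc (m n k u : ℤ) (hM : 1 < M) (hN : 1 < N) :
      rel1 q M N pl (oscOf q M (XgF M N) m n k u + oscOf q M (XgF M N) m u k n) 0

end QAS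

namespace QAS
open Finset Function

def kk (M i c : ℕ) : ℤ := if c = i then lof M i else if c = i + 1 then -lof M (i + 1) else 0

def ee (M : ℕ) : ℕ → ℤ
  | 0 => 0
  | i + 1 => ee M i + lof M (i + 1)

lemma lof_cases (M i : ℕ) : lof M i = 1 ∨ lof M i = -1 := by
  unfold lof; split <;> simp

lemma cc_kk (M i j : ℕ) : cc M i j = kk M i j - kk M i (j + 1) := by
  unfold cc form4 innerE kk
  by_cases h1 : i = j
  · subst h1; simp
  by_cases h2 : i = j + 1
  · subst h2
    have e1 : ¬ (j + 1 + 1 = j) := by omega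
    have e2 : ¬ (j = j + 1 + 1) := by omega
    simp [e1, e2]
    try ring
  by_cases h3 : i + 1 = j
  · subst h3
    have e1 : ¬ (i + 1 + 1 = i) := by omega
    have e2 : ¬ (i = i + 1 + 1) := by omega
    simp [e1, e2]
    try ring
  have : ¬ (j = i) := fun h => h1 h.symm
  have : ¬ (j = i + 1) := fun h => h3 h.symm
  have : ¬ (j + 1 = i) := fun h => h2 h.symm
  simp [*]

lemma cc_symm (M i j : ℕ) : cc M i j = cc M j i := by
  unfold cc form4 innerE
  by_cases h1 : i = j
  · subst h1; simp
  by_cases h2 : i = j + 1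
  · subst h2
    have e1 : ¬ (j + 1 + 1 = j) := by omega
    have e2 : ¬ (j = j + 1 + 1) := by omega
    simp [e1, e2]
    try ring
  by_cases h3 : i + 1 = j
  · subst h3
    have e1 : ¬ (i + 1 + 1 = i) := by omega
    have e2 : ¬ (i = i + 1 + 1) := by omega
    simp [e1, e2]
    try ring
  have : ¬ (j = i) := fun h => h1 h.symm
  have : ¬ (j = i + 1) := fun h => h3 h.symm
  have : ¬ (j + 1 = i) := fun h => h2 h.symm
  simp [*]

lemma cc_self (M i : ℕ) : cc M i i = lof M i + lof M (i + 1) := by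
  simp [cc, form4, innerE]

lemma cc_succ (M i : ℕ) : cc M i (i + 1) = - lof M (i + 1) := by
  have e1 : ¬ (i = i + 1 + 1) := by omega
  simp [cc, form4, innerE, e1]

lemma cc_far (M i j : ℕ) (h1 : i ≠ j) (h2 : i ≠ j + 1) (h3 : i + 1 ≠ j) : cc M i j = 0 := by
  unfold cc form4 innerE
  simp [*]

lemma cc_ee (M i j : ℕ) : cc M i j = 0 ∨ ee M i - ee M j = kk M i j + kk M i (j + 1) := by
  by_cases h1 : i = j
  · subst h1
    rw [cc_self]
    rcases lof_cases M i with h | h <;> rcases lof_cases M (i + 1) with h' | h' <;> simp [kk, h, h']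
  by_cases h2 : i = j + 1
  · subst h2; right
    have e1 : ¬ (j = j + 1 + 1) := by omega
    simp [kk, ee, e1]
  by_cases h3 : i + 1 = j
  · subst h3; right
    have e1 : ¬ (i + 1 + 1 = i) := by omega
    simp [kk, ee, e1]
  left; exact cc_far M i j h1 h2 h3

def sg (M i c : ℕ) : ℂ := if i = M ∧ M < c then -1 else 1

lemma sg_sq (M i c : ℕ) : sg M i c * sg M i c = 1 := by unfold sg; split <;> simp

lemma sgn_symm (M i j : ℕ) : sgn M i j = sgn M j i := by
  unfold sgn; congr 1; rw [and_comm]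

lemma sgn_sq (M i j : ℕ) : sgn M i j * sgn M i j = 1 := by
  unfold sgn; split <;> simp

lemma sg_step (M i j : ℕ) : sg M j (i + 1) = sgn M i j * sg M j i := by
  unfold sg sgn
  by_cases hj : j = M
  · subst hj
    by_cases hi : i = j
    · subst hi; simp
    · by_cases h : j < i
      · have : j < i + 1 := by omega
        simp [hi, h, this]
      · have : ¬ j < i + 1 := by omega
        simp [hi, h, this]
  · simp [hj]

variable {n : ℕ}

/-- elementary flip operator -/
def T (k : Fin n) (i j : ℕ) (d : Fin n → ℕ → ℂ) : Module.End ℂ ((Fin n → ℕ) → ℂ) where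
  toFun f c := if c k = i then (∏ k' ∈ univ.erase k, d k' (c k')) * f (update c k j) else 0
  map_add' f g := by
    funext c; simp only [Pi.add_apply]; split <;> ring
  map_smul' r f := by
    funext c; simp only [Pi.smul_apply, smul_eq_mul, RingHom.id_apply]; split <;> ring

lemma T_apply (k : Fin n) (i j : ℕ) (d : Fin n → ℕ → ℂ) (f : (Fin n → ℕ) → ℂ) (c : Fin n → ℕ) :
    T k i j d f c = if c k = i then (∏ k' ∈ univ.erase k, d k' (c k')) * f (update c k j) else 0 :=
  rfl

lemma prod_upd (k l : Fin n) (h : k ≠ l) (d : Fin n → ℕ → ℂ) (c : Fin n → ℕ) (j : ℕ) :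
    ∏ k' ∈ univ.erase l, d k' (update c k j k') =
      d k j * ∏ k' ∈ (univ.erase l).erase k, d k' (c k') := by
  rw [← Finset.mul_prod_erase (univ.erase l) _ (a := k) (by simp [h])]
  congr 1
  · simp
  · apply Finset.prod_congr rfl
    intro x hx
    simp at hx
    rw [update_of_ne hx.1]

lemma prod_upd' (k l : Fin n) (h : k ≠ l) (d : Fin n → ℕ → ℂ) (c : Fin n → ℕ) :
    ∏ k' ∈ univ.erase l, d k' (c k') =
      d k (c k) * ∏ k' ∈ (univ.erase l).erase k, d k' (c k') := by
  rw [← Finset.mul_prod_erase (univ.erase l) _ (a := k) (by simp [h])]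

lemma T_comm (k l : Fin n) (hkl : k ≠ l) (i j i' j' : ℕ) (d d' : Fin n → ℕ → ℂ) (α β : ℂ)
    (h : α * (d l i' * d' k j) = β * (d l j' * d' k i)) :
    α • (T k i j d * T l i' j' d') = β • (T l i' j' d' * T k i j d) := by
  ext f c
  simp only [LinearMap.smul_apply, Module.End.mul_apply, Pi.smul_apply, smul_eq_mul, T_apply]
  rw [update_of_ne hkl, update_of_ne hkl.symm, update_comm hkl.symm]
  by_cases h1 : c k = i
  · by_cases h2 : c l = i'
    · simp only [h1, h2, if_true]
      rw [prod_upd k l hkl, prod_upd l k hkl.symm, prod_upd' k l hkl d', prod_upd' l k hkl.symm d,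
        h1, h2]
      linear_combination (∏ k' ∈ (univ.erase l).erase k, d' k' (c k')) *
        (∏ k' ∈ (univ.erase k).erase l, d k' (c k')) * f (update (update c k j) l j') * h
    · simp [h2]
  · simp [h1]

lemma T_same_zero (k : Fin n) (i j i' j' : ℕ) (d d' : Fin n → ℕ → ℂ) (h : j ≠ i') :
    T k i j d * T k i' j' d' = 0 := by
  ext f c
  simp [T_apply, h]

lemma T_same (k : Fin n) (i j : ℕ) (d d' : Fin n → ℕ → ℂ) (f : (Fin n → ℕ) → ℂ) (c : Fin n → ℕ) :
    (T k i j d * T k j i d') f c =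
      (if c k = i then ∏ k' ∈ univ.erase k, (d k' (c k') * d' k' (c k')) else 0) * f c := by
  simp only [Module.End.mul_apply, T_apply]
  by_cases h : c k = i
  · simp only [h, if_true, update_self, update_idem]
    rw [← h, update_eq_self, Finset.prod_mul_distrib, ← mul_assoc]
    congr 2
    apply Finset.prod_congr rfl
    intro x hx
    simp at hx
    rw [update_of_ne hx]
  · simp [h]

lemma serre_core1 {A : Type} [Ring A] [Algebra ℂ A] (a b j : A) (g u v w : ℂ)
    (hba : b * a = g • (a * b)) (hja : j * a = u • (a * j)) (hjb : j * b = v • (b * j))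
    (h : (1 + g) - w * (v + u * g) + u * v * (1 + g) = 0) :
    (a * b + b * a) * j - w • (a * j * b + b * j * a) + j * (a * b + b * a) = 0 := by
  have e1 : a * j * b = v • (a * b * j) := by rw [mul_assoc, hjb, mul_smul_comm, mul_assoc]
  have e2 : b * j * a = (u * g) • (a * b * j) := by
    rw [mul_assoc, hja, mul_smul_comm, ← mul_assoc, hba, smul_mul_assoc, smul_smul]
  have e3 : j * (a * b) = (u * v) • (a * b * j) := by
    rw [← mul_assoc, hja, smul_mul_assoc, e1, smul_smul]
  rw [hba, e1, e2, mul_add, mul_smul_comm, e3, add_mul, smul_mul_assoc]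
  have : a * b * j + g • (a * b * j) - w • (v • (a * b * j) + (u * g) • (a * b * j)) +
      ((u * v) • (a * b * j) + g • (u * v) • (a * b * j)) =
      ((1 + g) - w * (v + u * g) + u * v * (1 + g)) • (a * b * j) := by module
  rw [this, h, zero_smul]

lemma serre_core2 {A : Type} [Ring A] [Algebra ℂ A] (a b j : A) (g u v w : ℂ)
    (hba : a * b = g • (b * a)) (hja : a * j = u • (j * a)) (hjb : b * j = v • (j * b))
    (h : (1 + g) - w * (v + u * g) + u * v * (1 + g) = 0) :
    (a * b + b * a) * j - w • (a * j * b + b * j * a) + j * (a * b + b * a) = 0 := by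
  have e1 : b * j * a = v • (j * b * a) := by rw [hjb, smul_mul_assoc]
  have e2 : a * j * b = (u * g) • (j * b * a) := by
    rw [hja, smul_mul_assoc, mul_assoc, hba, mul_smul_comm, smul_smul, ← mul_assoc]
  have e3 : b * a * j = (u * v) • (j * b * a) := by
    rw [mul_assoc, hja, mul_smul_comm, ← mul_assoc, e1, smul_smul]
  rw [hba, e1, e2, mul_add, mul_smul_comm, ← mul_assoc, add_mul, smul_mul_assoc, e3]
  have : g • (u * v) • (j * b * a) + (u * v) • (j * b * a) -
      w • ((u * g) • (j * b * a) + v • (j * b * a)) + (g • (j * b * a) + j * b * a) =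
      ((1 + g) - w * (v + u * g) + u * v * (1 + g)) • (j * b * a) := by module
  rw [this, h, zero_smul]

lemma serre_scalar (t x y z : ℂ) (ht : t ≠ 0) (h1 : x - t ^ 2 * y ≠ 0) (h2 : t * x - z ≠ 0)
    (h3 : t * y - z ≠ 0) :
    (1 + (t ^ 2 * x - y) / (x - t ^ 2 * y)) - (t + t⁻¹) * ((y - t * z) / (t * y - z) +
      (x - t * z) / (t * x - z) * ((t ^ 2 * x - y) / (x - t ^ 2 * y))) +
      (x - t * z) / (t * x - z) * ((y - t * z) / (t * y - z)) *
        (1 + (t ^ 2 * x - y) / (x - t ^ 2 * y)) = 0 := by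
  field_simp
  ring

/-- symmetrised oscillation expression -/
def oscS {A : Type} [Ring A] [Algebra ℂ A] (w : ℂ) (a b b' c : A) : A :=
  a * b * c * b' + c * b * a * b' + b' * a * b * c + b' * c * b * a +
  a * b' * c * b + c * b' * a * b + b * a * b' * c + b * c * b' * a
  - w • (b * a * c * b' + b' * a * c * b)

lemma osc_core {A : Type} [Ring A] [Algebra ℂ A] (a b b' c : A) (u u' v v' w : ℂ)
    (h1 : b * a = u • (a * b)) (h2 : b' * a = u' • (a * b')) (h3 : c * b = v • (b * c))
    (h4 : c * b' = v' • (b' * c)) (h5 : c * a = a * c) (h6 : b' * b = - (b * b'))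
    (h : v' + u * v * v' - u' - u * u' * v - v - u' * v * v' + u + u * u' * v'
      - w * (u * v' - u' * v) = 0) : oscS w a b b' c = 0 := by
  have f1 : ∀ r, b * (a * r) = u • (a * (b * r)) := fun r => by
    rw [← mul_assoc, h1, smul_mul_assoc, mul_assoc]
  have f2 : ∀ r, b' * (a * r) = u' • (a * (b' * r)) := fun r => by
    rw [← mul_assoc, h2, smul_mul_assoc, mul_assoc]
  have f3 : ∀ r, c * (b * r) = v • (b * (c * r)) := fun r => by
    rw [← mul_assoc, h3, smul_mul_assoc, mul_assoc]
  have f4 : ∀ r, c * (b' * r) = v' • (b' * (c * r)) := fun r => by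
    rw [← mul_assoc, h4, smul_mul_assoc, mul_assoc]
  have f5 : ∀ r, c * (a * r) = a * (c * r) := fun r => by
    rw [← mul_assoc, h5, mul_assoc]
  have f6 : ∀ r, b' * (b * r) = - (b * (b' * r)) := fun r => by
    rw [← mul_assoc, h6, neg_mul, mul_assoc]
  unfold oscS
  simp only [mul_assoc]
  simp only [h1, h2, h3, h4, h5, h6, f1, f2, f3, f4, f5, f6, mul_smul_comm, mul_neg,
    smul_neg, smul_smul]
  have := congrArg (fun r : ℂ => r • (a * (b * (b' * c)))) h
  simp only [zero_smul] at this
  rw [← this]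
  module

lemma osc_core' {A : Type} [Ring A] [Algebra ℂ A] (a b b' c : A) (u u' v v' w : ℂ)
    (h1 : a * b = u • (b * a)) (h2 : a * b' = u' • (b' * a)) (h3 : b * c = v • (c * b))
    (h4 : b' * c = v' • (c * b')) (h5 : a * c = c * a) (h6 : b * b' = - (b' * b))
    (h : v' + u * v * v' - u' - u * u' * v - v - u' * v * v' + u + u * u' * v'
      - w * (u * v' - u' * v) = 0) : oscS w a b b' c = 0 := by
  have f1 : ∀ r, a * (b * r) = u • (b * (a * r)) := fun r => by
    rw [← mul_assoc, h1, smul_mul_assoc, mul_assoc]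
  have f2 : ∀ r, a * (b' * r) = u' • (b' * (a * r)) := fun r => by
    rw [← mul_assoc, h2, smul_mul_assoc, mul_assoc]
  have f3 : ∀ r, b * (c * r) = v • (c * (b * r)) := fun r => by
    rw [← mul_assoc, h3, smul_mul_assoc, mul_assoc]
  have f4 : ∀ r, b' * (c * r) = v' • (c * (b' * r)) := fun r => by
    rw [← mul_assoc, h4, smul_mul_assoc, mul_assoc]
  have f5 : ∀ r, a * (c * r) = c * (a * r) := fun r => by
    rw [← mul_assoc, h5, mul_assoc]
  have f6 : ∀ r, b * (b' * r) = - (b' * (b * r)) := fun r => by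
    rw [← mul_assoc, h6, neg_mul, mul_assoc]
  unfold oscS
  simp only [mul_assoc]
  simp only [h1, h2, h3, h4, h5, h6, f1, f2, f3, f4, f5, f6, mul_smul_comm, mul_neg,
    smul_neg, smul_smul]
  have := congrArg (fun r : ℂ => r • (c * (b' * (b * a)))) h
  simp only [zero_smul] at this
  rw [← this]
  module

lemma osc_scalar (t x y y' z : ℂ) (ht : t ≠ 0) (h1 : t⁻¹ * x - y ≠ 0) (h2 : t⁻¹ * x - y' ≠ 0)
    (h3 : t * y - z ≠ 0) (h4 : t * y' - z ≠ 0) (u u' v v' : ℂ)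
    (hu : u = (x - t⁻¹ * y) / (t⁻¹ * x - y)) (hu' : u' = (x - t⁻¹ * y') / (t⁻¹ * x - y'))
    (hv : v = (y - t * z) / (t * y - z)) (hv' : v' = (y' - t * z) / (t * y' - z)) :
    v' + u * v * v' - u' - u * u' * v - v - u' * v * v' + u + u * u' * v'
      - (t + t⁻¹) * (u * v' - u' * v) = 0 := by
  have k1 : u = (t * x - y) / (x - t * y) := by
    rw [hu, show x - t⁻¹ * y = t⁻¹ * (t * x - y) by field_simp,
      show t⁻¹ * x - y = t⁻¹ * (x - t * y) by field_simp]
    rw [mul_div_mul_left _ _ (inv_ne_zero ht)]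
  have k2 : u' = (t * x - y') / (x - t * y') := by
    rw [hu', show x - t⁻¹ * y' = t⁻¹ * (t * x - y') by field_simp,
      show t⁻¹ * x - y' = t⁻¹ * (x - t * y') by field_simp]
    rw [mul_div_mul_left _ _ (inv_ne_zero ht)]
  have h1' : x - t * y ≠ 0 := by
    rw [show t⁻¹ * x - y = t⁻¹ * (x - t * y) by field_simp] at h1
    exact right_ne_zero_of_mul h1
  have h2' : x - t * y' ≠ 0 := by
    rw [show t⁻¹ * x - y' = t⁻¹ * (x - t * y') by field_simp] at h2
    exact right_ne_zero_of_mul h2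
  rw [k1, k2, hv, hv']
  clear hu hu' hv hv' k1 k2 h1 h2
  generalize e1 : x - t * y = d1 at *
  generalize e2 : x - t * y' = d2 at *
  generalize e3 : t * y - z = d3 at *
  generalize e4 : t * y' - z = d4 at *
  field_simp
  subst e1 e2 e3 e4
  ring

end QAS

namespace QAS
open Finset Function

/-- genericity of the evaluation points -/
structure Gn {n : ℕ} (q : ℂ) (a : Fin n → ℂ) : Prop where
  q0 : q ≠ 0
  q1 : ∀ e : ℤ, e ≠ 0 → q ^ e ≠ 1
  a0 : ∀ k, a k ≠ 0
  ne : ∀ k l, k ≠ l → ∀ e : ℤ, a k ≠ q ^ e * a l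

def kap (q : ℂ) (M i c : ℕ) : ℂ := q ^ kk M i c

def xx {n : ℕ} (q : ℂ) (M : ℕ) (a : Fin n → ℂ) (i : ℕ) (k : Fin n) : ℂ := q ^ ee M i * a k

def psi {n : ℕ} (q : ℂ) (M : ℕ) (a : Fin n → ℂ) (i : ℕ) (k k' : Fin n) (c : ℕ) : ℂ :=
  (kap q M i c * a k - (kap q M i c)⁻¹ * a k') / (a k - a k')

def EE {n : ℕ} (q : ℂ) (M : ℕ) (a : Fin n → ℂ) (i : ℕ) (k : Fin n) :
    Module.End ℂ ((Fin n → ℕ) → ℂ) :=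
  T k i (i + 1) (fun k' c => if k' < k then sg M i c * psi q M a i k k' c else 1)

def GG {n : ℕ} (q : ℂ) (M : ℕ) (a : Fin n → ℂ) (i : ℕ) (k : Fin n) :
    Module.End ℂ ((Fin n → ℕ) → ℂ) :=
  T k (i + 1) i (fun k' c => if k' < k then sg M i c else psi q M a i k k' c)

variable {n : ℕ} {q : ℂ} {M : ℕ} {a : Fin n → ℂ}

lemma xx_ne_zero (h : Gn q a) (i : ℕ) (k : Fin n) : xx q M a i k ≠ 0 :=
  mul_ne_zero (zpow_ne_zero _ h.q0) (h.a0 k)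

lemma xx_ne (h : Gn q a) (e : ℤ) (i j : ℕ) (k l : Fin n)
    (hh : k ≠ l ∨ e + ee M i - ee M j ≠ 0) : q ^ e * xx q M a i k ≠ xx q M a j l := by
  unfold xx
  intro H
  have hq := h.q0
  have H2 : a k = q ^ (ee M j - ee M i - e) * a l := by
    rw [zpow_sub₀ hq, zpow_sub₀ hq]
    have := zpow_ne_zero (ee M i) hq
    have := zpow_ne_zero e hq
    field_simp
    linear_combination H
  by_cases hkl : k = l
  · subst hkl
    rcases hh with hh | hh
    · exact hh rfl
    · have h3 : q ^ (ee M j - ee M i - e) = 1 := by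
        have := h.a0 k
        field_simp at H2
        exact H2.symm
      exact h.q1 _ (by omega) h3
  · exact h.ne k l hkl _ H2

lemma sub_ne (h : Gn q a) {k l : Fin n} (hkl : k ≠ l) : a k - a l ≠ 0 := by
  have := h.ne k l hkl 0
  simp at this
  exact sub_ne_zero.mpr this

lemma scal1 (h : Gn q a) (i j : ℕ) (k l : Fin n) (hkl : k ≠ l) :
    (xx q M a i k - q ^ cc M i j * xx q M a j l) * psi q M a j l k (i + 1) =
    (q ^ cc M i j * xx q M a i k - xx q M a j l) * psi q M a j l k i := by
  have hq := h.q0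
  have hd := sub_ne h hkl.symm
  have h1 : kk M j i = kk M j (i + 1) + cc M i j := by rw [cc_symm, cc_kk]; ring
  unfold psi xx kap
  rcases cc_ee M j i with h2 | h2
  · rw [cc_symm] at h2
    rw [h1, h2]; simp
  · rw [show ee M j = ee M i + (kk M j i + kk M j (i+1)) by omega, h1]
    generalize kk M j (i + 1) = A
    generalize cc M i j = C
    generalize ee M i = B
    simp only [zpow_add₀ hq]
    have e1 := zpow_ne_zero A hq
    have e2 := zpow_ne_zero B hq
    have e3 := zpow_ne_zero C hq
    generalize q ^ A = A' at *
    generalize q ^ B = B' at *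
    generalize q ^ C = C' at *
    field_simp
    ring

lemma scal2 (h : Gn q a) (i j : ℕ) (k l : Fin n) (hkl : k ≠ l) :
    (xx q M a i k - q ^ (-cc M i j) * xx q M a j l) * psi q M a i k l (j + 1) =
    (q ^ (-cc M i j) * xx q M a i k - xx q M a j l) * psi q M a i k l j := by
  have hq := h.q0
  have hd := sub_ne h hkl
  have h1 : kk M i j = kk M i (j + 1) + cc M i j := by rw [cc_kk]; ring
  unfold psi xx kap
  rcases cc_ee M i j with h2 | h2
  · rw [h1, h2]; simp
  · rw [show ee M i = ee M j + (kk M i j + kk M i (j+1)) by omega, h1]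
    generalize kk M i (j + 1) = A
    generalize cc M i j = C
    generalize ee M j = B
    simp only [zpow_add₀ hq, zpow_neg]
    have e1 := zpow_ne_zero A hq
    have e2 := zpow_ne_zero B hq
    have e3 := zpow_ne_zero C hq
    generalize q ^ A = A' at *
    generalize q ^ B = B' at *
    generalize q ^ C = C' at *
    field_simp

lemma scal3 (h : Gn q a) (i j : ℕ) (k l : Fin n) (hkl : k ≠ l) :
    psi q M a i k l (j + 1) * psi q M a j l k (i + 1) = psi q M a i k l j * psi q M a j l k i := by
  have h1 : kk M i j = kk M i (j + 1) + cc M i j := by rw [cc_kk]; ring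
  have h1' : kk M j i = kk M j (i + 1) + cc M i j := by rw [cc_symm, cc_kk]; ring
  have key : ∀ u v w w', kk M i w = - kk M j w' → u ≠ v →
      psi q M a i u v w = psi q M a j v u w' := by
    intro u v w w' hw huv
    have d1 := sub_ne h huv
    have d2 := sub_ne h huv.symm
    unfold psi kap
    rw [hw, zpow_neg, inv_inv]
    field_simp
    ring
  rcases cc_ee M i j with h2 | h2
  · rw [h2] at h1 h1'
    unfold psi kap
    rw [h1, h1']; simp
  · rcases cc_ee M j i with h3 | h3
    · rw [cc_symm] at h3
      rw [h3] at h1 h1'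
      unfold psi kap
      rw [h1, h1']; simp
    · rw [key k l (j+1) i (by omega) hkl, key k l j (i+1) (by omega) hkl]
      ring

lemma EQ_lt (h : Gn q a) (i j : ℕ) (k l : Fin n) (hkl : k < l) :
    (xx q M a i k - q ^ cc M i j * xx q M a j l) • (EE q M a i k * EE q M a j l) =
    (sgn M i j * (q ^ cc M i j * xx q M a i k - xx q M a j l)) •
      (EE q M a j l * EE q M a i k) := by
  unfold EE
  apply T_comm _ _ hkl.ne
  simp only [hkl, not_lt_of_gt hkl, if_true, if_false]
  rw [sg_step]
  linear_combination (sgn M i j * sg M j i) * scal1 (M := M) h i j k l hkl.ne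

lemma GQ_lt (h : Gn q a) (i j : ℕ) (k l : Fin n) (hkl : k < l) :
    (xx q M a i k - q ^ (-cc M i j) * xx q M a j l) • (GG q M a i k * GG q M a j l) =
    (sgn M i j * (q ^ (-cc M i j) * xx q M a i k - xx q M a j l)) •
      (GG q M a j l * GG q M a i k) := by
  unfold GG
  apply T_comm _ _ hkl.ne
  simp only [hkl, not_lt_of_gt hkl, if_true, if_false]
  rw [sg_step]
  linear_combination (sg M j i) * scal2 (M := M) h i j k l hkl.ne -
    (sg M j i) * (q ^ (-cc M i j) * xx q M a i k - xx q M a j l) *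
      psi q M a i k l j * sgn_sq M i j

lemma EE_same (i j : ℕ) (k : Fin n) (hij : i + 1 ≠ j) : EE q M a i k * EE q M a j k = 0 :=
  T_same_zero _ _ _ _ _ _ _ hij

lemma GG_same (i j : ℕ) (k : Fin n) (hij : i ≠ j + 1) : GG q M a i k * GG q M a j k = 0 :=
  T_same_zero _ _ _ _ _ _ _ hij

lemma xx_succ (h : Gn q a) (i : ℕ) (k : Fin n) :
    q ^ cc M i (i + 1) * xx q M a (i + 1) k = xx q M a i k := by
  unfold xx
  rw [← mul_assoc, ← zpow_add₀ h.q0, cc_succ, ee]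
  congr 2; ring

lemma xx_succ' (h : Gn q a) (i : ℕ) (k : Fin n) :
    q ^ (-cc M i (i + 1)) * xx q M a i k = xx q M a (i + 1) k := by
  unfold xx
  rw [← mul_assoc, ← zpow_add₀ h.q0, cc_succ, ee]
  congr 2; ring

lemma EQ (h : Gn q a) (i j : ℕ) (k l : Fin n) :
    (xx q M a i k - q ^ cc M i j * xx q M a j l) • (EE q M a i k * EE q M a j l) =
    (sgn M i j * (q ^ cc M i j * xx q M a i k - xx q M a j l)) •
      (EE q M a j l * EE q M a i k) := by
  rcases lt_trichotomy k l with hkl | hkl | hkl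
  · exact EQ_lt h i j k l hkl
  · subst hkl
    by_cases h1 : i + 1 = j
    · subst h1
      rw [xx_succ h, EE_same (i + 1) i k (by omega)]; simp
    · rw [EE_same i j k h1]
      by_cases h2 : j + 1 = i
      · subst h2
        rw [cc_symm, xx_succ h]; simp
      · rw [EE_same j i k h2]; simp
  · have := EQ_lt (M := M) h j i l k hkl
    rw [sgn_symm M j i, cc_symm M j i] at this
    have h2 := sgn_sq M i j
    have e : (sgn M i j * (q ^ cc M i j * xx q M a i k - xx q M a j l)) •
      (EE q M a j l * EE q M a i k) = (-sgn M i j) •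
       ((xx q M a j l - q ^ cc M i j * xx q M a i k) • (EE q M a j l * EE q M a i k)) := by module
    rw [e, this, smul_smul]
    congr 1
    linear_combination (q ^ cc M i j * xx q M a j l - xx q M a i k) * h2

lemma GQ (h : Gn q a) (i j : ℕ) (k l : Fin n) :
    (xx q M a i k - q ^ (-cc M i j) * xx q M a j l) • (GG q M a i k * GG q M a j l) =
    (sgn M i j * (q ^ (-cc M i j) * xx q M a i k - xx q M a j l)) •
      (GG q M a j l * GG q M a i k) := by
  rcases lt_trichotomy k l with hkl | hkl | hkl
  · exact GQ_lt h i j k l hkl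
  · subst hkl
    by_cases h1 : i + 1 = j
    · subst h1
      rw [xx_succ' h, GG_same i (i + 1) k (by omega)]; simp
    · rw [GG_same j i k (by omega)]
      by_cases h2 : j + 1 = i
      · subst h2
        rw [cc_symm, xx_succ' h]; simp
      · rw [GG_same i j k (by omega)]; simp
  · have := GQ_lt (M := M) h j i l k hkl
    rw [sgn_symm M j i, cc_symm M j i] at this
    have h2 := sgn_sq M i j
    have e : (sgn M i j * (q ^ (-cc M i j) * xx q M a i k - xx q M a j l)) •
      (GG q M a j l * GG q M a i k) = (-sgn M i j) •
       ((xx q M a j l - q ^ (-cc M i j) * xx q M a i k) • (GG q M a j l * GG q M a i k)) := by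
      module
    rw [e, this, smul_smul]
    congr 1
    linear_combination (q ^ (-cc M i j) * xx q M a j l - xx q M a i k) * h2

lemma cc_zero_ne (M i j : ℕ) (hc : cc M i j = 0) : i + 1 ≠ j ∧ i ≠ j + 1 := by
  constructor
  · rintro rfl
    rw [cc_succ] at hc
    rcases lof_cases M (i + 1) with h | h <;> omega
  · rintro rfl
    rw [cc_symm, cc_succ] at hc
    rcases lof_cases M (j + 1) with h | h <;> omega

lemma E0 (h : Gn q a) (i j : ℕ) (k l : Fin n) (hc : cc M i j = 0) :
    EE q M a i k * EE q M a j l = sgn M i j • (EE q M a j l * EE q M a i k) := by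
  obtain ⟨h1, h2⟩ := cc_zero_ne M i j hc
  by_cases hkl : k = l
  · subst hkl
    rw [EE_same i j k h1, EE_same j i k (by omega)]; simp
  · have H := EQ (M := M) h i j k l
    rw [hc] at H
    have hn := xx_ne (M := M) h 0 i j k l (Or.inl hkl)
    simp only [zpow_zero, one_mul] at H hn
    rw [mul_comm, mul_smul] at H
    exact smul_right_injective _ (sub_ne_zero.mpr hn) H

lemma G0 (h : Gn q a) (i j : ℕ) (k l : Fin n) (hc : cc M i j = 0) :
    GG q M a i k * GG q M a j l = sgn M i j • (GG q M a j l * GG q M a i k) := by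
  obtain ⟨h1, h2⟩ := cc_zero_ne M i j hc
  by_cases hkl : k = l
  · subst hkl
    rw [GG_same i j k h2, GG_same j i k (by omega)]; simp
  · have H := GQ (M := M) h i j k l
    rw [hc] at H
    have hn := xx_ne (M := M) h 0 i j k l (Or.inl hkl)
    simp only [zpow_zero, one_mul, neg_zero] at H hn
    rw [mul_comm, mul_smul] at H
    exact smul_right_injective _ (sub_ne_zero.mpr hn) H

lemma EG_ne (h : Gn q a) (i j : ℕ) (k l : Fin n) (hkl : k ≠ l ∨ i ≠ j) :
    EE q M a i k * GG q M a j l = sgn M i j • (GG q M a j l * EE q M a i k) := by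
  by_cases hk : k = l
  · subst hk
    have hij : i ≠ j := by tauto
    unfold EE GG
    rw [T_same_zero _ _ _ _ _ _ _ (by omega), T_same_zero _ _ _ _ _ _ _ (Ne.symm hij)]; simp
  · rw [← one_smul ℂ (EE q M a i k * GG q M a j l)]
    unfold EE GG
    apply T_comm _ _ hk
    rcases lt_or_gt_of_ne hk with hlt | hlt
    · simp only [hlt, not_lt_of_gt hlt, if_true, if_false]
      rw [sg_step]; ring
    · simp only [hlt, not_lt_of_gt hlt, if_true, if_false]
      rw [sg_step M j i, sgn_symm M j i]
      linear_combination (sgn M i j * sg M i j) * scal3 (M := M) h i j k l hk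

lemma lof_succ (M i : ℕ) (hi : i ≠ M) : lof M (i + 1) = lof M i := by
  unfold lof
  by_cases h : i ≤ M
  · rw [if_pos h, if_pos (by omega)]
  · rw [if_neg h, if_neg (by omega)]

lemma EG_same (i : ℕ) (k : Fin n) (hq2 : q ^ lof M i - (q ^ lof M i)⁻¹ ≠ 0)
    (f : (Fin n → ℕ) → ℂ) (c : Fin n → ℕ) :
    (EE q M a i k * GG q M a i k - sgn M i i • (GG q M a i k * EE q M a i k)) f c =
      ((q ^ lof M i - (q ^ lof M i)⁻¹)⁻¹ * ((kap q M i (c k) - (kap q M i (c k))⁻¹) *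
        ∏ k' ∈ univ.erase k, psi q M a i k k' (c k'))) * f c := by
  rw [LinearMap.sub_apply, LinearMap.smul_apply, Pi.sub_apply, Pi.smul_apply]
  unfold EE GG
  rw [T_same, T_same]
  have e1 : ∀ k' ∈ univ.erase k, ((if k' < k then sg M i (c k') * psi q M a i k k' (c k') else 1) *
    (if k' < k then sg M i (c k') else psi q M a i k k' (c k'))) = psi q M a i k k' (c k') := by
    intro k' _
    split
    · linear_combination psi q M a i k k' (c k') * sg_sq M i (c k')
    · ring
  have e2 : ∀ k' ∈ univ.erase k, ((if k' < k then sg M i (c k') else psi q M a i k k' (c k')) *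
    (if k' < k then sg M i (c k') * psi q M a i k k' (c k') else 1)) = psi q M a i k k' (c k') := by
    intro k' hk'
    rw [mul_comm, e1 k' hk']
  rw [Finset.prod_congr rfl e1, Finset.prod_congr rfl e2]
  generalize ∏ k' ∈ univ.erase k, psi q M a i k k' (c k') = P
  rw [smul_eq_mul, ← mul_assoc, ← sub_mul]
  congr 1
  by_cases h1 : c k = i
  · have : ¬ (c k = i + 1) := by omega
    simp only [h1, if_true, this, if_false]
    rw [if_neg (by omega)]
    simp only [kap, kk, if_true]
    linear_combination (-P) * inv_mul_cancel₀ hq2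
  · by_cases h2 : c k = i + 1
    · simp only [h2, if_true]
      rw [if_neg (by omega)]
      simp only [kap, kk, if_true]
      rw [if_neg (by omega)]
      by_cases hi : i = M
      · subst hi
        have l1 : lof i i = 1 := by simp [lof]
        have l2 : lof i (i + 1) = -1 := by simp [lof]
        rw [l1] at hq2 ⊢
        have hs : sgn i i i = -1 := by simp [sgn]
        rw [l2, neg_neg, hs]
        linear_combination (-P) * inv_mul_cancel₀ hq2
      · rw [lof_succ M i hi]
        have : sgn M i i = 1 := by simp [sgn, hi]
        rw [this, zpow_neg, inv_inv]
        linear_combination P * inv_mul_cancel₀ hq2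
    · simp [h1, h2, kap, kk]

/-- abstract Serre vanishing -/
lemma serreA {A : Type} [Ring A] [Algebra ℂ A] (u v j : A) (t x y z : ℂ) (ht : t ≠ 0)
    (h1 : x - t ^ 2 * y ≠ 0) (h2 : t * x - z ≠ 0) (h3 : t * y - z ≠ 0)
    (q1 : (x - (t ^ 2)⁻¹ * y) • (u * v) = ((t ^ 2)⁻¹ * x - y) • (v * u))
    (q2 : (x - t * z) • (u * j) = (t * x - z) • (j * u))
    (q3 : (y - t * z) • (v * j) = (t * y - z) • (j * v)) :
    (u * v + v * u) * j - (t + t⁻¹) • (u * j * v + v * j * u) + j * (u * v + v * u) = 0 := by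
  have sol : ∀ (α β : ℂ) (P Q : A), β ≠ 0 → α • P = β • Q → Q = (α / β) • P := by
    intro α β P Q hβ hh
    rw [div_eq_inv_mul, mul_smul, hh, smul_smul, inv_mul_cancel₀ hβ, one_smul]
  have ht2 : t ^ 2 ≠ 0 := pow_ne_zero _ ht
  have h1' : (t ^ 2)⁻¹ * x - y ≠ 0 := by
    rw [show (t ^ 2)⁻¹ * x - y = (t ^ 2)⁻¹ * (x - t ^ 2 * y) by field_simp]
    exact mul_ne_zero (inv_ne_zero ht2) h1
  have e1 := sol _ _ _ _ h1' q1
  rw [show x - (t ^ 2)⁻¹ * y = (t ^ 2)⁻¹ * (t ^ 2 * x - y) by field_simp,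
    show (t ^ 2)⁻¹ * x - y = (t ^ 2)⁻¹ * (x - t ^ 2 * y) by field_simp,
    mul_div_mul_left _ _ (inv_ne_zero ht2)] at e1
  exact serre_core1 u v j _ _ _ _ e1 (sol _ _ _ _ h2 q2) (sol _ _ _ _ h3 q3)
    (serre_scalar t x y z ht h1 h2 h3)

lemma serreB {A : Type} [Ring A] [Algebra ℂ A] (u v j : A) (t x y z : ℂ) (ht : t ≠ 0)
    (h1 : t ^ 2 * x - y ≠ 0) (h2 : x - t * z ≠ 0) (h3 : y - t * z ≠ 0)
    (q1 : (x - (t ^ 2)⁻¹ * y) • (u * v) = ((t ^ 2)⁻¹ * x - y) • (v * u))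
    (q2 : (x - t * z) • (u * j) = (t * x - z) • (j * u))
    (q3 : (y - t * z) • (v * j) = (t * y - z) • (j * v)) :
    (u * v + v * u) * j - (t + t⁻¹) • (u * j * v + v * j * u) + j * (u * v + v * u) = 0 := by
  have sol : ∀ (α β : ℂ) (P Q : A), β ≠ 0 → β • P = α • Q → P = (α / β) • Q := by
    intro α β P Q hβ hh
    rw [div_eq_inv_mul, mul_smul, ← hh, smul_smul, inv_mul_cancel₀ hβ, one_smul]
  have ht2 : t ^ 2 ≠ 0 := pow_ne_zero _ ht
  have f1 : t⁻¹ * x - z ≠ 0 := by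
    rw [show t⁻¹ * x - z = t⁻¹ * (x - t * z) by field_simp]
    exact mul_ne_zero (inv_ne_zero ht) h2
  have f2 : t⁻¹ * y - z ≠ 0 := by
    rw [show t⁻¹ * y - z = t⁻¹ * (y - t * z) by field_simp]
    exact mul_ne_zero (inv_ne_zero ht) h3
  have f3 : x - t⁻¹ ^ 2 * y ≠ 0 := by
    rw [show x - t⁻¹ ^ 2 * y = (t ^ 2)⁻¹ * (t ^ 2 * x - y) by field_simp]
    exact mul_ne_zero (inv_ne_zero ht2) h1
  have e1 := sol _ _ _ _ (by rwa [← inv_pow]) q1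
  have e2 := sol _ _ _ _ h2 q2
  have e3 := sol _ _ _ _ h3 q3
  rw [show (t * x - z) / (x - t * z) = (x - t⁻¹ * z) / (t⁻¹ * x - z) by
    field_simp] at e2
  rw [show (t * y - z) / (y - t * z) = (y - t⁻¹ * z) / (t⁻¹ * y - z) by
    field_simp] at e3
  rw [← inv_pow] at e1
  have := serre_scalar t⁻¹ x y z (inv_ne_zero ht) f3 f1 f2
  rw [inv_inv] at this
  rw [add_comm t]
  exact serre_core2 u v j _ _ _ _ e1 e2 e3 this

end QAS

namespace QAS
open Finset Function

lemma expC_map {A B : Type} [Ring A] [Algebra ℂ A] [Ring B] [Algebra ℂ B] (f : A →ₐ[ℂ] B)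
    (t : ℂ) (a : ℕ → A) (n : ℕ) : f (expC t a n) = expC t (fun s => f (a s)) n := by
  induction n using Nat.strong_induction_on with
  | _ n ih =>
    cases n with
    | zero => simp [expC]
    | succ n =>
      rw [expC, expC]
      simp only [map_smul, map_sum, map_mul]
      congr 2
      apply Finset.sum_congr rfl
      intro s hs
      rw [ih (n - s) (by omega)]

lemma expC_congr {A : Type} [Ring A] [Algebra ℂ A] (t : ℂ) (a b : ℕ → A)
    (h : ∀ s, a (s + 1) = b (s + 1)) (n : ℕ) : expC t a n = expC t b n := by
  induction n using Nat.strong_induction_on with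
  | _ n ih =>
    cases n with
    | zero => simp [expC]
    | succ n =>
      rw [expC, expC]
      congr 2
      apply Finset.sum_congr rfl
      intro s hs
      rw [ih (n - s) (by omega), h]

lemma expC_unique (t : ℂ) (a F : ℕ → ℂ) (h0 : F 0 = 1)
    (h : ∀ n : ℕ, ((n : ℂ) + 1) * F (n + 1) =
      ∑ s ∈ Finset.range (n + 1), t * (((s : ℂ) + 1) * a (s + 1)) * F (n - s)) (n : ℕ) :
    expC t a n = F n := by
  induction n using Nat.strong_induction_on with
  | _ n ih =>
    cases n with
    | zero => simp [expC, h0]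
    | succ n =>
      rw [expC]
      have hn : ((n : ℂ) + 1) ≠ 0 := by exact_mod_cast Nat.succ_ne_zero n
      simp only [smul_eq_mul]
      rw [inv_mul_eq_iff_eq_mul₀ hn, h, Finset.mul_sum]
      apply Finset.sum_congr rfl
      intro s hs
      rw [ih (n - s) (by omega)]
      ring

/-- geometric series -/
def geo (x : ℂ) : PowerSeries ℂ := PowerSeries.mk fun n => x ^ n

lemma geo_mul (x : ℂ) : (1 - PowerSeries.C x * PowerSeries.X) * geo x = 1 := by
  ext n
  rw [sub_mul, one_mul, map_sub, mul_assoc, PowerSeries.coeff_C_mul]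
  cases n with
  | zero => simp [geo]
  | succ n =>
    rw [PowerSeries.coeff_succ_X_mul]
    simp [geo, PowerSeries.coeff_one, pow_succ]
    ring

lemma geo_rel (x y : ℂ) : (x - y) • (geo x * geo y) = x • geo x - y • geo y := by
  have h1 := geo_mul x
  have h2 := geo_mul y
  simp only [PowerSeries.smul_eq_C_mul, map_sub]
  linear_combination (PowerSeries.C x * geo x) * h2 - (PowerSeries.C y * geo y) * h1

def dl (x : ℂ) : PowerSeries ℂ := PowerSeries.mk fun n => x ^ (n + 1)

lemma dl_eq (x : ℂ) : dl x = PowerSeries.C x * geo x := by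
  ext n
  rw [PowerSeries.coeff_C_mul]
  simp [dl, geo, pow_succ]; ring

lemma geo_deriv (x : ℂ) : PowerSeries.derivative ℂ (geo x) = dl x * geo x := by
  have h1 := geo_mul x
  have h2 := congrArg (PowerSeries.derivative ℂ) h1
  rw [Derivation.leibniz, map_sub, Derivation.leibniz] at h2
  simp [PowerSeries.derivative_C] at h2
  rw [dl_eq]
  linear_combination (geo x) * h2 - (PowerSeries.derivative ℂ (geo x)) * h1

/-- single factor -/
def ff (κ x : ℂ) : PowerSeries ℂ := (1 - PowerSeries.C (κ⁻¹ ^ 2 * x) * PowerSeries.X) * geo x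

lemma ff_deriv (κ x : ℂ) :
    PowerSeries.derivative ℂ (ff κ x) = (dl x - dl (κ⁻¹ ^ 2 * x)) * ff κ x := by
  unfold ff
  generalize κ⁻¹ ^ 2 * x = y
  rw [Derivation.leibniz, geo_deriv, map_sub, Derivation.leibniz]
  simp [PowerSeries.derivative_C]
  rw [dl_eq y]
  have h1 := geo_mul y
  linear_combination (PowerSeries.C y * geo x) * h1

lemma prod_deriv {n : ℕ} (S : Finset (Fin n)) (κ x : Fin n → ℂ) :
    PowerSeries.derivative ℂ (∏ k ∈ S, ff (κ k) (x k)) =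
      (∑ k ∈ S, (dl (x k) - dl ((κ k)⁻¹ ^ 2 * x k))) * ∏ k ∈ S, ff (κ k) (x k) := by
  induction S using Finset.induction_on with
  | empty => simp
  | insert p S hp ih =>
    rw [Finset.prod_insert hp, Finset.sum_insert hp, Derivation.leibniz, ih, ff_deriv]
    simp only [smul_eq_mul]
    ring

lemma expC_prod {n : ℕ} (κ x : Fin n → ℂ) (t : ℂ) (A : ℕ → ℂ)
    (hA : ∀ s : ℕ, t * (((s : ℂ) + 1) * A (s + 1)) =
      ∑ k, (1 - (κ k)⁻¹ ^ (2 * (s + 1))) * x k ^ (s + 1)) (m : ℕ) :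
    expC t A m = PowerSeries.coeff m (∏ k, ff (κ k) (x k)) := by
  apply expC_unique t A (fun m => PowerSeries.coeff m (∏ k, ff (κ k) (x k)))
  · simp only [PowerSeries.coeff_zero_eq_constantCoeff, map_prod]
    apply Finset.prod_eq_one
    intro k _
    simp only [ff, map_mul, map_sub]
    simp [geo, ← PowerSeries.coeff_zero_eq_constantCoeff]
  · intro m
    have h := congrArg (PowerSeries.coeff m) (prod_deriv univ κ x)
    rw [PowerSeries.coeff_derivative, PowerSeries.coeff_mul,
      Finset.Nat.sum_antidiagonal_eq_sum_range_succ (fun i j => (PowerSeries.coeff i)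
        (∑ k, (dl (x k) - dl ((κ k)⁻¹ ^ 2 * x k))) *
        (PowerSeries.coeff j) (∏ k, ff (κ k) (x k)))] at h
    rw [mul_comm, h]
    apply Finset.sum_congr rfl
    intro s hs
    congr 1
    rw [hA, map_sum]
    apply Finset.sum_congr rfl
    intro k _
    simp [dl]
    ring

def rr {n : ℕ} (κ x : Fin n → ℂ) (S : Finset (Fin n)) (k : Fin n) : ℂ :=
  (κ k - (κ k)⁻¹) * ∏ k' ∈ S.erase k, (κ k' * x k - (κ k')⁻¹ * x k') / (x k - x k')

lemma pf {n : ℕ} (κ x : Fin n → ℂ) (hx : ∀ k l, k ≠ l → x k - x l ≠ 0) (S : Finset (Fin n)) :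
    ∀ (R : Type) [CommRing R] [Algebra ℂ R] (g : Fin n → R)
      (_ : ∀ k ∈ S, ∀ l ∈ S, k ≠ l → (x k - x l) • (g k * g l) = x k • g k - x l • g l),
    ∏ k ∈ S, (algebraMap ℂ R (κ k)⁻¹ + (κ k - (κ k)⁻¹) • g k) =
      algebraMap ℂ R (∏ k ∈ S, (κ k)⁻¹) + ∑ k ∈ S, rr κ x S k • g k := by
  induction S using Finset.induction_on with
  | empty => intro R _ _ g _; simp
  | insert p S hp ih =>
    intro R _ _ g hg
    have hpne : ∀ k ∈ S, k ≠ p := fun k hk h => hp (h ▸ hk)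
    rw [Finset.prod_insert hp, Finset.prod_insert hp, Finset.sum_insert hp,
      ih R g (fun k hk l hl => hg k (mem_insert_of_mem hk) l (mem_insert_of_mem hl))]
    have h1 : rr κ x (insert p S) p = (κ p - (κ p)⁻¹) *
        (∏ k ∈ S, (κ k)⁻¹ + ∑ k ∈ S, rr κ x S k * (x p / (x p - x k))) := by
      unfold rr
      rw [Finset.erase_insert hp]
      congr 1
      have := ih ℂ (fun k => x p / (x p - x k)) (by
        intro k hk l hl hkl
        have d1 := hx p k (hpne k hk).symm
        have d2 := hx p l (hpne l hl).symm
        simp only [smul_eq_mul]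
        field_simp
        ring)
      simp only [smul_eq_mul, Algebra.algebraMap_self, RingHom.id_apply] at this
      unfold rr at this
      rw [← this]
      apply Finset.prod_congr rfl
      intro k hk
      have d1 := hx p k (hpne k hk).symm
      field_simp
      ring
    have h2 : ∀ k ∈ S, rr κ x (insert p S) k =
        rr κ x S k * ((κ p)⁻¹ + (κ p - (κ p)⁻¹) * (x k / (x k - x p))) := by
      intro k hk
      unfold rr
      rw [Finset.erase_insert_of_ne (hpne k hk).symm, Finset.prod_insert (by simp [hp]), mul_assoc]
      congr 1
      rw [mul_comm]
      congr 1
      have d1 := hx k p (hpne k hk)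
      field_simp
      ring
    have h3 : ∀ k ∈ S, g p * g k = (x k / (x k - x p)) • g k + (x p / (x p - x k)) • g p := by
      intro k hk
      have d1 := hx k p (hpne k hk)
      have d2 := hx p k (hpne k hk).symm
      have e := hg k (mem_insert_of_mem hk) p (mem_insert_self _ _) (hpne k hk)
      have e2 : g p * g k = (x k - x p)⁻¹ • ((x k - x p) • (g k * g p)) := by
        rw [smul_smul, inv_mul_cancel₀ d1, one_smul, mul_comm]
      rw [e2, e, smul_sub, smul_smul, smul_smul, sub_eq_add_neg, ← neg_smul]
      congr 2
      · rw [div_eq_inv_mul]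
      · rw [show x p - x k = - (x k - x p) by ring, div_neg, div_eq_inv_mul]
    have h5 : ∑ k ∈ S, rr κ x (insert p S) k • g k = ∑ k ∈ S,
        (rr κ x S k * ((κ p)⁻¹ + (κ p - (κ p)⁻¹) * (x k / (x k - x p)))) • g k :=
      Finset.sum_congr rfl (fun k hk => by rw [h2 k hk])
    rw [h5, h1, add_mul, mul_add, mul_add]
    have h4 : (κ p - (κ p)⁻¹) • g p * ∑ k ∈ S, rr κ x S k • g k =
        ∑ k ∈ S, (rr κ x S k * ((κ p - (κ p)⁻¹) * (x k / (x k - x p)))) • g k +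
        (∑ k ∈ S, (κ p - (κ p)⁻¹) * (rr κ x S k * (x p / (x p - x k)))) • g p := by
      rw [Finset.mul_sum, Finset.sum_smul, ← Finset.sum_add_distrib]
      apply Finset.sum_congr rfl
      intro k hk
      rw [smul_mul_smul_comm, h3 k hk]
      module
    rw [h4, Algebra.algebraMap_eq_smul_one, Algebra.algebraMap_eq_smul_one,
      Algebra.algebraMap_eq_smul_one, smul_mul_smul_comm, one_mul, smul_mul_smul_comm,
      mul_one, smul_one_mul, Finset.smul_sum]
    simp only [mul_add, add_smul, Finset.sum_add_distrib, Finset.mul_sum, smul_smul]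
    simp only [mul_comm (κ p)⁻¹]
    abel

lemma ff_eq (κ x : ℂ) (hκ : κ ≠ 0) :
    PowerSeries.C κ * ff κ x = algebraMap ℂ (PowerSeries ℂ) κ⁻¹ + (κ - κ⁻¹) • geo x := by
  have h := geo_mul x
  have e : PowerSeries.C κ * PowerSeries.C (κ⁻¹ ^ 2 * x) = PowerSeries.C κ⁻¹ * PowerSeries.C x := by
    rw [← map_mul, ← map_mul]; congr 1; field_simp
  unfold ff
  rw [PowerSeries.smul_eq_C_mul, map_sub, show algebraMap ℂ (PowerSeries ℂ) κ⁻¹ =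
    PowerSeries.C κ⁻¹ from rfl]
  linear_combination (- PowerSeries.X * geo x) * e + (PowerSeries.C κ⁻¹) * h

lemma phi_coeff {n : ℕ} (κ x : Fin n → ℂ) (hx : ∀ k l, k ≠ l → x k - x l ≠ 0)
    (hκ : ∀ k, κ k ≠ 0) (t : ℂ) (A : ℕ → ℂ)
    (hA : ∀ s : ℕ, t * (((s : ℂ) + 1) * A (s + 1)) =
      ∑ k, (1 - (κ k)⁻¹ ^ (2 * (s + 1))) * x k ^ (s + 1)) (m : ℕ) :
    (∏ k, κ k) * expC t A m =
      (if m = 0 then ∏ k, (κ k)⁻¹ else 0) + ∑ k, rr κ x univ k * x k ^ m := by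
  rw [expC_prod κ x t A hA m]
  have h := pf κ x hx univ (PowerSeries ℂ) (fun k => geo (x k)) (fun k _ l _ _ => geo_rel _ _)
  rw [← Finset.prod_congr rfl (fun k _ => ff_eq (κ k) (x k) (hκ k)), Finset.prod_mul_distrib,
    ← map_prod] at h
  have h2 := congrArg (PowerSeries.coeff m) h
  rw [PowerSeries.coeff_C_mul] at h2
  rw [h2, map_add, map_sum]
  congr 1
  · rw [show algebraMap ℂ (PowerSeries ℂ) (∏ k, (κ k)⁻¹) =
      PowerSeries.C (∏ k, (κ k)⁻¹) from rfl, PowerSeries.coeff_C]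
  · apply Finset.sum_congr rfl
    intro k _
    simp [geo]

lemma rr_inv {n : ℕ} (κ x : Fin n → ℂ) (hx : ∀ k l, k ≠ l → x k - x l ≠ 0)
    (hx0 : ∀ k, x k ≠ 0) (k : Fin n) :
    rr (fun k => (κ k)⁻¹) (fun k => (x k)⁻¹) univ k = - rr κ x univ k := by
  unfold rr
  rw [← neg_mul]
  congr 1
  · rw [inv_inv]; ring
  apply Finset.prod_congr rfl
  intro l hl
  have hkl : l ≠ k := by simpa using hl
  have d1 := hx k l hkl.symm
  have d2 := hx l k hkl
  have e1 := hx0 k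
  have e2 := hx0 l
  rw [inv_inv]
  have d3 : (x k)⁻¹ - (x l)⁻¹ ≠ 0 := by
    rw [show (x k)⁻¹ - (x l)⁻¹ = (x l - x k) * ((x k)⁻¹ * (x l)⁻¹) by field_simp]
    exact mul_ne_zero d2 (mul_ne_zero (inv_ne_zero e1) (inv_ne_zero e2))
  rw [div_eq_div_iff d3 d1]
  field_simp
  ring

end QAS

namespace QAS
open Finset Function

/-- symmetrised Serre expression -/
def serS {A : Type} [Ring A] [Algebra ℂ A] (w : ℂ) (a b j : A) : A :=
  (a * b + b * a) * j - w • (a * j * b + b * j * a) + j * (a * b + b * a)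

lemma serS_span {A : Type} [Ring A] [Algebra ℂ A] (w : ℂ) (S S' : Set A)
    (h : ∀ a ∈ S, ∀ b ∈ S, ∀ j ∈ S', serS w a b j = 0) (a b j : A)
    (ha : a ∈ Submodule.span ℂ S) (hb : b ∈ Submodule.span ℂ S) (hj : j ∈ Submodule.span ℂ S') :
    serS w a b j = 0 := by
  have s1 : ∀ a ∈ S, ∀ b ∈ S, serS w a b j = 0 := by
    intro a ha b hb
    induction hj using Submodule.span_induction with
    | mem x hx => exact h a ha b hb x hx
    | zero => simp [serS]
    | add x y _ _ hx hy =>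
      have : serS w a b (x + y) = serS w a b x + serS w a b y := by
        simp only [serS, add_mul, mul_add, smul_add]; abel
      rw [this, hx, hy, add_zero]
    | smul r x _ hx =>
      have : serS w a b (r • x) = r • serS w a b x := by
        simp only [serS, smul_mul_assoc, mul_smul_comm, smul_add, smul_sub, smul_comm w r]
      rw [this, hx, smul_zero]
  have s2 : ∀ a ∈ S, serS w a b j = 0 := by
    intro a ha
    clear h
    induction hb using Submodule.span_induction with
    | mem x hx => exact s1 a ha x hx
    | zero => simp [serS]
    | add x y _ _ hx hy =>
      have : serS w a (x + y) j = serS w a x j + serS w a y j := by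
        simp only [serS, add_mul, mul_add, smul_add]; abel
      rw [this, hx, hy, add_zero]
    | smul r x _ hx =>
      have : serS w a (r • x) j = r • serS w a x j := by
        simp only [serS, smul_mul_assoc, mul_smul_comm, smul_add, smul_sub, smul_comm w r, add_mul,
          mul_add]
      rw [this, hx, smul_zero]
  clear h s1
  induction ha using Submodule.span_induction with
  | mem x hx => exact s2 x hx
  | zero => simp [serS]
  | add x y _ _ hx hy =>
    have : serS w (x + y) b j = serS w x b j + serS w y b j := by
      simp only [serS, add_mul, mul_add, smul_add]; abel
    rw [this, hx, hy, add_zero]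
  | smul r x _ hx =>
    have : serS w (r • x) b j = r • serS w x b j := by
      simp only [serS, smul_mul_assoc, mul_smul_comm, smul_add, smul_sub, smul_comm w r, add_mul,
        mul_add]
    rw [this, hx, smul_zero]

lemma oscS_span {A : Type} [Ring A] [Algebra ℂ A] (w : ℂ) (S1 S2 S3 : Set A)
    (h : ∀ a ∈ S1, ∀ b ∈ S2, ∀ b' ∈ S2, ∀ c ∈ S3, oscS w a b b' c = 0) (a b b' c : A)
    (ha : a ∈ Submodule.span ℂ S1) (hb : b ∈ Submodule.span ℂ S2)
    (hb' : b' ∈ Submodule.span ℂ S2) (hc : c ∈ Submodule.span ℂ S3) :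
    oscS w a b b' c = 0 := by
  have s1 : ∀ a ∈ S1, ∀ b ∈ S2, ∀ b' ∈ S2, oscS w a b b' c = 0 := by
    intro a ha b hb b' hb'
    induction hc using Submodule.span_induction with
    | mem x hx => exact h a ha b hb b' hb' x hx
    | zero => simp [oscS]
    | add x y _ _ hx hy =>
      have : oscS w a b b' (x + y) = oscS w a b b' x + oscS w a b b' y := by
        simp only [oscS, add_mul, mul_add, smul_add]; abel
      rw [this, hx, hy, add_zero]
    | smul r x _ hx =>
      have : oscS w a b b' (r • x) = r • oscS w a b b' x := by
        simp only [oscS, smul_mul_assoc, mul_smul_comm, smul_add, smul_sub, smul_comm w r]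
      rw [this, hx, smul_zero]
  have s2 : ∀ a ∈ S1, ∀ b ∈ S2, oscS w a b b' c = 0 := by
    intro a ha b hb
    clear h
    induction hb' using Submodule.span_induction with
    | mem x hx => exact s1 a ha b hb x hx
    | zero => simp [oscS]
    | add x y _ _ hx hy =>
      have : oscS w a b (x + y) c = oscS w a b x c + oscS w a b y c := by
        simp only [oscS, add_mul, mul_add, smul_add]; abel
      rw [this, hx, hy, add_zero]
    | smul r x _ hx =>
      have : oscS w a b (r • x) c = r • oscS w a b x c := by
        simp only [oscS, smul_mul_assoc, mul_smul_comm, smul_add, smul_sub, smul_comm w r]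
      rw [this, hx, smul_zero]
  have s3 : ∀ a ∈ S1, oscS w a b b' c = 0 := by
    intro a ha
    clear h s1
    induction hb using Submodule.span_induction with
    | mem x hx => exact s2 a ha x hx
    | zero => simp [oscS]
    | add x y _ _ hx hy =>
      have : oscS w a (x + y) b' c = oscS w a x b' c + oscS w a y b' c := by
        simp only [oscS, add_mul, mul_add, smul_add]; abel
      rw [this, hx, hy, add_zero]
    | smul r x _ hx =>
      have : oscS w a (r • x) b' c = r • oscS w a x b' c := by
        simp only [oscS, smul_mul_assoc, mul_smul_comm, smul_add, smul_sub, smul_comm w r]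
      rw [this, hx, smul_zero]
  clear h s1 s2
  induction ha using Submodule.span_induction with
  | mem x hx => exact s3 x hx
  | zero => simp [oscS]
  | add x y _ _ hx hy =>
    have : oscS w (x + y) b b' c = oscS w x b b' c + oscS w y b b' c := by
      simp only [oscS, add_mul, mul_add, smul_add]; abel
    rw [this, hx, hy, add_zero]
  | smul r x _ hx =>
    have : oscS w (r • x) b b' c = r • oscS w x b b' c := by
      simp only [oscS, smul_mul_assoc, mul_smul_comm, smul_add, smul_sub, smul_comm w r]
    rw [this, hx, smul_zero]

lemma bil {A : Type} [Ring A] [Algebra ℂ A] {n : ℕ} (x y : Fin n → ℂ) (P Q : Fin n → A) (s : ℂ) :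
    (∑ k, x k • P k) * (∑ l, y l • Q l) - s • ((∑ l, y l • Q l) * (∑ k, x k • P k)) =
      ∑ k, ∑ l, (x k * y l) • (P k * Q l - s • (Q l * P k)) := by
  rw [Finset.sum_mul_sum, Finset.sum_mul_sum, Finset.sum_comm (s := univ (α := Fin n))
    (f := fun i j => y i • Q i * x j • P j), Finset.smul_sum, ← Finset.sum_sub_distrib]
  apply Finset.sum_congr rfl
  intro k _
  rw [Finset.smul_sum, ← Finset.sum_sub_distrib]
  apply Finset.sum_congr rfl
  intro l _
  rw [smul_mul_smul_comm, smul_mul_smul_comm]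
  module

lemma serre_br {A : Type} [Ring A] [Algebra ℂ A] (q : ℂ) (hq : q ≠ 0) (a b j : A) :
    brF q a (brF q⁻¹ b j) + brF q b (brF q⁻¹ a j) = serS (q + q⁻¹) a b j := by
  have h : q * q⁻¹ = 1 := mul_inv_cancel₀ hq
  simp only [brF, serS, mul_sub, sub_mul, mul_smul_comm, smul_mul_assoc, smul_sub, smul_smul, h,
    one_smul, add_mul, mul_add, smul_add, add_smul, mul_assoc]
  abel

lemma osc_br {A : Type} [Ring A] [Algebra ℂ A] (q : ℂ) (hq : q ≠ 0) (M : ℕ) (X : ℕ → ℤ → A)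
    (m n k u : ℤ) (h1 : X (M + 1) k * X (M - 1) m = X (M - 1) m * X (M + 1) k)
    (h2 : X M u * X M n = - (X M n * X M u)) :
    oscOf q M X m n k u + oscOf q M X m u k n =
      oscS (q + q⁻¹) (X (M - 1) m) (X M n) (X M u) (X (M + 1) k) := by
  have h : q * q⁻¹ = 1 := mul_inv_cancel₀ hq
  unfold oscOf
  generalize X (M + 1) k = c at *
  generalize X (M - 1) m = a at *
  generalize X M u = b' at *
  generalize X M n = b at *
  have f1 : ∀ r, c * (a * r) = a * (c * r) := fun r => by rw [← mul_assoc, h1, mul_assoc]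
  have f2 : ∀ r, b' * (b * r) = - (b * (b' * r)) := fun r => by
    rw [← mul_assoc, h2, neg_mul, mul_assoc]
  simp only [brF, oscS, mul_sub, sub_mul, mul_smul_comm, smul_mul_assoc, smul_sub, smul_smul, h,
    one_smul, add_mul, mul_add, smul_add, add_smul, mul_assoc]
  simp only [h1, f1, f2, h2, mul_neg, smul_neg, mul_smul_comm]
  abel

variable {n : ℕ} (q : ℂ) (M : ℕ) (a : Fin n → ℂ)

def Xpo (i : ℕ) (m : ℤ) : Module.End ℂ ((Fin n → ℕ) → ℂ) := ∑ k, xx q M a i k ^ m • EE q M a i k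
def Xmo (i : ℕ) (m : ℤ) : Module.End ℂ ((Fin n → ℕ) → ℂ) := ∑ k, xx q M a i k ^ m • GG q M a i k

lemma Xpo_mem (i : ℕ) (m : ℤ) : Xpo q M a i m ∈ Submodule.span ℂ (Set.range (EE q M a i)) :=
  Submodule.sum_mem _ fun k _ => Submodule.smul_mem _ _ (Submodule.subset_span ⟨k, rfl⟩)
lemma Xmo_mem (i : ℕ) (m : ℤ) : Xmo q M a i m ∈ Submodule.span ℂ (Set.range (GG q M a i)) :=
  Submodule.sum_mem _ fun k _ => Submodule.smul_mem _ _ (Submodule.subset_span ⟨k, rfl⟩)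

variable {q M a}

lemma ngE (x : Module.End ℂ ((Fin n → ℕ) → ℂ)) : (-1 : ℂ) • x = -x := by
  ext f c; simp

lemma Xp_comm0 (h : Gn q a) (i j : ℕ) (m r : ℤ) (hc : cc M i j = 0) :
    Xpo q M a i m * Xpo q M a j r - sgn M i j • (Xpo q M a j r * Xpo q M a i m) = 0 := by
  refine (bil (fun k => xx q M a i k ^ m) (fun k => xx q M a j k ^ r) (EE q M a i) (EE q M a j)
    (sgn M i j)).trans ?_
  apply Finset.sum_eq_zero; intro k _
  apply Finset.sum_eq_zero; intro l _
  rw [E0 h i j k l hc, sub_self, smul_zero]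

lemma Xm_comm0 (h : Gn q a) (i j : ℕ) (m r : ℤ) (hc : cc M i j = 0) :
    Xmo q M a i m * Xmo q M a j r - sgn M i j • (Xmo q M a j r * Xmo q M a i m) = 0 := by
  refine (bil (fun k => xx q M a i k ^ m) (fun k => xx q M a j k ^ r) (GG q M a i) (GG q M a j)
    (sgn M i j)).trans ?_
  apply Finset.sum_eq_zero; intro k _
  apply Finset.sum_eq_zero; intro l _
  rw [G0 h i j k l hc, sub_self, smul_zero]

lemma sgn_one (i j : ℕ) (hc : cc M i j ≠ 0) : sgn M i j = 1 := by
  unfold sgn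
  rw [if_neg]
  rintro ⟨rfl, rfl⟩
  apply hc
  rw [cc_self]
  simp [lof]

lemma quad {A : Type} [Ring A] [Algebra ℂ A] {n : ℕ} (x y : Fin n → ℂ) (P Q : Fin n → A) (t : ℂ)
    (hx : ∀ k, x k ≠ 0) (hy : ∀ k, y k ≠ 0) (m r : ℤ)
    (h : ∀ k l, (x k - t * y l) • (P k * Q l) = (t * x k - y l) • (Q l * P k)) :
    (∑ k, x k ^ (m + 1) • P k) * (∑ l, y l ^ r • Q l) -
      t • ((∑ l, y l ^ r • Q l) * (∑ k, x k ^ (m + 1) • P k)) =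
    t • ((∑ k, x k ^ m • P k) * (∑ l, y l ^ (r + 1) • Q l)) -
      (∑ l, y l ^ (r + 1) • Q l) * (∑ k, x k ^ m • P k) := by
  rw [bil, ← neg_sub (_ * _) (t • _), bil, Finset.sum_comm (s := univ (α := Fin n))
    (f := fun k l => (y k ^ (r + 1) * x l ^ m) • (Q k * P l - t • (P l * Q k))),
    ← Finset.sum_neg_distrib]
  apply Finset.sum_congr rfl; intro k _
  rw [← Finset.sum_neg_distrib]
  apply Finset.sum_congr rfl; intro l _
  rw [zpow_add_one₀ (hx k), zpow_add_one₀ (hy l)]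
  have := h k l
  have e := congrArg (fun z => (x k ^ m * y l ^ r) • z) this
  rw [← sub_eq_zero] at e ⊢
  rw [← e]
  module

lemma Xp_quad (h : Gn q a) (i j : ℕ) (m r : ℤ) (hc : cc M i j ≠ 0) :
    Xpo q M a i (m + 1) * Xpo q M a j r -
      q ^ cc M i j • (Xpo q M a j r * Xpo q M a i (m + 1)) =
    q ^ cc M i j • (Xpo q M a i m * Xpo q M a j (r + 1)) -
      Xpo q M a j (r + 1) * Xpo q M a i m := by
  unfold Xpo
  apply quad _ _ _ _ _ (xx_ne_zero h i) (xx_ne_zero h j)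
  intro k l
  have := EQ (M := M) h i j k l
  rwa [sgn_one i j hc, one_mul] at this

lemma Xm_quad (h : Gn q a) (i j : ℕ) (m r : ℤ) (hc : cc M i j ≠ 0) :
    Xmo q M a i (m + 1) * Xmo q M a j r -
      q ^ (-cc M i j) • (Xmo q M a j r * Xmo q M a i (m + 1)) =
    q ^ (-cc M i j) • (Xmo q M a i m * Xmo q M a j (r + 1)) -
      Xmo q M a j (r + 1) * Xmo q M a i m := by
  unfold Xmo
  apply quad _ _ _ _ _ (xx_ne_zero h i) (xx_ne_zero h j)
  intro k l
  have := GQ (M := M) h i j k l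
  rwa [sgn_one i j hc, one_mul] at this

lemma cc_one (i j : ℕ) (hc : cc M i j = 1 ∨ cc M i j = -1) (hi : i ≠ M) :
    cc M i i = -2 * cc M i j ∧ sgn M i i = 1 ∧ sgn M i j = 1 ∧
      ((j = i + 1 ∧ ee M i - ee M j = cc M i j) ∨ (i = j + 1 ∧ ee M i - ee M j = - cc M i j)) := by
  have h1 := lof_succ M i hi
  have hs : sgn M i j = 1 := by unfold sgn; simp [hi]
  have hs' : sgn M i i = 1 := by unfold sgn; simp [hi]
  have hij : i ≠ j := by
    rintro rfl
    rw [cc_self] at hc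
    rcases lof_cases M i with h | h <;> omega
  rcases (show j = i + 1 ∨ i = j + 1 by
    by_contra hcon
    push Not at hcon
    rw [cc_far M i j hij hcon.2 (Ne.symm hcon.1)] at hc
    omega) with rfl | rfl
  · refine ⟨?_, hs', hs, Or.inl ⟨rfl, ?_⟩⟩
    · rw [cc_self, cc_succ]; omega
    · rw [cc_succ, ee]; omega
  · refine ⟨?_, hs', hs, Or.inr ⟨rfl, ?_⟩⟩
    · rw [cc_self, cc_symm M (j + 1) j, cc_succ]; omega
    · rw [cc_symm, cc_succ, ee]; omega

lemma w_eq {c : ℤ} (hc : c = 1 ∨ c = -1) : q ^ c + (q ^ c)⁻¹ = q + q⁻¹ := by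
  rcases hc with rfl | rfl
  · simp
  · simp [add_comm]

/-- common part of the Serre relations -/
lemma serre_gen (h : Gn q a) (i j : ℕ) (c : ℤ) (hc : c = 1 ∨ c = -1)
    (P Q : Fin n → Module.End ℂ ((Fin n → ℕ) → ℂ))
    (h1 : ∀ k l, (xx q M a i k - q ^ (-2 * c) * xx q M a i l) • (P k * P l) =
      (q ^ (-2 * c) * xx q M a i k - xx q M a i l) • (P l * P k))
    (h2 : ∀ k l, (xx q M a i k - q ^ c * xx q M a j l) • (P k * Q l) =
      (q ^ c * xx q M a i k - xx q M a j l) • (Q l * P k))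
    (he : ee M i - ee M j = c ∨ ee M i - ee M j = - c)
    (A B J : Module.End ℂ ((Fin n → ℕ) → ℂ)) (hA : A ∈ Submodule.span ℂ (Set.range P))
    (hB : B ∈ Submodule.span ℂ (Set.range P)) (hJ : J ∈ Submodule.span ℂ (Set.range Q)) :
    brF q A (brF q⁻¹ B J) + brF q B (brF q⁻¹ A J) = 0 := by
  have hq := h.q0
  rw [serre_br q hq]
  have ht : q ^ c ≠ 0 := zpow_ne_zero _ hq
  have hp : q ^ (-2 * c) = ((q ^ c) ^ 2)⁻¹ := by
    rw [← zpow_natCast, ← zpow_mul, ← zpow_neg]; congr 1; push_cast; ring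
  have hp2 : (q ^ c) ^ 2 = q ^ (2 * c) := by
    rw [← zpow_natCast, ← zpow_mul]; congr 1; push_cast; ring
  apply serS_span _ _ _ _ A B J hA hB hJ
  rintro _ ⟨k, rfl⟩ _ ⟨l, rfl⟩ _ ⟨p, rfl⟩
  unfold serS
  rw [← w_eq hc]
  rw [hp] at h1
  have x1 : ∀ k l, (q ^ c) ^ 2 * xx q M a i k - xx q M a i l ≠ 0 := by
    intro k l
    rw [hp2]
    exact sub_ne_zero.mpr (xx_ne h (2 * c) i i k l (Or.inr (by omega)))
  rcases he with he | he
  · have x2 : ∀ k p, q ^ c * xx q M a i k - xx q M a j p ≠ 0 := fun k p =>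
      sub_ne_zero.mpr (xx_ne h c i j k p (Or.inr (by omega)))
    apply serreA _ _ _ (q ^ c) (xx q M a i k) (xx q M a i l) (xx q M a j p) ht _ (x2 _ _) (x2 _ _)
      (h1 k l) (h2 k p) (h2 l p)
    intro hz
    exact x1 l k (by linear_combination -hz)
  · have x2 : ∀ k p, xx q M a i k - q ^ c * xx q M a j p ≠ 0 := by
      intro k p hz
      exact xx_ne (M := M) h c j i p k (Or.inr (by omega)) (by linear_combination -hz)
    exact serreB _ _ _ (q ^ c) (xx q M a i k) (xx q M a i l) (xx q M a j p) ht (x1 _ _) (x2 _ _)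
      (x2 _ _) (h1 k l) (h2 k p) (h2 l p)

lemma Xp_serre (h : Gn q a) (i j : ℕ) (m r s : ℤ) (hc : cc M i j = 1 ∨ cc M i j = -1)
    (hi : i ≠ M) :
    brF q (Xpo q M a i m) (brF q⁻¹ (Xpo q M a i r) (Xpo q M a j s)) +
      brF q (Xpo q M a i r) (brF q⁻¹ (Xpo q M a i m) (Xpo q M a j s)) = 0 := by
  obtain ⟨c1, s1, s2, he⟩ := cc_one (M := M) i j hc hi
  refine serre_gen (M := M) h i j (cc M i j) hc (EE q M a i) (EE q M a j) ?_ ?_ ?_ _ _ _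
    (Xpo_mem q M a i m) (Xpo_mem q M a i r) (Xpo_mem q M a j s)
  · intro k l
    have := EQ (M := M) h i i k l
    rwa [s1, one_mul, c1] at this
  · intro k l
    have := EQ (M := M) h i j k l
    rwa [s2, one_mul] at this
  · omega

lemma Xm_serre (h : Gn q a) (i j : ℕ) (m r s : ℤ) (hc : cc M i j = 1 ∨ cc M i j = -1)
    (hi : i ≠ M) :
    brF q (Xmo q M a i m) (brF q⁻¹ (Xmo q M a i r) (Xmo q M a j s)) +
      brF q (Xmo q M a i r) (brF q⁻¹ (Xmo q M a i m) (Xmo q M a j s)) = 0 := by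
  obtain ⟨c1, s1, s2, he⟩ := cc_one (M := M) i j hc hi
  refine serre_gen (M := M) h i j (-cc M i j) (by omega) (GG q M a i) (GG q M a j) ?_ ?_ ?_ _ _ _
    (Xmo_mem q M a i m) (Xmo_mem q M a i r) (Xmo_mem q M a j s)
  · intro k l
    have := GQ (M := M) h i i k l
    rwa [s1, one_mul, c1, neg_mul_eq_mul_neg] at this
  · intro k l
    have := GQ (M := M) h i j k l
    rwa [s2, one_mul] at this
  · omega

lemma sol1 {A : Type} [Ring A] [Algebra ℂ A] (α β : ℂ) (P Q : A) (hβ : β ≠ 0)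
    (hh : α • P = β • Q) : Q = (α / β) • P := by
  rw [div_eq_inv_mul, mul_smul, hh, smul_smul, inv_mul_cancel₀ hβ, one_smul]

lemma osc_data (hM : 1 < M) : cc M (M - 1) M = -1 ∧ cc M M (M + 1) = 1 ∧ cc M (M - 1) (M + 1) = 0 ∧
    cc M M M = 0 ∧ sgn M (M - 1) M = 1 ∧ sgn M M (M + 1) = 1 ∧ sgn M (M - 1) (M + 1) = 1 ∧
    sgn M M M = -1 ∧ ee M M = ee M (M - 1) + 1 ∧ ee M (M + 1) = ee M M - 1 := by
  obtain ⟨L, rfl⟩ : ∃ L, M = L + 1 := ⟨M - 1, by omega⟩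
  have l1 : lof (L + 1) (L + 1) = 1 := by simp [lof]
  have l2 : lof (L + 1) (L + 1 + 1) = -1 := by simp [lof]
  rw [Nat.add_sub_cancel]
  refine ⟨?_, ?_, ?_, ?_, ?_, ?_, ?_, ?_, ?_, ?_⟩
  · rw [cc_succ, l1]
  · rw [cc_succ, l2]; rfl
  · exact cc_far _ _ _ (by omega) (by omega) (by omega)
  · rw [cc_self, l1, l2]; rfl
  · simp [sgn]
  · simp [sgn]
  · simp [sgn]
  · simp [sgn]
  · rw [ee, l1]
  · rw [ee, l2]; rfl

lemma Xp_osc (h : Gn q a) (hM : 1 < M) (m r s u : ℤ) :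
    oscOf q M (Xpo q M a) m r s u + oscOf q M (Xpo q M a) m u s r = 0 := by
  obtain ⟨c1, c2, c3, c4, s1, s2, s3, s4, e1, e2⟩ := osc_data hM
  have hq := h.q0
  rw [osc_br q hq]
  · refine oscS_span _ (Set.range (EE q M a (M - 1))) (Set.range (EE q M a M))
      (Set.range (EE q M a (M + 1))) ?_ _ _ _ _ (Xpo_mem q M a _ _) (Xpo_mem q M a _ _)
      (Xpo_mem q M a _ _) (Xpo_mem q M a _ _)
    rintro _ ⟨k, rfl⟩ _ ⟨l, rfl⟩ _ ⟨l', rfl⟩ _ ⟨p, rfl⟩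
    have d1 : ∀ l, q⁻¹ * xx q M a (M - 1) k - xx q M a M l ≠ 0 := fun l => by
      rw [← zpow_neg_one]
      exact sub_ne_zero.mpr (xx_ne h (-1) (M - 1) M k l (Or.inr (by omega)))
    have d2 : ∀ l, q * xx q M a M l - xx q M a (M + 1) p ≠ 0 := fun l => by
      have := sub_ne_zero.mpr (xx_ne (M := M) h 1 M (M + 1) l p (Or.inr (by omega)))
      rwa [zpow_one] at this
    have r1 : ∀ l, _ := fun l => EQ (M := M) h (M - 1) M k l
    have r2 : ∀ l, _ := fun l => EQ (M := M) h M (M + 1) l p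
    simp only [c1, s1, one_mul, zpow_neg_one] at r1
    simp only [c2, s2, one_mul, zpow_one] at r2
    have r3 := E0 (M := M) h (M - 1) (M + 1) k p c3
    have r4 := E0 (M := M) h M M l' l c4
    rw [s3, one_smul] at r3
    rw [s4, ngE] at r4
    exact osc_core _ _ _ _ _ _ _ _ _ (sol1 _ _ _ _ (d1 l) (r1 l)) (sol1 _ _ _ _ (d1 l') (r1 l'))
      (sol1 _ _ _ _ (d2 l) (r2 l)) (sol1 _ _ _ _ (d2 l') (r2 l')) r3.symm r4
      (osc_scalar q _ _ _ _ hq (d1 l) (d1 l') (d2 l) (d2 l') _ _ _ _ rfl rfl rfl rfl)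
  · have := Xp_comm0 (M := M) h (M - 1) (M + 1) m s c3
    rw [s3, one_smul, sub_eq_zero] at this
    exact this.symm
  · have := Xp_comm0 (M := M) h M M u r c4
    rw [s4, ngE, sub_eq_zero] at this
    exact this

lemma Xm_osc (h : Gn q a) (hM : 1 < M) (m r s u : ℤ) :
    oscOf q M (Xmo q M a) m r s u + oscOf q M (Xmo q M a) m u s r = 0 := by
  obtain ⟨c1, c2, c3, c4, s1, s2, s3, s4, e1, e2⟩ := osc_data hM
  have hq := h.q0
  rw [osc_br q hq]
  · refine oscS_span _ (Set.range (GG q M a (M - 1))) (Set.range (GG q M a M))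
      (Set.range (GG q M a (M + 1))) ?_ _ _ _ _ (Xmo_mem q M a _ _) (Xmo_mem q M a _ _)
      (Xmo_mem q M a _ _) (Xmo_mem q M a _ _)
    rintro _ ⟨k, rfl⟩ _ ⟨l, rfl⟩ _ ⟨l', rfl⟩ _ ⟨p, rfl⟩
    have d1' : ∀ l, xx q M a (M - 1) k - q * xx q M a M l ≠ 0 := fun l hz => by
      have := xx_ne (M := M) h 1 M (M - 1) l k (Or.inr (by omega))
      rw [zpow_one] at this
      exact this (by linear_combination -hz)
    have d2' : ∀ l, xx q M a M l - q⁻¹ * xx q M a (M + 1) p ≠ 0 := fun l hz => by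
      have := xx_ne (M := M) h (-1) (M + 1) M p l (Or.inr (by omega))
      rw [zpow_neg_one] at this
      exact this (by linear_combination -hz)
    have d1 : ∀ l, q⁻¹ * xx q M a (M - 1) k - xx q M a M l ≠ 0 := fun l => by
      rw [show q⁻¹ * xx q M a (M - 1) k - xx q M a M l =
        q⁻¹ * (xx q M a (M - 1) k - q * xx q M a M l) by field_simp]
      exact mul_ne_zero (inv_ne_zero hq) (d1' l)
    have d2 : ∀ l, q * xx q M a M l - xx q M a (M + 1) p ≠ 0 := fun l => by
      rw [show q * xx q M a M l - xx q M a (M + 1) p =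
        q * (xx q M a M l - q⁻¹ * xx q M a (M + 1) p) by field_simp]
      exact mul_ne_zero hq (d2' l)
    have r1 : ∀ l, _ := fun l => GQ (M := M) h (M - 1) M k l
    have r2 : ∀ l, _ := fun l => GQ (M := M) h M (M + 1) l p
    simp only [c1, s1, one_mul, neg_neg, zpow_one] at r1
    simp only [c2, s2, one_mul, zpow_neg_one] at r2
    have r3 := G0 (M := M) h (M - 1) (M + 1) k p c3
    have r4 := G0 (M := M) h M M l l' c4
    rw [s3, one_smul] at r3
    rw [s4, ngE] at r4
    have t1 : ∀ l, (q * xx q M a (M - 1) k - xx q M a M l) /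
      (xx q M a (M - 1) k - q * xx q M a M l) = (xx q M a (M - 1) k - q⁻¹ * xx q M a M l) /
      (q⁻¹ * xx q M a (M - 1) k - xx q M a M l) := fun l => by
      rw [div_eq_div_iff (d1' l) (d1 l)]
      field_simp
    have t2 : ∀ l, (q⁻¹ * xx q M a M l - xx q M a (M + 1) p) /
      (xx q M a M l - q⁻¹ * xx q M a (M + 1) p) = (xx q M a M l - q * xx q M a (M + 1) p) /
      (q * xx q M a M l - xx q M a (M + 1) p) := fun l => by
      rw [div_eq_div_iff (d2' l) (d2 l)]
      field_simp
    exact osc_core' _ _ _ _ _ _ _ _ _ (sol1 _ _ _ _ (d1' l) (r1 l).symm)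
      (sol1 _ _ _ _ (d1' l') (r1 l').symm)
      (sol1 _ _ _ _ (d2' l) (r2 l).symm) (sol1 _ _ _ _ (d2' l') (r2 l').symm) r3 r4
      (osc_scalar q _ _ _ _ hq (d1 l) (d1 l') (d2 l) (d2 l') _ _ _ _ (t1 l) (t1 l') (t2 l) (t2 l'))
  · have := Xm_comm0 (M := M) h (M - 1) (M + 1) m s c3
    rw [s3, one_smul, sub_eq_zero] at this
    exact this.symm
  · have := Xm_comm0 (M := M) h M M u r c4
    rw [s4, ngE, sub_eq_zero] at this
    exact this

end QAS

namespace QAS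
open Finset Function

variable {n : ℕ}

/-- diagonal operators -/
def dg (n : ℕ) : ((Fin n → ℕ) → ℂ) →ₐ[ℂ] Module.End ℂ ((Fin n → ℕ) → ℂ) :=
  Algebra.lmul ℂ ((Fin n → ℕ) → ℂ)

lemma dg_apply (f g : (Fin n → ℕ) → ℂ) (c : Fin n → ℕ) : dg n f g c = f c * g c := rfl

lemma dgT_mul (k : Fin n) (i j : ℕ) (d : Fin n → ℕ → ℂ) (f : (Fin n → ℕ) → ℂ) (r : ℂ)
    (hf : ∀ c : Fin n → ℕ, c k = i → f c = r * f (update c k j)) :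
    dg n f * T k i j d = r • (T k i j d * dg n f) := by
  apply LinearMap.ext; intro g; funext c
  rw [LinearMap.smul_apply, Pi.smul_apply, Module.End.mul_apply, Module.End.mul_apply, dg_apply,
    T_apply, T_apply, dg_apply, smul_eq_mul]
  split
  · next h => rw [hf c h]; ring
  · ring

lemma dgT_comm (k : Fin n) (i j : ℕ) (d : Fin n → ℕ → ℂ) (f : (Fin n → ℕ) → ℂ) (r : ℂ)
    (hf : ∀ c : Fin n → ℕ, c k = i → f c - f (update c k j) = r) :
    dg n f * T k i j d - T k i j d * dg n f = r • T k i j d := by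
  apply LinearMap.ext; intro g; funext c
  rw [LinearMap.smul_apply, Pi.smul_apply, LinearMap.sub_apply, Pi.sub_apply, Module.End.mul_apply,
    Module.End.mul_apply, dg_apply,
    T_apply, T_apply, dg_apply, smul_eq_mul]
  split
  · next h => rw [← hf c h]; ring
  · ring

lemma prodU (g : ℕ → ℂ) (c : Fin n → ℕ) (k : Fin n) (j : ℕ) :
    (∏ l, g (c l)) * g j = g (c k) * ∏ l, g (update c k j l) := by
  rw [← Finset.mul_prod_erase univ (fun l => g (c l)) (Finset.mem_univ k),
    ← Finset.mul_prod_erase univ (fun l => g (update c k j l)) (Finset.mem_univ k), update_self,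
    Finset.prod_congr rfl (g := fun l => g (c l)) (s₁ := univ.erase k)
      (f := fun l => g (update c k j l)) (fun l hl => by
      rw [update_of_ne (by simpa using hl)])]
  ring

lemma sumU (g : Fin n → ℕ → ℂ) (c : Fin n → ℕ) (k : Fin n) (j : ℕ) :
    (∑ l, g l (c l)) - ∑ l, g l (update c k j l) = g k (c k) - g k j := by
  rw [← Finset.add_sum_erase univ (fun l => g l (c l)) (Finset.mem_univ k),
    ← Finset.add_sum_erase univ (fun l => g l (update c k j l)) (Finset.mem_univ k), update_self,
    Finset.sum_congr rfl (g := fun l => g l (c l)) (s₁ := univ.erase k)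
      (f := fun l => g l (update c k j l)) (fun l hl => by
      rw [update_of_ne (by simpa using hl)])]
  ring

def Kf (q : ℂ) (M i : ℕ) (c : Fin n → ℕ) : ℂ := ∏ k, kap q M i (c k)
def Kif (q : ℂ) (M i : ℕ) (c : Fin n → ℕ) : ℂ := ∏ k, (kap q M i (c k))⁻¹
def eta (q : ℂ) (M i : ℕ) (s : ℤ) (c : ℕ) : ℂ :=
  (1 - q ^ (-2 * s * kk M i c)) / (s * (qpar q M i - (qpar q M i)⁻¹))
def Hf (q : ℂ) (M : ℕ) (a : Fin n → ℂ) (i : ℕ) (s : ℤ) (c : Fin n → ℕ) : ℂ :=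
  ∑ k, eta q M i s (c k) * xx q M a i k ^ s

variable {q : ℂ} {M : ℕ} {a : Fin n → ℂ}

lemma KE (hq : q ≠ 0) (i j : ℕ) (k : Fin n) :
    dg n (Kf q M i) * EE q M a j k = q ^ cc M i j • (EE q M a j k * dg n (Kf q M i)) := by
  apply dgT_mul
  intro c hc
  have h := prodU (kap q M i) c k (j + 1)
  have h0 : kap q M i (j + 1) ≠ 0 := zpow_ne_zero _ hq
  apply mul_right_cancel₀ h0
  unfold Kf
  rw [h, hc, cc_kk, zpow_sub₀ hq]
  unfold kap at *
  field_simp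

lemma KG (hq : q ≠ 0) (i j : ℕ) (k : Fin n) :
    dg n (Kf q M i) * GG q M a j k = q ^ (-cc M i j) • (GG q M a j k * dg n (Kf q M i)) := by
  apply dgT_mul
  intro c hc
  have h := prodU (kap q M i) c k j
  have h0 : kap q M i j ≠ 0 := zpow_ne_zero _ hq
  apply mul_right_cancel₀ h0
  unfold Kf
  rw [h, hc, cc_kk, neg_sub, zpow_sub₀ hq]
  unfold kap at *
  field_simp

lemma eta_diff (h : Gn q a) (i j : ℕ) (s : ℤ) (k : Fin n) :
    (eta q M i s j - eta q M i s (j + 1)) * xx q M a i k ^ s =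
      qint (qpar q M i) (s * lof M i * cc M i j) / (s : ℂ) * xx q M a j k ^ s := by
  have hq := h.q0
  unfold eta qint
  have e1 : ∀ e : ℤ, qpar q M i ^ (s * lof M i * e) = q ^ (s * e) := by
    intro e
    unfold qpar
    rw [← zpow_mul]
    congr 1
    rcases lof_cases M i with h | h <;> rw [h] <;> ring
  rw [e1, show -(s * lof M i * cc M i j) = s * lof M i * (- cc M i j) by ring, e1]
  have e2 : (q ^ (-2 * s * kk M i (j + 1)) - q ^ (-2 * s * kk M i j)) * xx q M a i k ^ s =
    (q ^ (s * cc M i j) - q ^ (s * - cc M i j)) * xx q M a j k ^ s := by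
    unfold xx
    rw [mul_zpow, mul_zpow, ← zpow_mul, ← zpow_mul, ← mul_assoc, ← mul_assoc]
    congr 1
    rw [sub_mul, sub_mul, ← zpow_add₀ hq, ← zpow_add₀ hq, ← zpow_add₀ hq, ← zpow_add₀ hq]
    have hk := cc_kk M i j
    rcases cc_ee M i j with h0 | h0
    · rw [h0] at hk ⊢
      rw [show kk M i (j + 1) = kk M i j by omega]
      simp
    · congr 2
      · rw [hk]; linear_combination s * h0
      · rw [hk]; linear_combination s * h0
  generalize qpar q M i - (qpar q M i)⁻¹ = τ
  linear_combination ((s : ℂ) * τ)⁻¹ * e2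

lemma HE (h : Gn q a) (i j : ℕ) (s : ℤ) (k : Fin n) :
    dg n (Hf q M a i s) * EE q M a j k - EE q M a j k * dg n (Hf q M a i s) =
      (qint (qpar q M i) (s * lof M i * cc M i j) / (s : ℂ) * xx q M a j k ^ s) • EE q M a j k := by
  apply dgT_comm
  intro c hc
  unfold Hf
  rw [sumU (fun k c => eta q M i s c * xx q M a i k ^ s) c k (j + 1), hc, ← sub_mul, eta_diff h]

lemma HG (h : Gn q a) (i j : ℕ) (s : ℤ) (k : Fin n) :
    dg n (Hf q M a i s) * GG q M a j k - GG q M a j k * dg n (Hf q M a i s) =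
      (-(qint (qpar q M i) (s * lof M i * cc M i j) / (s : ℂ) * xx q M a j k ^ s)) •
        GG q M a j k := by
  apply dgT_comm
  intro c hc
  unfold Hf
  rw [sumU (fun k c => eta q M i s c * xx q M a i k ^ s) c k j, hc, ← sub_mul, ← eta_diff h]
  ring

lemma Kop (t : ℂ) {A : Type} [Ring A] [Algebra ℂ A] (x : Fin n → ℂ) (P : Fin n → A) (D : A)
    (h : ∀ k, D * P k = t • (P k * D)) :
    D * (∑ k, x k • P k) = t • ((∑ k, x k • P k) * D) := by
  rw [Finset.mul_sum, Finset.sum_mul, Finset.smul_sum]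
  apply Finset.sum_congr rfl; intro k _
  rw [mul_smul_comm, h, smul_mul_assoc, smul_comm]

lemma Hop {A : Type} [Ring A] [Algebra ℂ A] (x y : Fin n → ℂ) (P : Fin n → A) (D : A)
    (h : ∀ k, D * P k - P k * D = y k • P k) :
    D * (∑ k, x k • P k) - (∑ k, x k • P k) * D = ∑ k, (x k * y k) • P k := by
  rw [Finset.mul_sum, Finset.sum_mul, ← Finset.sum_sub_distrib]
  apply Finset.sum_congr rfl; intro k _
  rw [mul_smul_comm, smul_mul_assoc, ← smul_sub, h, smul_smul]

lemma KXpo (h : Gn q a) (i j : ℕ) (m : ℤ) :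
    dg n (Kf q M i) * Xpo q M a j m = q ^ cc M i j • (Xpo q M a j m * dg n (Kf q M i)) :=
  Kop _ (fun k => xx q M a j k ^ m) (EE q M a j) _ (fun k => KE h.q0 i j k)

lemma KXmo (h : Gn q a) (i j : ℕ) (m : ℤ) :
    dg n (Kf q M i) * Xmo q M a j m = q ^ (-cc M i j) • (Xmo q M a j m * dg n (Kf q M i)) :=
  Kop _ (fun k => xx q M a j k ^ m) (GG q M a j) _ (fun k => KG h.q0 i j k)

lemma HXpo (h : Gn q a) (i j : ℕ) (s m : ℤ) :
    dg n (Hf q M a i s) * Xpo q M a j m - Xpo q M a j m * dg n (Hf q M a i s) =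
      (qint (qpar q M i) (s * lof M i * cc M i j) / (s : ℂ)) • Xpo q M a j (m + s) := by
  refine (Hop (fun k => xx q M a j k ^ m) _ (EE q M a j) _ (fun k => HE h i j s k)).trans ?_
  unfold Xpo
  rw [Finset.smul_sum]
  apply Finset.sum_congr rfl; intro k _
  rw [zpow_add₀ (xx_ne_zero h j k), smul_smul]
  congr 1
  ring

lemma HXmo (h : Gn q a) (i j : ℕ) (s m : ℤ) :
    dg n (Hf q M a i s) * Xmo q M a j m - Xmo q M a j m * dg n (Hf q M a i s) =
      -((qint (qpar q M i) (s * lof M i * cc M i j) / (s : ℂ)) • Xmo q M a j (m + s)) := by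
  refine (Hop (fun k => xx q M a j k ^ m) _ (GG q M a j) _ (fun k => HG h i j s k)).trans ?_
  unfold Xmo
  rw [Finset.smul_sum, ← Finset.sum_neg_distrib]
  apply Finset.sum_congr rfl; intro k _
  rw [zpow_add₀ (xx_ne_zero h j k), smul_smul, ← neg_smul]
  congr 1
  ring

lemma phi_diff (κ x : Fin n → ℂ) (hx : ∀ k l, k ≠ l → x k - x l ≠ 0)
    (hκ : ∀ k, κ k ≠ 0) (hx0 : ∀ k, x k ≠ 0) (τ : ℂ) (H : ℤ → ℂ)
    (hH : ∀ s : ℤ, s ≠ 0 → τ * (s * H s) = ∑ k, (1 - κ k ^ (-2 * s)) * x k ^ s) (p : ℤ) :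
    (if 0 ≤ p then (∏ k, κ k) * expC τ (fun s => H (s : ℤ)) p.toNat else 0) -
    (if p ≤ 0 then (∏ k, (κ k)⁻¹) * expC (-τ) (fun s => H (-(s : ℤ))) (-p).toNat else 0) =
    ∑ k, rr κ x univ k * x k ^ p := by
  have h1 := phi_coeff κ x hx hκ τ (fun s => H (s : ℤ)) (by
    intro s
    have := hH (s + 1) (by omega)
    push_cast at this ⊢
    rw [this]
    apply Finset.sum_congr rfl; intro k _
    rw [show (-2 : ℤ) * (s + 1) = -((2 * (s + 1) : ℕ) : ℤ) by push_cast; ring, zpow_neg,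
      zpow_natCast, inv_pow]
    congr 1)
  have hx' : ∀ k l, k ≠ l → (x k)⁻¹ - (x l)⁻¹ ≠ 0 := by
    intro k l hkl
    have := hx l k (Ne.symm hkl)
    have e1 := hx0 k
    have e2 := hx0 l
    rw [show (x k)⁻¹ - (x l)⁻¹ = (x l - x k) * ((x k)⁻¹ * (x l)⁻¹) by field_simp]
    exact mul_ne_zero this (mul_ne_zero (inv_ne_zero e1) (inv_ne_zero e2))
  have h2 := phi_coeff (fun k => (κ k)⁻¹) (fun k => (x k)⁻¹) hx' (fun k => inv_ne_zero (hκ k)) (-τ)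
    (fun s => H (-(s : ℤ))) (by
    intro s
    have := hH (-(s + 1)) (by omega)
    push_cast at this ⊢
    rw [neg_mul, ← mul_neg, ← neg_mul, this]
    apply Finset.sum_congr rfl; intro k _
    rw [show (-2 : ℤ) * (-(s + 1)) = ((2 * (s + 1) : ℕ) : ℤ) by push_cast; ring,
      zpow_natCast, inv_inv, zpow_neg, inv_pow]
    congr 1)
  simp only [rr_inv κ x hx hx0] at h2
  rcases lt_trichotomy p 0 with hp | hp | hp
  · obtain ⟨m, hm⟩ : ∃ m : ℕ, p = -((m + 1 : ℕ) : ℤ) := ⟨(-p).toNat - 1, by omega⟩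
    rw [if_neg (by omega), if_pos (by omega), hm, neg_neg, Int.toNat_natCast, h2,
      if_neg (by omega), zero_add, zero_sub, ← Finset.sum_neg_distrib]
    apply Finset.sum_congr rfl; intro k _
    rw [zpow_neg, zpow_natCast, inv_pow]; ring
  · subst hp
    have h10 := h1 0
    simp only [if_true] at h10
    simp only [le_refl, if_true, neg_zero, Int.toNat_zero, h10]
    simp [expC]
  · obtain ⟨m, hm⟩ : ∃ m : ℕ, p = ((m + 1 : ℕ) : ℤ) := ⟨p.toNat - 1, by omega⟩
    rw [if_pos (by omega), if_neg (by omega), hm, Int.toNat_natCast, h1,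
      if_neg (by omega), zero_add, sub_zero]
    apply Finset.sum_congr rfl; intro k _
    rw [zpow_natCast]

def PhiP (q : ℂ) (M : ℕ) (a : Fin n → ℂ) (i : ℕ) (p : ℤ) : (Fin n → ℕ) → ℂ :=
  if 0 ≤ p then Kf q M i * expC (qpar q M i - (qpar q M i)⁻¹) (fun s => Hf q M a i (s : ℤ)) p.toNat
  else 0
def PhiM (q : ℂ) (M : ℕ) (a : Fin n → ℂ) (i : ℕ) (p : ℤ) : (Fin n → ℕ) → ℂ :=
  if p ≤ 0 then Kif q M i *
    expC (-(qpar q M i - (qpar q M i)⁻¹)) (fun s => Hf q M a i (-(s : ℤ))) (-p).toNat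
  else 0

lemma tau_ne (h : Gn q a) (i : ℕ) : qpar q M i - (qpar q M i)⁻¹ ≠ 0 := by
  unfold qpar
  rw [← zpow_neg, sub_ne_zero]
  intro H
  have := h.q1 (2 * lof M i) (by rcases lof_cases M i with h | h <;> omega)
  apply this
  rw [show 2 * lof M i = lof M i - (- lof M i) by ring, zpow_sub₀ h.q0, ← H,
    div_self (zpow_ne_zero _ h.q0)]

lemma Phi_eval (h : Gn q a) (i : ℕ) (p : ℤ) (c : Fin n → ℕ) :
    PhiP q M a i p c - PhiM q M a i p c =
      ∑ k, rr (fun k => kap q M i (c k)) (xx q M a i) univ k * xx q M a i k ^ p := by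
  rw [← phi_diff (fun k => kap q M i (c k)) (xx q M a i) _ (fun k => zpow_ne_zero _ h.q0)
    (xx_ne_zero h i) (qpar q M i - (qpar q M i)⁻¹) (fun s => Hf q M a i s c) _ p]
  · unfold PhiP PhiM
    have ev : ∀ t (A : ℕ → (Fin n → ℕ) → ℂ) m, expC t A m c = expC t (fun s => A s c) m :=
      fun t A m => expC_map (Pi.evalAlgHom ℂ (fun _ => ℂ) c) t A m
    congr 1
    · split
      · rw [Pi.mul_apply, ev]; rfl
      · rfl
    · split
      · rw [Pi.mul_apply, ev]; rfl
      · rfl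
  · intro k l hkl
    have := xx_ne (M := M) h 0 i i k l (Or.inl hkl)
    rw [zpow_zero, one_mul] at this
    exact sub_ne_zero.mpr this
  · intro s hs
    unfold Hf
    rw [Finset.mul_sum, Finset.mul_sum]
    apply Finset.sum_congr rfl; intro k _
    have ht := tau_ne (M := M) h i
    have hs' : (s : ℂ) ≠ 0 := by exact_mod_cast hs
    unfold eta kap
    rw [← zpow_mul, mul_comm (kk M i (c k))]
    rw [← mul_assoc, ← mul_assoc]
    congr 1
    generalize qpar q M i - (qpar q M i)⁻¹ = τ at *
    field_simp

lemma psi_eq (h : Gn q a) (i : ℕ) (k k' : Fin n) (c : ℕ) :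
    psi q M a i k k' c = (kap q M i c * xx q M a i k - (kap q M i c)⁻¹ * xx q M a i k') /
      (xx q M a i k - xx q M a i k') := by
  unfold psi xx
  have h0 : q ^ ee M i ≠ 0 := zpow_ne_zero _ h.q0
  rw [← mul_sub, ← mul_div_mul_left _ (a k - a k') h0]
  congr 1
  ring

lemma XpXm_ne (h : Gn q a) (i j : ℕ) (hij : i ≠ j) (m r : ℤ) :
    Xpo q M a i m * Xmo q M a j r - sgn M i j • (Xmo q M a j r * Xpo q M a i m) = 0 := by
  refine (bil (fun k => xx q M a i k ^ m) (fun k => xx q M a j k ^ r) (EE q M a i) (GG q M a j)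
    (sgn M i j)).trans ?_
  apply Finset.sum_eq_zero; intro k _
  apply Finset.sum_eq_zero; intro l _
  rw [EG_ne h i j k l (Or.inr hij), sub_self, smul_zero]

lemma XpXm_same (h : Gn q a) (i : ℕ) (m r : ℤ) :
    Xpo q M a i m * Xmo q M a i r - sgn M i i • (Xmo q M a i r * Xpo q M a i m) =
      (qpar q M i - (qpar q M i)⁻¹)⁻¹ •
        (dg n (PhiP q M a i (m + r)) - dg n (PhiM q M a i (m + r))) := by
  refine (bil (fun k => xx q M a i k ^ m) (fun k => xx q M a i k ^ r) (EE q M a i) (GG q M a i)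
    (sgn M i i)).trans ?_
  have e1 : ∀ k, ∑ l, (xx q M a i k ^ m * xx q M a i l ^ r) •
      (EE q M a i k * GG q M a i l - sgn M i i • (GG q M a i l * EE q M a i k)) =
      (xx q M a i k ^ (m + r)) •
      (EE q M a i k * GG q M a i k - sgn M i i • (GG q M a i k * EE q M a i k)) := by
    intro k
    rw [Finset.sum_eq_single k, zpow_add₀ (xx_ne_zero h i k)]
    · intro l _ hl
      rw [EG_ne h i i k l (Or.inl (Ne.symm hl)), sub_self, smul_zero]
    · simp
  rw [Finset.sum_congr rfl (fun k _ => e1 k)]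
  apply LinearMap.ext; intro f; funext c
  rw [LinearMap.smul_apply, Pi.smul_apply, LinearMap.sub_apply, Pi.sub_apply, dg_apply, dg_apply,
    ← sub_mul, Phi_eval h, LinearMap.sum_apply, Finset.sum_apply, Finset.sum_mul, Finset.smul_sum]
  apply Finset.sum_congr rfl; intro k _
  rw [LinearMap.smul_apply, Pi.smul_apply, EG_same i k (tau_ne (M := M) h i)]
  unfold rr
  simp only [psi_eq h, smul_eq_mul, qpar]
  ring

end QAS

namespace QAS
open Finset Function

variable {n : ℕ}

abbrev EndV (n : ℕ) := Module.End ℂ ((Fin n → ℕ) → ℂ)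

def repG (q : ℂ) (M N : ℕ) (a : Fin n → ℂ) : Gen M N false → EndV n
  | Gen.Xp i m => Xpo q M a i.1 m
  | Gen.Xm i m => Xmo q M a i.1 m
  | Gen.K i => dg n (Kf q M i.1)
  | Gen.Ki i => dg n (Kif q M i.1)
  | Gen.H i s => dg n (Hf q M a i.1 s.1)
  | Gen.K0 _ => 0
  | Gen.K0i _ => 0

def repF (q : ℂ) (M N : ℕ) (a : Fin n → ℂ) : FA M N false →ₐ[ℂ] EndV n :=
  FreeAlgebra.lift ℂ (repG q M N a)

variable {q : ℂ} {M N : ℕ} {a : Fin n → ℂ}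

@[simp] lemma repF_gi (g : Gen M N false) : repF q M N a (gi g) = repG q M N a g := by
  unfold repF gi
  exact FreeAlgebra.lift_ι_apply _ _

lemma Kf_Kif (hq : q ≠ 0) (i : ℕ) : (Kf q M i * Kif q M i : (Fin n → ℕ) → ℂ) = 1 := by
  funext c
  simp only [Pi.mul_apply, Kf, Kif, Pi.one_apply]
  rw [← Finset.prod_mul_distrib]
  apply Finset.prod_eq_one; intro k _
  exact mul_inv_cancel₀ (zpow_ne_zero _ hq)

lemma dg_comm (f g : (Fin n → ℕ) → ℂ) : dg n f * dg n g = dg n g * dg n f := by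
  rw [← map_mul, mul_comm, map_mul]

lemma rep_phiP (i : Idx M N) (p : ℤ) :
    repF q M N a (phiPF q M N false i.1 p) = dg n (PhiP q M a i.1 p) := by
  unfold phiPF PhiP
  split
  · rw [map_mul, map_mul, expC_map, expC_map, KF, dif_pos i.2, repF_gi]
    congr 1
    apply expC_congr
    intro s
    rw [HF, dif_pos ⟨i.2, by omega⟩, repF_gi]
    rfl
  · simp

lemma rep_phiM (i : Idx M N) (p : ℤ) :
    repF q M N a (phiMF q M N false i.1 p) = dg n (PhiM q M a i.1 p) := by
  unfold phiMF PhiM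
  split
  · rw [map_mul, map_mul, expC_map, expC_map, KiF, dif_pos i.2, repF_gi]
    congr 1
    apply expC_congr
    intro s
    rw [HF, dif_pos ⟨i.2, by omega⟩, repF_gi]
    rfl
  · simp

lemma repF_osc (X : ℕ → ℤ → FA M N false) (Y : ℕ → ℤ → EndV n)
    (h : ∀ i m, M - 1 ≤ i → i ≤ M + 1 → repF q M N a (X i m) = Y i m) (m r k u : ℤ) :
    repF q M N a (oscOf q M X m r k u) = oscOf q M Y m r k u := by
  simp only [oscOf, brF, map_sub, map_add, map_mul, map_smul, h (M - 1) _ le_rfl (by omega),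
    h M _ (by omega) (by omega), h (M + 1) _ (by omega) le_rfl]

lemma rep_rel (h : Gn q a) (x y : FA M N false) (hr : rel q M N false 3 x y) :
    repF q M N a x = repF q M N a y := by
  have hq := h.q0
  cases hr with
  | KKi i => simp only [map_mul, repF_gi, map_one, repG]; rw [← map_mul, Kf_Kif hq, map_one]
  | KiK i =>
    simp only [map_mul, repF_gi, map_one, repG]; rw [← map_mul, mul_comm, Kf_Kif hq, map_one]
  | KK i j => simp only [map_mul, repF_gi, repG]; exact dg_comm _ _
  | KKi2 i j => simp only [map_mul, repF_gi, repG]; exact dg_comm _ _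
  | KiKi i j => simp only [map_mul, repF_gi, repG]; exact dg_comm _ _
  | KH i j s => simp only [map_mul, repF_gi, repG]; exact dg_comm _ _
  | KiH i j s => simp only [map_mul, repF_gi, repG]; exact dg_comm _ _
  | HH i j s t => simp only [map_mul, repF_gi, repG]; exact dg_comm _ _
  | KXp i j m => simp only [map_mul, map_smul, repF_gi, repG]; exact KXpo h _ _ _
  | KXm i j m => simp only [map_mul, map_smul, repF_gi, repG]; exact KXmo h _ _ _
  | HXp i j s m => simp only [map_mul, map_sub, map_smul, repF_gi, repG]; exact HXpo h _ _ _ _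
  | HXm i j s m =>
    simp only [map_mul, map_sub, map_neg, map_smul, repF_gi, repG]; exact HXmo h _ _ _ _
  | XpXm i j m r =>
    by_cases hij : i = j
    · subst hij
      simp only [if_true, map_mul, map_sub, map_smul, repF_gi, repG, rep_phiP, rep_phiM]
      exact XpXm_same h _ _ _
    · simp only [if_neg hij, map_mul, map_sub, map_smul, map_zero, repF_gi, repG]
      exact XpXm_ne h _ _ (fun e => hij (Subtype.ext e)) _ _
  | XX0p i j m r h2 hc =>
    simp only [map_mul, map_sub, map_smul, map_zero, repF_gi, repG]; exact Xp_comm0 h _ _ _ _ hc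
  | XX0m i j m r h2 hc =>
    simp only [map_mul, map_sub, map_smul, map_zero, repF_gi, repG]; exact Xm_comm0 h _ _ _ _ hc
  | XXp i j m r h2 hc =>
    simp only [map_mul, map_sub, map_smul, repF_gi, repG]; exact Xp_quad h _ _ _ _ hc
  | XXm i j m r h2 hc =>
    simp only [map_mul, map_sub, map_smul, repF_gi, repG]; exact Xm_quad h _ _ _ _ hc
  | serreP i j m r k h3 hc hi =>
    have := Xp_serre h i.1 j.1 m r k hc hi
    unfold brF at *
    simp only [map_mul, map_sub, map_add, map_zero, map_smul, repF_gi, repG]; exact this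
  | serreM i j m r k h3 hc hi =>
    have := Xm_serre h i.1 j.1 m r k hc hi
    unfold brF at *
    simp only [map_mul, map_sub, map_add, map_zero, map_smul, repF_gi, repG]; exact this
  | oscP m r k u h3 hM hN =>
    have e : ∀ i m, M - 1 ≤ i → i ≤ M + 1 → repF q M N a (XpF M N false i m) = Xpo q M a i m := by
      intro i m h1 h2
      rw [XpF, dif_pos ⟨by omega, by omega⟩, repF_gi]
      rfl
    rw [map_add, repF_osc _ _ e, repF_osc _ _ e, map_zero]
    exact Xp_osc h hM _ _ _ _
  | oscM m r k u h3 hM hN =>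
    have e : ∀ i m, M - 1 ≤ i → i ≤ M + 1 → repF q M N a (XmF M N false i m) = Xmo q M a i m := by
      intro i m h1 h2
      rw [XmF, dif_pos ⟨by omega, by omega⟩, repF_gi]
      rfl
    rw [map_add, repF_osc _ _ e, repF_osc _ _ e, map_zero]
    exact Xm_osc h hM _ _ _ _
  | K0K0i he => exact absurd he (by simp)
  | K0iK0 he => exact absurd he (by simp)
  | K0K he => exact absurd he (by simp)
  | K0Ki he => exact absurd he (by simp)
  | K0H he => exact absurd he (by simp)
  | K0Xp he => exact absurd he (by simp)
  | K0Xm he => exact absurd he (by simp)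

def rep (h : Gn q a) : ALG q M N false 3 →ₐ[ℂ] EndV n :=
  RingQuot.liftAlgHom ℂ ⟨repF q M N a, fun x y hr => rep_rel h x y hr⟩

lemma rep_mk (h : Gn q a) (x : FA M N false) : rep h (mkA q M N false 3 x) = repF q M N a x :=
  RingQuot.liftAlgHom_mkAlgHom_apply _ _ _ _

lemma rep_HA (h : Gn q a) (g : Idx M N × {s : ℤ // s ≠ 0}) :
    rep h (HA q M N false 3 g.1.1 g.2.1) = dg n (Hf q M a g.1.1 g.2.1) := by
  rw [HA, rep_mk, HF, dif_pos ⟨g.1.2, g.2.2⟩, repF_gi]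
  rfl

lemma rep_KA (h : Gn q a) (i : Idx M N) :
    rep h (KA q M N false 3 i.1) = dg n (Kf q M i.1) := by
  rw [KA, rep_mk, KF, dif_pos i.2, repF_gi]
  rfl

end QAS

namespace QAS
open Finset Function

section hom
variable {I : Type}

lemma monhom_ext {B : Type} [Monoid B] (F G : Multiplicative (I →₀ ℤ) →* B)
    (h : ∀ i, F (Multiplicative.ofAdd (Finsupp.single i 1)) =
      G (Multiplicative.ofAdd (Finsupp.single i 1))) : F = G := by
  have key : ∀ x : I →₀ ℤ, F.toHomUnits (Multiplicative.ofAdd x) =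
      G.toHomUnits (Multiplicative.ofAdd x) := by
    intro x
    induction x using Finsupp.induction_linear with
    | zero => simp
    | add x y hx hy => rw [ofAdd_add, map_mul, map_mul, hx, hy]
    | single i z =>
      have : Multiplicative.ofAdd (Finsupp.single i z) =
          (Multiplicative.ofAdd (Finsupp.single i (1 : ℤ))) ^ z := by
        rw [← ofAdd_zsmul, Finsupp.smul_single, smul_eq_mul, mul_one]
      rw [this, map_zpow, map_zpow]
      congr 1
      exact Units.ext (h i)
  apply MonoidHom.ext
  intro x
  exact congrArg Units.val (key x.toAdd)

/-- character of the lattice with given values on the basis -/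
def zh {B : Type} [CommMonoid B] (z : I → Bˣ) : Multiplicative (I →₀ ℤ) →* B :=
  (Units.coeHom B).comp (AddMonoidHom.toMultiplicativeLeft
    (Finsupp.liftAddHom fun i => zmultiplesHom (Additive Bˣ) (Additive.ofMul (z i))))

lemma zh_single {B : Type} [CommMonoid B] (z : I → Bˣ) (i : I) :
    zh z (Multiplicative.ofAdd (Finsupp.single i 1)) = z i := by
  simp [zh]

lemma zh_single_neg {B : Type} [CommMonoid B] (z : I → Bˣ) (i : I) :
    zh z (Multiplicative.ofAdd (Finsupp.single i (-1))) = ((z i)⁻¹ : Bˣ) := by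
  unfold zh
  rw [MonoidHom.comp_apply]
  change ((Additive.toMul (Finsupp.liftAddHom _ (Finsupp.single i (-1))) : Bˣ) : B) = _
  rw [Finsupp.liftAddHom_apply_single]
  simp

abbrev Lau (I : Type) := AddMonoidAlgebra ℂ (I →₀ ℤ)

lemma exists_hom {A J : Type} [Ring A] [Algebra ℂ A] (k ki : I → A) (hh : J → A)
    (c1 : ∀ i j, k i * k j = k j * k i) (c2 : ∀ i j, k i * ki j = ki j * k i)
    (c3 : ∀ i j, ki i * ki j = ki j * ki i) (c4 : ∀ i j, k i * hh j = hh j * k i)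
    (c5 : ∀ i j, ki i * hh j = hh j * ki i) (c6 : ∀ i j, hh i * hh j = hh j * hh i)
    (hk : ∀ i, k i * ki i = 1) :
    ∃ φ : MvPolynomial J (Lau I) →ₐ[ℂ] A,
      (∀ g, φ (MvPolynomial.X g) = hh g) ∧
      (∀ i, φ (MvPolynomial.C (AddMonoidAlgebra.single (Finsupp.single i 1) (1 : ℂ))) = k i) ∧
      φ.range = Algebra.adjoin ℂ (Set.range k ∪ Set.range ki ∪ Set.range hh) := by
  set S := Set.range k ∪ Set.range ki ∪ Set.range hh with hS
  have hcomm : ∀ x ∈ S, ∀ y ∈ S, x * y = y * x := by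
    rintro _ ((⟨i, rfl⟩ | ⟨i, rfl⟩) | ⟨i, rfl⟩) _ ((⟨j, rfl⟩ | ⟨j, rfl⟩) | ⟨j, rfl⟩)
    · exact c1 _ _
    · exact c2 _ _
    · exact c4 _ _
    · exact (c2 _ _).symm
    · exact c3 _ _
    · exact c5 _ _
    · exact (c4 _ _).symm
    · exact (c5 _ _).symm
    · exact c6 _ _
  have hB := Algebra.isMulCommutative_adjoin ℂ hcomm
  let B := Algebra.adjoin ℂ S
  let _ : CommRing B := { (inferInstance : Ring B) with
    mul_comm := fun x y => hB.is_comm.comm x y }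
  have mk : ∀ i, k i ∈ B := fun i => Algebra.subset_adjoin (Or.inl (Or.inl ⟨i, rfl⟩))
  have mki : ∀ i, ki i ∈ B := fun i => Algebra.subset_adjoin (Or.inl (Or.inr ⟨i, rfl⟩))
  have mh : ∀ i, hh i ∈ B := fun i => Algebra.subset_adjoin (Or.inr ⟨i, rfl⟩)
  let u : I → Bˣ := fun i => ⟨⟨k i, mk i⟩, ⟨ki i, mki i⟩, Subtype.ext (hk i),
    Subtype.ext ((c2 i i).symm.trans (hk i))⟩
  let ψ : MvPolynomial J (Lau I) →ₐ[ℂ] B :=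
    MvPolynomial.aevalTower (AddMonoidAlgebra.lift ℂ B (I →₀ ℤ) (zh u)) (fun g => ⟨hh g, mh g⟩)
  have e1 : ∀ g, (B.val.comp ψ) (MvPolynomial.X g) = hh g := by
    intro g
    simp [ψ]
  have e2 : ∀ i, (B.val.comp ψ)
      (MvPolynomial.C (AddMonoidAlgebra.single (Finsupp.single i 1) (1 : ℂ))) = k i := by
    intro i
    rw [AlgHom.comp_apply, MvPolynomial.aevalTower_C, AddMonoidAlgebra.lift_single, one_smul,
      zh_single]
    rfl
  have e3 : ∀ i, (B.val.comp ψ)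
      (MvPolynomial.C (AddMonoidAlgebra.single (Finsupp.single i (-1)) (1 : ℂ))) = ki i := by
    intro i
    rw [AlgHom.comp_apply, MvPolynomial.aevalTower_C, AddMonoidAlgebra.lift_single, one_smul,
      zh_single_neg]
    rfl
  refine ⟨B.val.comp ψ, e1, e2, le_antisymm ?_ ?_⟩
  · rintro _ ⟨x, rfl⟩
    exact (ψ x).2
  · apply Algebra.adjoin_le
    rintro _ ((⟨i, rfl⟩ | ⟨i, rfl⟩) | ⟨i, rfl⟩)
    · exact ⟨_, e2 i⟩
    · exact ⟨_, e3 i⟩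
    · exact ⟨_, e1 i⟩

/-- evaluation of Laurent polynomials -/
def evz (z : I → ℂˣ) : Lau I →+* ℂ := (AddMonoidAlgebra.lift ℂ ℂ (I →₀ ℤ) (zh z)).toRingHom

lemma evz_single (z : I → ℂˣ) (m : I →₀ ℤ) (r : ℂ) :
    evz z (AddMonoidAlgebra.single m r) = r * zh z (Multiplicative.ofAdd m) := by
  unfold evz
  exact AddMonoidAlgebra.lift_single _ _ _

/-- evaluation of everything -/
def chi {J : Type} (z : I → ℂˣ) (w : J → ℂ) : MvPolynomial J (Lau I) →+* ℂ :=
  (MvPolynomial.eval w).comp (MvPolynomial.map (evz z))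

lemma eval_formula {X J A : Type} [Ring A] [Algebra ℂ A] (D : (X → ℂ) →ₐ[ℂ] A)
    (φ : MvPolynomial J (Lau I) →ₐ[ℂ] A) (z : X → I → ℂˣ) (w : X → J → ℂ)
    (h1 : ∀ g, φ (MvPolynomial.X g) = D (fun c => w c g))
    (h2 : ∀ i, φ (MvPolynomial.C (AddMonoidAlgebra.single (Finsupp.single i 1) (1 : ℂ))) =
      D (fun c => z c i)) (f : MvPolynomial J (Lau I)) :
    φ f = D (fun c => chi (z c) (w c) f) := by
  have hC : ∀ r, φ (MvPolynomial.C r) = D (fun c => evz (z c) r) := by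
    let F : Multiplicative (I →₀ ℤ) →* A :=
      (φ : MvPolynomial J (Lau I) →* A).comp
        ((MvPolynomial.C : Lau I →+* MvPolynomial J (Lau I)).toMonoidHom.comp
        (AddMonoidAlgebra.of ℂ (I →₀ ℤ)))
    let G : Multiplicative (I →₀ ℤ) →* A := (D : (X → ℂ) →* A).comp
      { toFun := fun m c => zh (z c) m
        map_one' := by funext c; simp
        map_mul' := fun x y => by funext c; simp }
    have hFG : F = G := by
      apply monhom_ext
      intro i
      refine (h2 i).trans ?_
      change D _ = D (fun c => zh (z c) (Multiplicative.ofAdd (Finsupp.single i 1)))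
      simp only [zh_single]
    intro r
    induction r using AddMonoidAlgebra.induction_linear with
    | zero => simp only [map_zero]; exact (map_zero D).symm
    | add x y hx hy =>
      rw [map_add, map_add, hx, hy, ← map_add]
      congr 1
      funext c
      simp
    | single m r =>
      have e := DFunLike.congr_fun hFG (Multiplicative.ofAdd m)
      have e' : φ (MvPolynomial.C (AddMonoidAlgebra.single m 1)) =
        D (fun c => zh (z c) (Multiplicative.ofAdd m)) := e
      have s1 : (AddMonoidAlgebra.single m r : Lau I) = r • AddMonoidAlgebra.single m 1 := by
        simp
      have s2 : (MvPolynomial.C (r • AddMonoidAlgebra.single m 1 : Lau I) :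
          MvPolynomial J (Lau I)) = r • MvPolynomial.C (AddMonoidAlgebra.single m 1) := by
        classical
        exact MvPolynomial.ext _ _ fun d => by
          rw [MvPolynomial.coeff_smul, MvPolynomial.coeff_C, MvPolynomial.coeff_C]
          split <;> simp
      rw [s1, s2, map_smul, e', ← map_smul]
      congr 1
      funext c
      rw [← s1, evz_single]
      rfl
  induction f using MvPolynomial.induction_on with
  | C r =>
    rw [hC]; congr 1; funext c; simp [chi]
  | add p r hp hr =>
    rw [map_add, hp, hr, ← map_add]; congr 1; funext c; simp
  | mul_X p i hp =>
    rw [map_mul, hp, h1, ← map_mul]; congr 1; funext c; simp [chi]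
end hom

end QAS

namespace QAS
open Finset Function

section tri
instance finIdx (M N : ℕ) : Fintype (Idx M N) :=
  Fintype.subtype (Finset.Icc 1 (M + N - 1)) (by simp)

lemma tri {M N : ℕ} {R : Type} [CommRing R] [IsDomain R] (κ : ℕ → ℕ → R)
    (h0 : ∀ i j, j ≠ i → j ≠ i + 1 → κ i j = 0) (h1 : ∀ i, κ i i ≠ 0) (x : Idx M N → R)
    (hx : ∀ j : Idx M N, ∑ i, x i * κ i.1 j.1 = 0) : ∀ i, x i = 0 := by
  have key : ∀ n : ℕ, ∀ i : Idx M N, i.1 = n → x i = 0 := by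
    intro n
    induction n using Nat.strong_induction_on with
    | _ n ih =>
      intro j hj
      have e := hx j
      rw [Finset.sum_eq_single j] at e
      · exact (mul_eq_zero.1 e).resolve_right (h1 _)
      · intro i _ hij
        by_cases h : j.1 = i.1 + 1
        · rw [ih i.1 (by omega) i rfl, zero_mul]
        · rw [h0 _ _ (fun h' => hij (Subtype.ext h'.symm)) h, mul_zero]
      · intro h; exact absurd (Finset.mem_univ j) h
  exact fun i => key i.1 i rfl
end tri

section dens
variable {n : ℕ} {q : ℂ} {M : ℕ} {J : Type}

lemma exists_dense (q0 : q ≠ 0) (q1 : ∀ e : ℤ, e ≠ 0 → q ^ e ≠ 1) (a : Fin n → ℂ)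
    (ha : ∀ k, a k ≠ 0) :
    Dense {t : ℝ | Gn q (fun k : Fin n => a k * ((Real.exp (k.1 * t) : ℝ) : ℂ))} := by
  have hc : Set.Countable (⋃ x : Fin n × Fin n × ℤ, {t : ℝ | x.1 ≠ x.2.1 ∧
      a x.1 * ((Real.exp (x.1.1 * t) : ℝ) : ℂ) =
        q ^ x.2.2 * (a x.2.1 * ((Real.exp (x.2.1.1 * t) : ℝ) : ℂ))}) := by
    apply Set.countable_iUnion
    rintro ⟨k, l, e⟩
    apply Set.Subsingleton.countable
    rintro t ⟨hkl, ht⟩ u ⟨-, hu⟩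
    dsimp only at hkl ht hu
    have hB : a k * (q ^ e * a l) ≠ 0 :=
      mul_ne_zero (ha k) (mul_ne_zero (zpow_ne_zero _ q0) (ha l))
    have e1 : ((Real.exp (k.1 * t) : ℝ) : ℂ) * ((Real.exp (l.1 * u) : ℝ) : ℂ) =
        ((Real.exp (k.1 * u) : ℝ) : ℂ) * ((Real.exp (l.1 * t) : ℝ) : ℂ) := by
      apply mul_left_cancel₀ hB
      linear_combination (q ^ e * a l * ((Real.exp (l.1 * u) : ℝ) : ℂ)) * ht -
        (q ^ e * a l * ((Real.exp (l.1 * t) : ℝ) : ℂ)) * hu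
    rw [← Complex.ofReal_mul, ← Complex.ofReal_mul, Complex.ofReal_inj, ← Real.exp_add,
      ← Real.exp_add, Real.exp_eq_exp] at e1
    have hne : (k.1 : ℝ) - l.1 ≠ 0 := by
      rw [sub_ne_zero]; exact_mod_cast fun h => hkl (Fin.ext h)
    have : ((k.1 : ℝ) - l.1) * (t - u) = 0 := by linear_combination e1
    exact sub_eq_zero.1 ((mul_eq_zero.1 this).resolve_left hne)
  refine (hc.dense_compl ℝ).mono ?_
  intro t ht
  refine ⟨q0, q1, fun k => mul_ne_zero (ha k) ?_, ?_⟩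
  · exact_mod_cast (Real.exp_pos _).ne'
  · intro k l hkl e he
    exact ht (Set.mem_iUnion.2 ⟨(k, l, e), hkl, he⟩)

lemma extend (q0 : q ≠ 0) (q1 : ∀ e : ℤ, e ≠ 0 → q ^ e ≠ 1) (ix : J → ℕ) (sx : J → ℤ)
    (g : MvPolynomial J ℂ) (c : Fin n → ℕ)
    (H : ∀ a : Fin n → ℂ, Gn q a → MvPolynomial.eval (fun v => Hf q M a (ix v) (sx v) c) g = 0)
    (a : Fin n → ℂ) (ha : ∀ k, a k ≠ 0) :
    MvPolynomial.eval (fun v => Hf q M a (ix v) (sx v) c) g = 0 := by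
  let A : ℝ → Fin n → ℂ := fun t k => a k * ((Real.exp (k.1 * t) : ℝ) : ℂ)
  have hcont : Continuous fun t => MvPolynomial.eval (fun v => Hf q M (A t) (ix v) (sx v) c) g := by
    refine (MvPolynomial.continuous_eval g).comp (continuous_pi fun v => ?_)
    unfold Hf
    refine continuous_finset_sum _ fun k _ => continuous_const.mul ?_
    refine Continuous.zpow₀ ?_ _ fun t => Or.inl ?_
    · unfold xx A
      fun_prop
    · unfold xx A
      refine mul_ne_zero (zpow_ne_zero _ q0) (mul_ne_zero (ha k) ?_)
      exact_mod_cast (Real.exp_pos _).ne'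
  have := Continuous.ext_on (exists_dense q0 q1 a ha) hcont (continuous_const (y := (0 : ℂ)))
    (fun t ht => H _ ht)
  have h0 := congrFun this 0
  have : A 0 = a := by funext k; simp [A]
  rw [← this]
  exact h0
end dens

section grid
variable {J ι : Type} [Fintype ι]

lemma grid (g : MvPolynomial J ℂ) (D : ℕ) (hD : ∀ d ∈ g.support, (d.sum fun _ e => e) ≤ D)
    (h0 : J → ℂ) (w : ι → J → ℂ)
    (H : ∀ m : ι → ℕ, (∀ r, m r ≤ D) →
      MvPolynomial.eval (fun v => h0 v + ∑ r, (m r : ℂ) * w r v) g = 0) (t : ι → ℂ) :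
    MvPolynomial.eval (fun v => h0 v + ∑ r, t r * w r v) g = 0 := by
  classical
  let ℓ : J → MvPolynomial ι ℂ := fun v =>
    MvPolynomial.C (h0 v) + ∑ r, MvPolynomial.X r * MvPolynomial.C (w r v)
  have hℓ : ∀ v, (ℓ v).totalDegree ≤ 1 := by
    intro v
    refine (MvPolynomial.totalDegree_add _ _).trans (max_le (by simp) ?_)
    refine MvPolynomial.totalDegree_finsetSum_le fun r _ => ?_
    refine (MvPolynomial.totalDegree_mul _ _).trans ?_
    simp
  let G := MvPolynomial.aeval ℓ g
  have hG : G.totalDegree ≤ D := by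
    have : G = ∑ d ∈ g.support, MvPolynomial.C (g.coeff d) * d.prod fun v e => ℓ v ^ e := by
      simp only [G]
      rw [MvPolynomial.aeval_def, MvPolynomial.eval₂_eq]
      rfl
    rw [this]
    refine MvPolynomial.totalDegree_finsetSum_le fun d hd => ?_
    refine (MvPolynomial.totalDegree_mul _ _).trans ?_
    rw [MvPolynomial.totalDegree_C, zero_add]
    refine (MvPolynomial.totalDegree_finsetProd _ _).trans (le_trans ?_ (hD d hd))
    refine Finset.sum_le_sum fun v _ => ?_
    refine (MvPolynomial.totalDegree_pow _ _).trans ?_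
    nlinarith [hℓ v]
  have ev : ∀ t : ι → ℂ, MvPolynomial.eval t G =
      MvPolynomial.eval (fun v => h0 v + ∑ r, t r * w r v) g := by
    intro t
    simp only [G]
    have : ((MvPolynomial.eval t).comp (MvPolynomial.aeval (R := ℂ) ℓ).toRingHom) =
        MvPolynomial.eval (fun v => h0 v + ∑ r, t r * w r v) := by
      apply MvPolynomial.ringHom_ext
      · intro r; simp
      · intro v; simp [ℓ]
    exact DFunLike.congr_fun this g
  have : G = 0 := by
    apply MvPolynomial.eq_zero_of_eval_zero_at_prod_finset G
      (fun _ => (Finset.range (D + 1)).image (Nat.cast : ℕ → ℂ))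
    · intro r
      rw [Finset.card_image_of_injective _ Nat.cast_injective, Finset.card_range]
      exact Nat.lt_succ_of_le ((MvPolynomial.degreeOf_le_totalDegree _ _).trans hG)
    · intro x hx
      have : ∀ r, ∃ m : ℕ, m ≤ D ∧ (m : ℂ) = x r := by
        intro r
        obtain ⟨m, hm, e⟩ := Finset.mem_image.1 (hx r)
        exact ⟨m, by simpa [Nat.lt_succ_iff] using hm, e⟩
      choose m hm e using this
      have hh := H m hm
      rw [ev]
      simpa only [e] using hh
  rw [← ev, this, map_zero]
end grid
end QAS

namespace QAS
open Finset Function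

lemma zh_eq {I : Type} [Fintype I] (z : I → ℂˣ) (m : I →₀ ℤ) :
    zh z (Multiplicative.ofAdd m) = ((∏ i, z i ^ m i : ℂˣ) : ℂ) := by
  unfold zh
  rw [MonoidHom.comp_apply]
  change ((Additive.toMul (Finsupp.liftAddHom _ m) : ℂˣ) : ℂ) = _
  rw [Finsupp.liftAddHom_apply, Finsupp.sum_fintype _ _ (by simp)]
  simp

section chars
variable {M N : ℕ}

/-- the value of the `K` on a configuration -/
def zP (q : ℂˣ) (M N : ℕ) (P : Multiset (ℕ × ℂˣ)) : Idx M N → ℂˣ := fun i =>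
  (P.map fun p => q ^ kk M i.1 p.1).prod

lemma zP_zero (q : ℂˣ) : zP q M N 0 = 1 := by funext i; simp [zP]
lemma zP_add (q : ℂˣ) (P Q : Multiset (ℕ × ℂˣ)) :
    zP q M N (P + Q) = zP q M N P * zP q M N Q := by funext i; simp [zP]

/-- the characters -/
def psiC (q : ℂˣ) (M N : ℕ) (m : Idx M N →₀ ℤ) : Multiplicative (Multiset (ℕ × ℂˣ)) →* ℂ where
  toFun P := zh (zP q M N P.toAdd) (Multiplicative.ofAdd m)
  map_one' := by rw [toAdd_one, zP_zero, zh_eq]; simp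
  map_mul' P Q := by
    rw [toAdd_mul, zP_add, zh_eq, zh_eq, zh_eq, ← Units.val_mul, ← Finset.prod_mul_distrib]
    simp [mul_zpow]

lemma psiC_inj (q : ℂˣ) (q1 : ∀ e : ℤ, e ≠ 0 → (q : ℂ) ^ e ≠ 1) :
    Function.Injective (psiC q M N) := by
  intro m m' h
  have key : ∀ i, m i - m' i = 0 := by
    apply tri (kk M)
    · intro i j h1 h2; simp [kk, h1, h2]
    · intro i
      have := lof_cases M i
      simp only [kk, if_true]
      rcases this with h | h <;> rw [h] <;> decide
    · intro j
      have e := DFunLike.congr_fun h (Multiplicative.ofAdd {(j.1, 1)})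
      have val : ∀ m : Idx M N →₀ ℤ, psiC q M N m (Multiplicative.ofAdd {(j.1, 1)}) =
          (q : ℂ) ^ (∑ i, m i * kk M i.1 j.1) := by
        intro m
        change zh (zP q M N {(j.1, 1)}) (Multiplicative.ofAdd m) = _
        rw [zh_eq, ← Units.val_zpow_eq_zpow_val, Units.val_inj]
        have : ∀ (s : Finset (Idx M N)) (f : Idx M N → ℤ), q ^ (∑ i ∈ s, f i) =
            ∏ i ∈ s, q ^ f i := by
          classical
          intro s f
          induction s using Finset.induction_on with
          | empty => simp
          | insert a s ha ih => rw [Finset.sum_insert ha, Finset.prod_insert ha, zpow_add, ih]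
        rw [this]
        refine Finset.prod_congr rfl fun i _ => ?_
        simp only [zP, Multiset.map_singleton, Multiset.prod_singleton]
        rw [← zpow_mul, mul_comm]
      rw [val, val] at e
      by_contra hne
      refine q1 _ hne ?_
      simp only [sub_mul, Finset.sum_sub_distrib]
      rw [zpow_sub₀ q.ne_zero, e, div_self (zpow_ne_zero _ q.ne_zero)]
  ext i
  exact sub_eq_zero.1 (key i)

lemma lau_zero (q : ℂˣ) (q1 : ∀ e : ℤ, e ≠ 0 → (q : ℂ) ^ e ≠ 1) (Z0 : Idx M N → ℂˣ)
    (b : Lau (Idx M N)) (H : ∀ Q, evz (zP q M N Q * Z0) b = 0) : b = 0 := by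
  have li := (linearIndependent_monoidHom (Multiplicative (Multiset (ℕ × ℂˣ))) ℂ).comp
    (psiC q M N) (psiC_inj q q1)
  rw [linearIndependent_iff'] at li
  have := li b.coeff.support (fun m => b.coeff m * zh Z0 (Multiplicative.ofAdd m)) (by
    funext Q
    rw [Finset.sum_apply]
    have h := H Q.toAdd
    have e : evz (zP q M N Q.toAdd * Z0) b = b.coeff.sum fun a r =>
      r • zh (zP q M N Q.toAdd * Z0) (Multiplicative.ofAdd a) := AddMonoidAlgebra.lift_apply _ _
    rw [e] at h
    rw [Pi.zero_apply, ← h, Finsupp.sum]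
    refine Finset.sum_congr rfl fun m _ => ?_
    change _ * zh (zP q M N Q.toAdd) (Multiplicative.ofAdd m) = _
    rw [smul_eq_mul, mul_assoc]
    congr 1
    rw [zh_eq, zh_eq, zh_eq, ← Units.val_mul, ← Finset.prod_mul_distrib]
    simp [mul_zpow, mul_comm])
  have hb : b.coeff = 0 := by
    ext m
    by_cases hm : m ∈ b.coeff.support
    · have h := this m hm
      refine (mul_eq_zero.1 h).resolve_right ?_
      rw [zh_eq]
      exact Units.ne_zero _
    · exact Finsupp.notMem_support_iff.1 hm
  cases b
  simp only at hb
  rw [hb]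
  rfl
end chars

section span
variable {M N : ℕ}

abbrev JJ (M N : ℕ) := Idx M N × {s : ℤ // s ≠ 0}

/-- contribution of one point -/
def uu (q : ℂ) (M N : ℕ) (p : ℕ × ℂˣ) (v : JJ M N) : ℂ :=
  eta q M v.1.1 v.2.1 p.1 * (q ^ ee M v.1.1 * p.2) ^ v.2.1

lemma zchar_indep : LinearIndependent ℂ
    (fun (o : Option {s : ℤ // s ≠ 0}) (b : ℂˣ) => (b : ℂ) ^ (o.elim (0 : ℤ) (fun s => s.1))) := by
  let ch : Option {s : ℤ // s ≠ 0} → (ℂˣ →* ℂ) := fun o =>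
    (Units.coeHom ℂ).comp (zpowGroupHom (o.elim (0 : ℤ) (fun s => s.1)))
  have hinj : Function.Injective ch := by
    have h2 : Function.Injective (fun o : Option {s : ℤ // s ≠ 0} =>
        (o.elim (0 : ℤ) (fun s => s.1))) := by
      rintro (_ | s) (_ | t) h
      · rfl
      · exact absurd h.symm t.2
      · exact absurd h s.2
      · exact congrArg some (Subtype.ext h)
    intro o o' h
    apply h2
    have e := DFunLike.congr_fun h (Units.mk0 (2 : ℂ) two_ne_zero)
    simp only [ch, MonoidHom.comp_apply, zpowGroupHom_apply, Units.coeHom_apply,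
      Units.val_zpow_eq_zpow_val, Units.val_mk0] at e
    have e2 := congrArg (fun x => ‖x‖) e
    simp only [norm_zpow, Complex.norm_ofNat] at e2
    exact zpow_right_injective₀ (by norm_num) (by norm_num) e2
  have := (linearIndependent_monoidHom ℂˣ ℂ).comp ch hinj
  have he : (fun (o : Option {s : ℤ // s ≠ 0}) (b : ℂˣ) =>
      (b : ℂ) ^ (o.elim (0 : ℤ) (fun s => s.1))) = (fun f : ℂˣ →* ℂ => ⇑f) ∘ ch := by
    funext o b
    simp [ch]
  rw [he]
  exact this

lemma eta_diag (q : ℂ) (q0 : q ≠ 0) (q1 : ∀ e : ℤ, e ≠ 0 → q ^ e ≠ 1) (i : ℕ) (s : ℤ)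
    (hs : s ≠ 0) : eta q M i s i ≠ 0 := by
  have hg : Gn q (Fin.elim0 : Fin 0 → ℂ) := ⟨q0, q1, fun k => k.elim0, fun k => k.elim0⟩
  unfold eta
  refine div_ne_zero (sub_ne_zero.2 (q1 _ ?_).symm) (mul_ne_zero (by exact_mod_cast hs)
    (tau_ne hg i))
  simp only [kk, if_true]
  refine mul_ne_zero (mul_ne_zero (by norm_num) hs) ?_
  rcases lof_cases M i with h | h <;> rw [h] <;> decide

lemma span_top (q : ℂ) (q0 : q ≠ 0) (q1 : ∀ e : ℤ, e ≠ 0 → q ^ e ≠ 1) (F : Finset (JJ M N)) :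
    Submodule.span ℂ (Set.range fun (p : Idx M N × ℂˣ) (v : F) =>
      uu q M N (p.1.1, p.2) v.1 - uu q M N (p.1.1, 1) v.1) = ⊤ := by
  classical
  by_contra hne
  obtain ⟨f, hf, hk⟩ := Submodule.exists_le_ker_of_lt_top _ (lt_top_iff_ne_top.2 hne)
  apply hf
  let Λ : JJ M N → ℂ := fun v => if h : v ∈ F then f (fun j => if ⟨v, h⟩ = j then 1 else 0) else 0
  let S : Finset {s : ℤ // s ≠ 0} := F.image Prod.snd
  have hΛ : ∀ v, v ∉ F → Λ v = 0 := fun v hv => dif_neg hv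
  have fsum : ∀ y : JJ M N → ℂ, f (fun v => y v.1) = ∑ s ∈ S, ∑ i, y (i, s) * Λ (i, s) := by
    intro y
    rw [LinearMap.pi_apply_eq_sum_univ f]
    have e1 : ∑ v : F, (y v.1) • f (fun j => if v = j then 1 else 0) =
        ∑ v : F, y v.1 * Λ v.1 := by
      refine Finset.sum_congr rfl fun v _ => ?_
      simp only [Λ, dif_pos v.2, smul_eq_mul]
    rw [e1, Finset.sum_coe_sort F (fun v => y v * Λ v), Finset.sum_comm, ← Finset.sum_product'
      (f := fun i s => y (i, s) * Λ (i, s))]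
    refine Finset.sum_subset ?_ ?_
    · intro v hv
      exact Finset.mem_product.2 ⟨Finset.mem_univ _, Finset.mem_image_of_mem _ hv⟩
    · intro v _ hv
      rw [hΛ v hv, mul_zero]
  have hzero : ∀ s ∈ S, ∀ i, Λ (i, s) = 0 := by
    have hB : ∀ j : Idx M N, ∀ s ∈ S,
        ∑ i : Idx M N, (Λ (i, s) * (q ^ ee M i.1) ^ s.1) * eta q M i.1 s.1 j.1 = 0 := by
      intro j
      let B : {s : ℤ // s ≠ 0} → ℂ := fun s =>
        ∑ i : Idx M N, (Λ (i, s) * (q ^ ee M i.1) ^ s.1) * eta q M i.1 s.1 j.1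
      have li := linearIndependent_iff'.1 zchar_indep (Finset.insertNone S)
        (fun o => o.elim (-∑ s ∈ S, B s) B) (by
          rw [Finset.sum_insertNone]
          funext b
          have h := hk (Submodule.subset_span ⟨(j, b), rfl⟩)
          rw [LinearMap.mem_ker] at h
          have h' := (fsum (fun v => uu q M N (j.1, b) v - uu q M N (j.1, 1) v)).symm.trans h
          rw [Pi.add_apply, Finset.sum_apply]
          simp only [Pi.smul_apply, Option.elim, zpow_zero, smul_eq_mul, mul_one, Pi.zero_apply]
          rw [← h', neg_add_eq_sub, ← Finset.sum_sub_distrib]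
          refine Finset.sum_congr rfl fun s _ => ?_
          rw [← mul_sub_one]
          simp only [B, Finset.sum_mul]
          refine Finset.sum_congr rfl fun i _ => ?_
          simp only [uu, mul_zpow, Units.val_one, one_zpow]
          ring)
      intro s hs
      exact li (some s) (Finset.some_mem_insertNone.2 hs)
    intro s hs i
    have := tri (fun i j => eta q M i s.1 j) (by
        intro i j h1 h2
        simp [eta, kk, h1, h2]) (fun i => eta_diag q q0 q1 i s.1 s.2)
        (fun i : Idx M N => Λ (i, s) * (q ^ ee M i.1) ^ s.1) (fun j => hB j s hs) i
    exact (mul_eq_zero.1 this).resolve_right (zpow_ne_zero _ (zpow_ne_zero _ q0))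
  apply LinearMap.ext
  intro y
  have := fsum (fun v => if h : v ∈ F then y ⟨v, h⟩ else 0)
  have e : (fun v : F => (fun v => if h : v ∈ F then y ⟨v, h⟩ else 0) v.1) = y := by
    funext v
    simp
  rw [e] at this
  rw [this]
  exact Finset.sum_eq_zero fun s hs => Finset.sum_eq_zero fun i _ => by rw [hzero s hs i, mul_zero]

lemma exists_T (q : ℂ) (q0 : q ≠ 0) (q1 : ∀ e : ℤ, e ≠ 0 → q ^ e ≠ 1) (F : Finset (JJ M N)) :
    ∃ T : Finset (Idx M N × ℂˣ), ∀ y : JJ M N → ℂ, ∃ t : T → ℂ, ∀ v ∈ F,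
      y v = ∑ p : T, t p * (uu q M N (p.1.1.1, p.1.2) v - uu q M N (p.1.1.1, 1) v) := by
  classical
  have h : ∀ v : F, ∃ c : (Idx M N × ℂˣ) →₀ ℂ, (c.sum fun p a => a • (fun (v : F) =>
      uu q M N (p.1.1, p.2) v.1 - uu q M N (p.1.1, 1) v.1)) = Pi.single v 1 := by
    intro v
    rw [← Finsupp.mem_span_range_iff_exists_finsupp, span_top q q0 q1 F]
    trivial
  choose c hc using h
  refine ⟨Finset.univ.biUnion fun v => (c v).support, fun y => ⟨fun p => ∑ v : F, y v.1 * c v p.1,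
    fun v hv => ?_⟩⟩
  rw [Finset.sum_coe_sort _ (fun p : Idx M N × ℂˣ => (∑ v : F, y v.1 * c v p) *
    (uu q M N (p.1.1, p.2) v - uu q M N (p.1.1, 1) v))]
  simp only [Finset.sum_mul]
  rw [Finset.sum_comm]
  have e : ∀ x : F, ∑ p ∈ Finset.univ.biUnion (fun v => (c v).support), y x.1 * c x p *
      (uu q M N (p.1.1, p.2) v - uu q M N (p.1.1, 1) v) = y x.1 * (Pi.single x (1 : ℂ) : F → ℂ) ⟨v, hv⟩ := by
    intro x
    rw [← hc x, Finsupp.sum, Finset.sum_apply, Finset.mul_sum]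
    symm
    refine Finset.sum_subset_zero_on_sdiff ?_ ?_ ?_
    · exact Finset.subset_biUnion_of_mem (fun v => (c v).support) (Finset.mem_univ x)
    · intro p hp
      have := Finsupp.notMem_support_iff.1 (Finset.mem_sdiff.1 hp).2
      rw [this]; ring
    · intro p _
      simp only [Pi.smul_apply, smul_eq_mul]
      ring
  simp only [e]
  rw [Finset.sum_eq_single (⟨v, hv⟩ : F)]
  · simp
  · intro b _ hb
    rw [Pi.single_eq_of_ne hb.symm, mul_zero]
  · intro h; exact absurd (Finset.mem_univ _) h
end span
end QAS

namespace QAS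
open Finset Function
variable {M N : ℕ}

/-- the value of the `h` on a configuration -/
def hP (q : ℂ) (M N : ℕ) (P : Multiset (ℕ × ℂˣ)) (v : JJ M N) : ℂ := (P.map fun p => uu q M N p v).sum

lemma hP_add (q : ℂ) (P Q : Multiset (ℕ × ℂˣ)) (v : JJ M N) :
    hP q M N (P + Q) v = hP q M N P v + hP q M N Q v := by simp [hP]

lemma hP_nsmul (q : ℂ) (n : ℕ) (P : Multiset (ℕ × ℂˣ)) (v : JJ M N) :
    hP q M N (n • P) v = n * hP q M N P v := by
  simp [hP, Multiset.map_nsmul, Multiset.sum_nsmul]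

lemma hP_sum {ι : Type} (q : ℂ) (s : Finset ι) (P : ι → Multiset (ℕ × ℂˣ)) (v : JJ M N) :
    hP q M N (∑ i ∈ s, P i) v = ∑ i ∈ s, hP q M N (P i) v := by
  classical
  induction s using Finset.induction_on with
  | empty => simp [hP]
  | insert a s ha ih => rw [Finset.sum_insert ha, Finset.sum_insert ha, hP_add, ih]

lemma hP_singleton (q : ℂ) (p : ℕ × ℂˣ) (v : JJ M N) : hP q M N {p} v = uu q M N p v := by
  simp [hP]

lemma zP_nsmul (q : ℂˣ) (n : ℕ) (P : Multiset (ℕ × ℂˣ)) :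
    zP q M N (n • P) = zP q M N P ^ n := by
  funext i
  simp [zP, Multiset.map_nsmul, Multiset.prod_nsmul]

lemma zP_sum {ι : Type} (q : ℂˣ) (s : Finset ι) (P : ι → Multiset (ℕ × ℂˣ)) :
    zP q M N (∑ i ∈ s, P i) = ∏ i ∈ s, zP q M N (P i) := by
  classical
  induction s using Finset.induction_on with
  | empty => simp [zP_zero]
  | insert a s ha ih => rw [Finset.sum_insert ha, Finset.prod_insert ha, zP_add, ih]

lemma zP_pt (q : ℂˣ) (j : ℕ) (b b' : ℂˣ) : zP q M N {(j, b)} = zP q M N {(j, b')} := by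
  funext i; simp [zP]

lemma f_zero (q : ℂˣ) (q1 : ∀ e : ℤ, e ≠ 0 → (q : ℂ) ^ e ≠ 1)
    (f : MvPolynomial (JJ M N) (Lau (Idx M N)))
    (H : ∀ P, chi (zP q M N P) (hP q M N P) f = 0) : f = 0 := by
  obtain ⟨T, hT⟩ := exists_T (q : ℂ) q.ne_zero q1 f.vars
  let D := f.totalDegree
  let Z0 : Idx M N → ℂˣ := ∏ p : T, zP q M N {(p.1.1.1, 1)} ^ D
  have hg : ∀ Q, MvPolynomial.map (evz (zP q M N Q * Z0)) f = 0 := by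
    intro Q
    set g := MvPolynomial.map (evz (zP q M N Q * Z0)) f with hgdef
    let h0 : JJ M N → ℂ := fun v => hP q M N Q v + ∑ p : T, (D : ℂ) * uu q M N (p.1.1.1, 1) v
    have key := grid g D (fun d hd => MvPolynomial.le_totalDegree
        (MvPolynomial.support_map_subset _ _ hd)) h0
      (fun (p : T) v => uu q M N (p.1.1.1, p.1.2) v - uu q M N (p.1.1.1, 1) v) (by
        intro m hm
        have := H (Q + ∑ p : T, (m p • {(p.1.1.1, p.1.2)} + (D - m p) • {(p.1.1.1, 1)}))
        have ez : zP q M N (Q + ∑ p : T, (m p • {(p.1.1.1, p.1.2)} + (D - m p) • {(p.1.1.1, 1)})) =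
            zP q M N Q * Z0 := by
          rw [zP_add, zP_sum]
          congr 1
          refine Finset.prod_congr rfl fun p _ => ?_
          rw [zP_add, zP_nsmul, zP_nsmul, zP_pt q _ p.1.2 1, ← pow_add, Nat.add_sub_cancel' (hm p)]
        have eh : hP q M N (Q + ∑ p : T, (m p • {(p.1.1.1, p.1.2)} +
            (D - m p) • {(p.1.1.1, 1)})) = fun v => h0 v + ∑ p : T, (m p : ℂ) *
              (uu q M N (p.1.1.1, p.1.2) v - uu q M N (p.1.1.1, 1) v) := by
          funext v
          rw [hP_add, hP_sum, add_assoc, ← Finset.sum_add_distrib]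
          congr 1
          refine Finset.sum_congr rfl fun p _ => ?_
          rw [hP_add, hP_nsmul, hP_nsmul, hP_singleton, hP_singleton, Nat.cast_sub (hm p)]
          ring
        rw [ez, eh] at this
        exact this)
    apply MvPolynomial.funext
    intro y
    obtain ⟨t, ht⟩ := hT (fun v => y v - h0 v)
    rw [map_zero, ← key t]
    refine MvPolynomial.eval₂Hom_congr' rfl ?_ rfl
    intro v hv _
    have := ht v (MvPolynomial.vars_map _ _ hv)
    rw [← this]
    ring
  apply MvPolynomial.ext
  intro d
  rw [MvPolynomial.coeff_zero]
  apply lau_zero q q1 Z0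
  intro Q
  rw [← MvPolynomial.coeff_map, hg, MvPolynomial.coeff_zero]

lemma inj_of (q : ℂ) (q0 : q ≠ 0) (q1 : ∀ e : ℤ, e ≠ 0 → q ^ e ≠ 1)
    (φ : MvPolynomial (JJ M N) (Lau (Idx M N)) →ₐ[ℂ] ALG q M N false 3)
    (h1 : ∀ g : JJ M N, φ (MvPolynomial.X g) = HA q M N false 3 g.1.1 g.2.1)
    (h2 : ∀ i : Idx M N, φ (MvPolynomial.C (AddMonoidAlgebra.single (Finsupp.single i 1) (1 : ℂ))) =
      KA q M N false 3 i.1) : Function.Injective φ := by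
  rw [injective_iff_map_eq_zero]
  intro f hf
  let qu : ℂˣ := Units.mk0 q q0
  apply f_zero qu q1
  intro P
  induction P using Quotient.inductionOn with
  | _ l =>
  let n := l.length
  let c : Fin n → ℕ := fun k => (l.get k).1
  let a : Fin n → ℂ := fun k => ((l.get k).2 : ℂ)
  have hz : ∀ (c : Fin n → ℕ) (i : Idx M N), Kf q M i.1 c ≠ 0 := fun c i =>
    Finset.prod_ne_zero_iff.2 fun k _ => zpow_ne_zero _ q0
  let z : (Fin n → ℕ) → Idx M N → ℂˣ := fun c i => Units.mk0 (Kf q M i.1 c) (hz c i)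
  have van := extend (M := M) q0 q1 (fun v : JJ M N => v.1.1) (fun v => v.2.1)
    (MvPolynomial.map (evz (z c)) f) c (by
      intro a ha
      have e := eval_formula (dg n) ((rep ha).comp φ) z
        (fun c (v : JJ M N) => Hf q M a v.1.1 v.2.1 c)
        (fun g => by rw [AlgHom.comp_apply, h1, rep_HA])
        (fun i => by rw [AlgHom.comp_apply, h2, rep_KA]; rfl) f
      rw [AlgHom.comp_apply, hf, map_zero] at e
      have e2 := congrFun (DFunLike.congr_fun e (fun _ => 1)) c
      rw [dg_apply, mul_one] at e2
      exact e2.symm) a (fun k => Units.ne_zero _)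
  have ez : zP qu M N (l : Multiset (ℕ × ℂˣ)) = z c := by
    funext i
    apply Units.ext
    simp only [zP, Multiset.map_coe, Multiset.prod_coe, z, Units.val_mk0, Kf, kap, c]
    rw [← Fin.prod_univ_fun_getElem, Units.coe_prod]
    refine Finset.prod_congr rfl fun k _ => ?_
    rw [Units.val_zpow_eq_zpow_val]
    rfl
  have eh : hP q M N (l : Multiset (ℕ × ℂˣ)) = fun v => Hf q M a v.1.1 v.2.1 c := by
    funext v
    simp only [hP, Multiset.map_coe, Multiset.sum_coe]
    rw [← Fin.sum_univ_fun_getElem]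
    rfl
  change chi (zP qu M N (l : Multiset (ℕ × ℂˣ))) (hP q M N (l : Multiset (ℕ × ℂˣ))) f = 0
  rw [ez, eh]
  exact van
end QAS

namespace QAS
open Finset Function

lemma mk_rel {q : ℂ} {M N : ℕ} {x y : FA M N false} (h : rel q M N false 3 x y) :
    mkA q M N false 3 x = mkA q M N false 3 y := RingQuot.mkAlgHom_rel ℂ h

lemma KA_eq (q : ℂ) {M N : ℕ} (i : Idx M N) :
    KA q M N false 3 i.1 = mkA q M N false 3 (gi (Gen.K i)) := by
  rw [KA, KF, dif_pos i.2]
lemma KiA_eq (q : ℂ) {M N : ℕ} (i : Idx M N) :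
    KiA q M N false 3 i.1 = mkA q M N false 3 (gi (Gen.Ki i)) := by
  rw [KiA, KiF, dif_pos i.2]
lemma HA_eq (q : ℂ) {M N : ℕ} (g : JJ M N) :
    HA q M N false 3 g.1.1 g.2.1 = mkA q M N false 3 (gi (Gen.H g.1 g.2)) := by
  rw [HA, HF, dif_pos ⟨g.1.2, g.2.2⟩]

lemma main_ex (q : ℂ) (hq0 : q ≠ 0) (hq1 : ∀ k : ℕ, k ≠ 0 → q ^ k ≠ 1) (M N : ℕ) :
    ∃ φ : MvPolynomial (Idx M N × {s : ℤ // s ≠ 0})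
        (AddMonoidAlgebra ℂ (Idx M N →₀ ℤ)) →ₐ[ℂ] ALG q M N false 3,
      (∀ g : Idx M N × {s : ℤ // s ≠ 0},
          φ (MvPolynomial.X g) = HA q M N false 3 g.1.1 g.2.1) ∧
      (∀ i : Idx M N,
          φ (MvPolynomial.C (AddMonoidAlgebra.single (Finsupp.single i 1) (1 : ℂ))) =
            KA q M N false 3 i.1) ∧
      Function.Injective φ ∧ φ.range = Azero q M N false 3 := by
  have q1 : ∀ e : ℤ, e ≠ 0 → q ^ e ≠ 1 := by
    intro e he h
    rcases Int.eq_nat_or_neg e with ⟨k, rfl | rfl⟩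
    · exact hq1 k (by simpa using he) (by simpa using h)
    · exact hq1 k (by simpa using he) (by simpa using h)
  obtain ⟨φ, e1, e2, e3⟩ := exists_hom (fun i : Idx M N => KA q M N false 3 i.1)
    (fun i : Idx M N => KiA q M N false 3 i.1)
    (fun g : JJ M N => HA q M N false 3 g.1.1 g.2.1)
    (fun i j => by
      rw [KA_eq, KA_eq, ← map_mul, ← map_mul]; exact mk_rel (rel.KK i j))
    (fun i j => by
      rw [KA_eq, KiA_eq, ← map_mul, ← map_mul]; exact mk_rel (rel.KKi2 i j))
    (fun i j => by
      rw [KiA_eq, KiA_eq, ← map_mul, ← map_mul]; exact mk_rel (rel.KiKi i j))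
    (fun i j => by
      rw [KA_eq, HA_eq, ← map_mul, ← map_mul]; exact mk_rel (rel.KH i j.1 j.2))
    (fun i j => by
      rw [KiA_eq, HA_eq, ← map_mul, ← map_mul]; exact mk_rel (rel.KiH i j.1 j.2))
    (fun i j => by
      rw [HA_eq, HA_eq, ← map_mul, ← map_mul]; exact mk_rel (rel.HH i.1 j.1 i.2 j.2))
    (fun i => by
      rw [KA_eq, KiA_eq, ← map_mul, mk_rel (rel.KKi i), map_one])
  refine ⟨φ, e1, e2, inj_of q hq0 q1 φ e1 e2, ?_⟩
  rw [e3, Azero]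
  apply le_antisymm
  · apply Algebra.adjoin_mono
    rintro _ ((⟨i, rfl⟩ | ⟨i, rfl⟩) | ⟨g, rfl⟩)
    · exact Or.inl ⟨_, rfl⟩
    · exact Or.inr (Or.inl ⟨_, rfl⟩)
    · exact Or.inr (Or.inr ⟨_, _, rfl⟩)
  · apply Algebra.adjoin_le
    rintro _ (⟨i, rfl⟩ | ⟨i, rfl⟩ | ⟨i, s, rfl⟩)
    · by_cases h : 1 ≤ i ∧ i ≤ M + N - 1
      · exact Algebra.subset_adjoin (Or.inl (Or.inl ⟨⟨i, h⟩, rfl⟩))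
      · rw [KA, KF, dif_neg h, map_zero]; exact zero_mem _
    · by_cases h : 1 ≤ i ∧ i ≤ M + N - 1
      · exact Algebra.subset_adjoin (Or.inl (Or.inr ⟨⟨i, h⟩, rfl⟩))
      · rw [KiA, KiF, dif_neg h, map_zero]; exact zero_mem _
    · by_cases h : (1 ≤ i ∧ i ≤ M + N - 1) ∧ s ≠ 0
      · exact Algebra.subset_adjoin (Or.inr ⟨(⟨i, h.1⟩, ⟨s, h.2⟩), rfl⟩)
      · rw [HA, HF, dif_neg h, map_zero]; exact zero_mem _
end QAS


open QAS in
/-- the natural homomorphism from the polynomial algebra in the `h_{i,s}`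
over the Laurent polynomial algebra (group algebra of `ℤ^{M+N-1}`) in the `K_i` to `U⁰`,
sending each generator to the element of the same name, is injective with image `U⁰`. -/
theorem Uzero_Laurent (q : ℂ) (hq0 : q ≠ 0)
    (hq1 : ∀ k : ℕ, k ≠ 0 → q ^ k ≠ 1) (M N : ℕ) (hM : 1 ≤ M) (hN : 1 ≤ N) :
    ∃ φ : MvPolynomial (Idx M N × {s : ℤ // s ≠ 0})
        (AddMonoidAlgebra ℂ (Idx M N →₀ ℤ)) →ₐ[ℂ] ALG q M N false 3,
      (∀ g : Idx M N × {s : ℤ // s ≠ 0},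
          φ (MvPolynomial.X g) = HA q M N false 3 g.1.1 g.2.1) ∧
      (∀ i : Idx M N,
          φ (MvPolynomial.C (AddMonoidAlgebra.single (Finsupp.single i 1) (1 : ℂ))) =
            KA q M N false 3 i.1) ∧
      Function.Injective φ ∧ φ.range = Azero q M N false 3 := by
  exact main_ex q hq0 hq1 M N
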